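/- Convergence of the iteration: For ε sufficiently small, the sequence of iterates (α¹₊,ₙ, β²₊,ₙ, xₙ), n = 0, 1, 2, …, of the shock interaction iteration scheme converges in B_A × B_B × B_{N₀}; that is, α¹₊,ₙ, β²₊,ₙ and xₙ converge uniformly, together with all their derivatives up to second order, to limits α¹₊ ∈ B_A, β²₊ ∈ B_B, x ∈ B_{N₀}. -/

import Mathlib

noncomputable section

open Set Filter

namespace ShockInteraction

/-- Partial derivative with respect to the first coordinate. -/
def pu (f : ℝ × ℝ → ℝ) (q : ℝ × ℝ) : ℝ := deriv (fun s => f (s, q.2)) q.1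

/-- Partial derivative with respect to the second coordinate. -/
def pv (f : ℝ × ℝ → ℝ) (q : ℝ × ℝ) : ℝ := deriv (fun s => f (q.1, s)) q.2

/-- The characteristic triangle `T_ε = {(u,v) : 0 ≤ u ≤ v ≤ u/a ≤ ε}`. -/
def Teps (a ε : ℝ) : Set (ℝ × ℝ) :=
  {q | 0 ≤ q.1 ∧ q.1 ≤ q.2 ∧ q.2 ≤ q.1 / a ∧ q.1 / a ≤ ε}

/-- The data of the shock interaction problem:  a barotropic pressure law `p` with sound
speed `η = √(dp/dρ)`, a primitive `σ` of `η(ρ)/ρ` with inverse `R` (so that the density and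
velocity are smooth functions `ρ(α,β) = R((α+β)/2)`, `w(α,β) = (α−β)/2` of the Riemann
invariants), two smooth solutions `(ρ*ⁱ, wⁱ*)` of the Euler equations on the future
developments `Dⁱ` of the data for `x ≤ 0` and `x ≥ 0` (coordinates `(t,x)`), and a solution
`(ρ₀, w₀ = 0, V¹₀, V²₀)` of the Rankine–Hugoniot conditions at the interaction point
`(0,0)` satisfying the determinism conditions and `V¹₀ < 0 < V²₀`. -/
structure Setup where
  p : ℝ → ℝ
  η : ℝ → ℝ
  σ : ℝ → ℝ
  R : ℝ → ℝ
  ρst₁ : ℝ × ℝ → ℝ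
  wst₁ : ℝ × ℝ → ℝ
  ρst₂ : ℝ × ℝ → ℝ
  wst₂ : ℝ × ℝ → ℝ
  D₁ : Set (ℝ × ℝ)
  D₂ : Set (ℝ × ℝ)
  ρ₀ : ℝ
  V₁₀ : ℝ
  V₂₀ : ℝ
  hp : ContDiffOn ℝ (⊤ : ℕ∞) p (Ioi 0)
  hp' : ∀ r > (0 : ℝ), 0 < deriv p r
  hη : ∀ r > (0 : ℝ), η r = Real.sqrt (deriv p r)
  hσ : ∀ r > (0 : ℝ), HasDerivAt σ (η r / r) r
  hR : ContDiff ℝ (⊤ : ℕ∞) R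
  hRpos : ∀ s, 0 < R s
  hRσ : ∀ s, σ (R s) = s
  hρ₀ : 0 < ρ₀
  hD₁ : IsOpen D₁
  hD₂ : IsOpen D₂
  hD₁0 : (0, 0) ∈ closure D₁
  hD₂0 : (0, 0) ∈ closure D₂
  hρst₁ : ContDiff ℝ (⊤ : ℕ∞) ρst₁
  hwst₁ : ContDiff ℝ (⊤ : ℕ∞) wst₁
  hρst₂ : ContDiff ℝ (⊤ : ℕ∞) ρst₂
  hwst₂ : ContDiff ℝ (⊤ : ℕ∞) wst₂
  hρst₁pos : ∀ q ∈ closure D₁, 0 < ρst₁ q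
  hρst₂pos : ∀ q ∈ closure D₂, 0 < ρst₂ q
  heuler₁ : ∀ q ∈ D₁,
    pu ρst₁ q + pv (fun q' => ρst₁ q' * wst₁ q') q = 0 ∧
    pu wst₁ q + wst₁ q * pv wst₁ q = -(1 / ρst₁ q) * pv (fun q' => p (ρst₁ q')) q
  heuler₂ : ∀ q ∈ D₂,
    pu ρst₂ q + pv (fun q' => ρst₂ q' * wst₂ q') q = 0 ∧
    pu wst₂ q + wst₂ q * pv wst₂ q = -(1 / ρst₂ q) * pv (fun q' => p (ρst₂ q')) q
  hjump₁V : (ρ₀ - ρst₁ (0, 0)) * V₁₀ = -(ρst₁ (0, 0) * wst₁ (0, 0))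
  hjump₁M : (-(ρst₁ (0, 0) * wst₁ (0, 0))) * V₁₀ =
    p ρ₀ - (ρst₁ (0, 0) * wst₁ (0, 0) ^ 2 + p (ρst₁ (0, 0)))
  hjump₂V : (ρ₀ - ρst₂ (0, 0)) * V₂₀ = -(ρst₂ (0, 0) * wst₂ (0, 0))
  hjump₂M : (-(ρst₂ (0, 0) * wst₂ (0, 0))) * V₂₀ =
    p ρ₀ - (ρst₂ (0, 0) * wst₂ (0, 0) ^ 2 + p (ρst₂ (0, 0)))
  hdet₁l : -η ρ₀ < V₁₀
  hdet₁r : V₁₀ < wst₁ (0, 0) - η (ρst₁ (0, 0))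
  hdet₂l : wst₂ (0, 0) + η (ρst₂ (0, 0)) < V₂₀
  hdet₂r : V₂₀ < η ρ₀
  hV₁₀neg : V₁₀ < 0
  hV₂₀pos : 0 < V₂₀

/-- The sound speed `η₀` of the state behind at the interaction point. -/
def η₀ (S : Setup) : ℝ := S.η S.ρ₀

/-- The constant `a = ((η₀+V¹₀)/(η₀−V¹₀))·((η₀−V²₀)/(η₀+V²₀)) ∈ (0,1)` determining the right
shock curve `u = av` in characteristic coordinates. -/
def aconst (S : Setup) : ℝ :=
  ((η₀ S + S.V₁₀) / (η₀ S - S.V₁₀)) * ((η₀ S - S.V₂₀) / (η₀ S + S.V₂₀))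

/-- The constant `Γ₀ = −(η₀+V¹₀)/(η₀−V¹₀)`. -/
def Γ₀ (S : Setup) : ℝ := -(η₀ S + S.V₁₀) / (η₀ S - S.V₁₀)

/-- The common value `β₀ = σ(ρ₀)` of the Riemann invariants of the state behind at the
interaction point (where `w₀ = 0`). -/
def β₀ (S : Setup) : ℝ := S.σ S.ρ₀

/-- Density as a function of the Riemann invariants. -/
def ρf (S : Setup) (α β : ℝ) : ℝ := S.R ((α + β) / 2)

/-- Velocity as a function of the Riemann invariants. -/
def wf (α β : ℝ) : ℝ := (α - β) / 2

/-- Incoming characteristic speed `c_in = w − η(ρ)` as a function of the Riemann invariants. -/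
def cin (S : Setup) (α β : ℝ) : ℝ := wf α β - S.η (ρf S α β)

/-- Outgoing characteristic speed `c_out = w + η(ρ)` as a function of the Riemann invariants. -/
def cout (S : Setup) (α β : ℝ) : ℝ := wf α β + S.η (ρf S α β)

/-- The jump function `J = [ρw]² − [ρw² + p(ρ)]·[ρ]` in terms of the Riemann invariants. -/
def Jf (S : Setup) (ap bp am bm : ℝ) : ℝ :=
  (ρf S ap bp * wf ap bp - ρf S am bm * wf am bm) ^ 2 -
    (ρf S ap bp * wf ap bp ^ 2 + S.p (ρf S ap bp)
      - ρf S am bm * wf am bm ^ 2 - S.p (ρf S am bm)) * (ρf S ap bp - ρf S am bm)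

/-- The Riemann invariant `α¹*` of the state ahead of the left moving shock. -/
def αst₁ (S : Setup) : ℝ × ℝ → ℝ := fun q => S.σ (S.ρst₁ q) + S.wst₁ q

/-- The Riemann invariant `β¹*` of the state ahead of the left moving shock. -/
def βst₁ (S : Setup) : ℝ × ℝ → ℝ := fun q => S.σ (S.ρst₁ q) - S.wst₁ q

/-- The Riemann invariant `α²*` of the state ahead of the right moving shock. -/
def αst₂ (S : Setup) : ℝ × ℝ → ℝ := fun q => S.σ (S.ρst₂ q) + S.wst₂ q

/-- The Riemann invariant `β²*` of the state ahead of the right moving shock. -/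
def βst₂ (S : Setup) : ℝ × ℝ → ℝ := fun q => S.σ (S.ρst₂ q) - S.wst₂ q

/-- Partial derivative of `J` with respect to `α₊`. -/
def Jαp (S : Setup) (ap bp am bm : ℝ) : ℝ := deriv (fun s => Jf S s bp am bm) ap

/-- Partial derivative of `J` with respect to `β₊`. -/
def Jβp (S : Setup) (ap bp am bm : ℝ) : ℝ := deriv (fun s => Jf S ap s am bm) bp

/-- Partial derivative of `J` with respect to `α₋`. -/
def Jαm (S : Setup) (ap bp am bm : ℝ) : ℝ := deriv (fun s => Jf S ap bp s bm) am

/-- Partial derivative of `J` with respect to `β₋`. -/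
def Jβm (S : Setup) (ap bp am bm : ℝ) : ℝ := deriv (fun s => Jf S ap bp am s) bm

/-- `F¹₀ = −((V¹₀+η₀)/(η₀−V¹₀))²`. -/
def F₁₀ (S : Setup) : ℝ := -((S.V₁₀ + η₀ S) / (η₀ S - S.V₁₀)) ^ 2

/-- `F²₀ = −((η₀−V²₀)/(V²₀+η₀))²`. -/
def F₂₀ (S : Setup) : ℝ := -((η₀ S - S.V₂₀) / (S.V₂₀ + η₀ S)) ^ 2

/-- The Riemann invariants of the states ahead at the interaction point. -/
def αm₁₀ (S : Setup) : ℝ := αst₁ S (0, 0)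

def βm₁₀ (S : Setup) : ℝ := βst₁ S (0, 0)

def αm₂₀ (S : Setup) : ℝ := αst₂ S (0, 0)

def βm₂₀ (S : Setup) : ℝ := βst₂ S (0, 0)

/-- `M¹₁₀ = −(∂J/∂α₋)/(∂J/∂α₊)` at the interaction point, left shock. -/
def M₁₁₀ (S : Setup) : ℝ :=
  -(Jαm S (β₀ S) (β₀ S) (αm₁₀ S) (βm₁₀ S)) / Jαp S (β₀ S) (β₀ S) (αm₁₀ S) (βm₁₀ S)

/-- `M¹₂₀ = −(∂J/∂β₋)/(∂J/∂α₊)` at the interaction point, left shock. -/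
def M₁₂₀ (S : Setup) : ℝ :=
  -(Jβm S (β₀ S) (β₀ S) (αm₁₀ S) (βm₁₀ S)) / Jαp S (β₀ S) (β₀ S) (αm₁₀ S) (βm₁₀ S)

/-- `M²₁₀ = −(∂J/∂α₋)/(∂J/∂β₊)` at the interaction point, right shock. -/
def M₂₁₀ (S : Setup) : ℝ :=
  -(Jαm S (β₀ S) (β₀ S) (αm₂₀ S) (βm₂₀ S)) / Jβp S (β₀ S) (β₀ S) (αm₂₀ S) (βm₂₀ S)

/-- `M²₂₀ = −(∂J/∂β₋)/(∂J/∂β₊)` at the interaction point, right shock. -/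
def M₂₂₀ (S : Setup) : ℝ :=
  -(Jβm S (β₀ S) (β₀ S) (αm₂₀ S) (βm₂₀ S)) / Jβp S (β₀ S) (β₀ S) (αm₂₀ S) (βm₂₀ S)

/-- `dα¹₋/du(0)`, expressed through the first derivatives of `α¹*` at the origin. -/
def dαm₁ (S : Setup) : ℝ :=
  pu (αst₁ S) (0, 0) * (1 / η₀ S) * (1 - 1 / Γ₀ S) + pv (αst₁ S) (0, 0) * (1 / Γ₀ S + 1)

/-- `dβ¹₋/du(0)`. -/
def dβm₁ (S : Setup) : ℝ :=
  pu (βst₁ S) (0, 0) * (1 / η₀ S) * (1 - 1 / Γ₀ S) + pv (βst₁ S) (0, 0) * (1 / Γ₀ S + 1)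

/-- `dα²₋/dv(0)`. -/
def dαm₂ (S : Setup) : ℝ :=
  pu (αst₂ S) (0, 0) * (1 / η₀ S) * (1 - aconst S / Γ₀ S)
    + pv (αst₂ S) (0, 0) * (aconst S / Γ₀ S + 1)

/-- `dβ²₋/dv(0)`. -/
def dβm₂ (S : Setup) : ℝ :=
  pu (βst₂ S) (0, 0) * (1 / η₀ S) * (1 - aconst S / Γ₀ S)
    + pv (βst₂ S) (0, 0) * (aconst S / Γ₀ S + 1)

/-- The inhomogeneity `a₀` of the linear system for `(α₀′, β₀′)`. -/
def a₀ (S : Setup) : ℝ := M₁₁₀ S * dαm₁ S + M₁₂₀ S * dβm₁ S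

/-- The inhomogeneity `b₀` of the linear system for `(α₀′, β₀′)`. -/
def b₀ (S : Setup) : ℝ := M₂₁₀ S * dαm₂ S + M₂₂₀ S * dβm₂ S

/-- `α₀′`, the unique solution together with `β₀′` of
`α₀′ = F¹₀ β₀′ + a₀`, `β₀′ = a F²₀ α₀′ + b₀`. -/
def α₀' (S : Setup) : ℝ := (a₀ S + F₁₀ S * b₀ S) / (1 - aconst S * F₁₀ S * F₂₀ S)

/-- `β₀′`, the unique solution together with `α₀′` of
`α₀′ = F¹₀ β₀′ + a₀`, `β₀′ = a F²₀ α₀′ + b₀`. -/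
def β₀' (S : Setup) : ℝ := (b₀ S + aconst S * F₂₀ S * a₀ S) / (1 - aconst S * F₁₀ S * F₂₀ S)

/-- **The shock interaction problem in characteristic coordinates.**
The functions `α, β, t, x` (of the characteristic coordinates `(u,v) ∈ T_ε`) are a `C²`
solution of the shock interaction problem:
(i) the characteristic system holds on `T_ε` and `t(0,0) = x(0,0) = 0`;
(ii) the shock curves `u ↦ (t,x)(u,u)` (left) and `v ↦ (t,x)(av,v)` (right) lie in the
respective future developments and satisfy the shock boundary conditions `dx₊ = V dt₊` with
`V = [ρw]/[ρ]`;
(iii) the jump conditions `J = 0` hold along both shocks;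
(iv) at the interaction point `α = β = β₀`, `∂α/∂u = α₀′`, `∂β/∂v = β₀′`, `Vⁱ(0) = Vⁱ₀`;
(v) the determinism conditions hold along both shocks. -/
def SolvesSIP (S : Setup) (ε : ℝ) (α β t x : ℝ × ℝ → ℝ) : Prop :=
  let a := aconst S
  let lα : ℝ → ℝ := fun u => α (u, u)
  let lβ : ℝ → ℝ := fun u => β (u, u)
  let lt : ℝ → ℝ := fun u => t (u, u)
  let lx : ℝ → ℝ := fun u => x (u, u)
  let rα : ℝ → ℝ := fun v => α (a * v, v)
  let rβ : ℝ → ℝ := fun v => β (a * v, v)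
  let rt : ℝ → ℝ := fun v => t (a * v, v)
  let rx : ℝ → ℝ := fun v => x (a * v, v)
  let lαm : ℝ → ℝ := fun u => αst₁ S (lt u, lx u)
  let lβm : ℝ → ℝ := fun u => βst₁ S (lt u, lx u)
  let rαm : ℝ → ℝ := fun v => αst₂ S (rt v, rx v)
  let rβm : ℝ → ℝ := fun v => βst₂ S (rt v, rx v)
  let V₁ : ℝ → ℝ := fun u =>
    (ρf S (lα u) (lβ u) * wf (lα u) (lβ u) - ρf S (lαm u) (lβm u) * wf (lαm u) (lβm u)) /
      (ρf S (lα u) (lβ u) - ρf S (lαm u) (lβm u))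
  let V₂ : ℝ → ℝ := fun v =>
    (ρf S (rα v) (rβ v) * wf (rα v) (rβ v) - ρf S (rαm v) (rβm v) * wf (rαm v) (rβm v)) /
      (ρf S (rα v) (rβ v) - ρf S (rαm v) (rβm v))
  -- regularity
  (ContDiffOn ℝ 2 α (Teps a ε) ∧ ContDiffOn ℝ 2 β (Teps a ε) ∧
    ContDiffOn ℝ 2 t (Teps a ε) ∧ ContDiffOn ℝ 2 x (Teps a ε)) ∧
  -- (i) characteristic system
  (t (0, 0) = 0 ∧ x (0, 0) = 0) ∧
  (∀ q ∈ Teps a ε,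
    pu x q = cin S (α q) (β q) * pu t q ∧
    pv x q = cout S (α q) (β q) * pv t q ∧
    pv α q = 0 ∧ pu β q = 0) ∧
  -- (ii), (iii), (v) along the left shock
  (∀ u ∈ Icc (0 : ℝ) (a * ε),
    (lt u, lx u) ∈ closure S.D₁ ∧
    deriv lx u = V₁ u * deriv lt u ∧
    Jf S (lα u) (lβ u) (lαm u) (lβm u) = 0 ∧
    cin S (lα u) (lβ u) < V₁ u ∧ V₁ u < cin S (lαm u) (lβm u)) ∧
  -- (ii), (iii), (v) along the right shock
  (∀ v ∈ Icc (0 : ℝ) ε,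
    (rt v, rx v) ∈ closure S.D₂ ∧
    deriv rx v = V₂ v * deriv rt v ∧
    Jf S (rα v) (rβ v) (rαm v) (rβm v) = 0 ∧
    cout S (rαm v) (rβm v) < V₂ v ∧ V₂ v < cout S (rα v) (rβ v)) ∧
  -- (iv) conditions at the interaction point
  (α (0, 0) = β₀ S ∧ β (0, 0) = β₀ S ∧
    pu α (0, 0) = α₀' S ∧ pv β (0, 0) = β₀' S ∧
    V₁ 0 = S.V₁₀ ∧ V₂ 0 = S.V₂₀)

/-- Extended data for the iteration scheme: in addition to the `Setup` data, the smooth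
implicit solutions `H¹, H²` (furnished by the implicit function theorem at the
interaction-point data) of the jump condition `J = 0` for the Riemann invariant behind. -/
structure IterSetup extends Setup where
  H₁ : ℝ × ℝ × ℝ → ℝ
  H₂ : ℝ × ℝ × ℝ → ℝ
  U₁ : Set (ℝ × ℝ × ℝ)
  U₂ : Set (ℝ × ℝ × ℝ)
  hU₁ : IsOpen U₁
  hU₂ : IsOpen U₂
  hU₁mem : (β₀ toSetup, αm₁₀ toSetup, βm₁₀ toSetup) ∈ U₁
  hU₂mem : (β₀ toSetup, αm₂₀ toSetup, βm₂₀ toSetup) ∈ U₂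
  hH₁ : ContDiffOn ℝ (⊤ : ℕ∞) H₁ U₁
  hH₂ : ContDiffOn ℝ (⊤ : ℕ∞) H₂ U₂
  hH₁val : H₁ (β₀ toSetup, αm₁₀ toSetup, βm₁₀ toSetup) = β₀ toSetup
  hH₂val : H₂ (β₀ toSetup, αm₂₀ toSetup, βm₂₀ toSetup) = β₀ toSetup
  hH₁J : ∀ y ∈ U₁, Jf toSetup (H₁ y) y.1 y.2.1 y.2.2 = 0
  hH₂J : ∀ y ∈ U₂, Jf toSetup y.1 (H₂ y) y.2.1 y.2.2 = 0

/-- A triple `(α¹₊, β²₊, x)` on which the iteration scheme operates. -/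
abbrev Triple : Type := (ℝ → ℝ) × (ℝ → ℝ) × (ℝ × ℝ → ℝ)

/-- One step of the iteration scheme: from `(α¹₊,ₙ, β²₊,ₙ, xₙ)` to
`(α¹₊,ₙ₊₁, β²₊,ₙ₊₁, xₙ₊₁)`, following the construction in the paper:
`αₙ(u,v) = α¹₊,ₙ(u)`, `βₙ(u,v) = β²₊,ₙ(v)`; `tₙ` by integration of the characteristic
system; states ahead by composing `αⁱ*, βⁱ*` with the shock traces; shock speeds `Vⁱₙ` by
the jump formula; `Γⁱₙ`, `μₙ`, `νₙ`, `Mₙ`, `γⁱₙ`, `Λⁱₙ`, `Φⁱₙ` as in the text; `xₙ₊₁` by the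
double-integral formula and `α¹₊,ₙ₊₁`, `β²₊,ₙ₊₁` via the implicit functions `H¹`, `H²`. -/
def step (T : IterSetup) (P : Triple) : Triple :=
  let S := T.toSetup
  let a := aconst S
  let A1 := P.1
  let B2 := P.2.1
  let X := P.2.2
  let cinn : ℝ × ℝ → ℝ := fun q => cin S (A1 q.1) (B2 q.2)
  let coutn : ℝ × ℝ → ℝ := fun q => cout S (A1 q.1) (B2 q.2)
  let φ : ℝ × ℝ → ℝ := fun q => pu X q / cinn q
  let ψ : ℝ × ℝ → ℝ := fun q => pv X q / coutn q
  let tn : ℝ × ℝ → ℝ := fun q =>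
    (∫ u' in (0 : ℝ)..q.1, (φ (u', u') + ψ (u', u'))) + ∫ v' in q.1..q.2, ψ (q.1, v')
  let lt : ℝ → ℝ := fun u => tn (u, u)
  let lx : ℝ → ℝ := fun u => X (u, u)
  let rt : ℝ → ℝ := fun v => tn (a * v, v)
  let rx : ℝ → ℝ := fun v => X (a * v, v)
  let lαm : ℝ → ℝ := fun u => αst₁ S (lt u, lx u)
  let lβm : ℝ → ℝ := fun u => βst₁ S (lt u, lx u)
  let rαm : ℝ → ℝ := fun v => αst₂ S (rt v, rx v)
  let rβm : ℝ → ℝ := fun v => βst₂ S (rt v, rx v)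
  let lα : ℝ → ℝ := A1
  let lβ : ℝ → ℝ := B2
  let rα : ℝ → ℝ := fun v => A1 (a * v)
  let rβ : ℝ → ℝ := B2
  let V₁ : ℝ → ℝ := fun u =>
    (ρf S (lα u) (lβ u) * wf (lα u) (lβ u) - ρf S (lαm u) (lβm u) * wf (lαm u) (lβm u)) /
      (ρf S (lα u) (lβ u) - ρf S (lαm u) (lβm u))
  let V₂ : ℝ → ℝ := fun v =>
    (ρf S (rα v) (rβ v) * wf (rα v) (rβ v) - ρf S (rαm v) (rβm v) * wf (rαm v) (rβm v)) /
      (ρf S (rα v) (rβ v) - ρf S (rαm v) (rβm v))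
  let Γ₁ : ℝ → ℝ := fun u =>
    (cout S (lα u) (lβ u) / cin S (lα u) (lβ u)) *
      ((V₁ u - cin S (lα u) (lβ u)) / (cout S (lα u) (lβ u) - V₁ u))
  let Γ₂ : ℝ → ℝ := fun v =>
    a * (cout S (rα v) (rβ v) / cin S (rα v) (rβ v)) *
      ((V₂ v - cin S (rα v) (rβ v)) / (cout S (rα v) (rβ v) - V₂ v))
  let μ : ℝ × ℝ → ℝ := fun q => (1 / (coutn q - cinn q)) * (coutn q / cinn q) * pv cinn q
  let ν : ℝ × ℝ → ℝ := fun q => -((1 / (coutn q - cinn q)) * (cinn q / coutn q) * pu coutn q)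
  let Mn : ℝ × ℝ → ℝ := fun q => μ q * pu X q + ν q * pv X q
  let γ₁ : ℝ → ℝ := fun u => Γ₂ u / Γ₁ u
  let γ₂ : ℝ → ℝ := fun v => Γ₂ v / Γ₁ (a * v)
  let Λ₁ : ℝ → ℝ := fun u =>
    deriv γ₁ u * pu X (a * u, u) + a * γ₁ u * pu (fun q => pu X q) (a * u, u)
      + γ₁ u * Mn (a * u, u)
  let Λ₂ : ℝ → ℝ := fun v =>
    deriv γ₂ v * pv X (a * v, a * v) + a * γ₂ v * pv (fun q => pv X q) (a * v, a * v)
      + a * γ₂ v * Mn (a * v, a * v)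
  let Φ₁ : ℝ → ℝ := fun u =>
    (∫ u' in (0 : ℝ)..u, Λ₁ u') + (1 / Γ₁ u) * ∫ u' in (a * u)..u, Mn (u', u)
  let Φ₂ : ℝ → ℝ := fun v =>
    (∫ v' in (0 : ℝ)..v, Λ₂ v') + Γ₂ v * ∫ v' in (a * v)..v, Mn (a * v, v')
  let Xnext : ℝ × ℝ → ℝ := fun q =>
    q.1 / Γ₀ S + q.2 + (∫ u' in (0 : ℝ)..q.1, Φ₁ u') + (∫ v' in (0 : ℝ)..q.2, Φ₂ v')
      + (∫ v' in (0 : ℝ)..q.1, ∫ u' in (a * v')..v', Mn (u', v'))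
      + ∫ v' in q.1..q.2, ∫ u' in (a * v')..q.1, Mn (u', v')
  let A1next : ℝ → ℝ := fun u => T.H₁ (B2 u, lαm u, lβm u)
  let B2next : ℝ → ℝ := fun v => T.H₂ (A1 (a * v), rαm v, rβm v)
  (A1next, B2next, Xnext)

/-- The sequence of iterates of the shock interaction iteration scheme, initialized by
`x₀(u,v) = u/Γ₀ + v`, `α¹₊,₀(u) = β₀ + α₀′u`, `β²₊,₀(v) = β₀ + β₀′v`. -/
def seq (T : IterSetup) : ℕ → Triple
  | 0 => (fun u => β₀ T.toSetup + α₀' T.toSetup * u,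
      fun v => β₀ T.toSetup + β₀' T.toSetup * v,
      fun q => q.1 / Γ₀ T.toSetup + q.2)
  | n + 1 => step T (seq T n)

/-- Membership in the ball `B_{N₀}` of `C²(T_ε)` functions with the prescribed values at the
interaction point and second derivatives bounded by `N₀`. -/
def memBN (S : Setup) (ε N₀ : ℝ) (f : ℝ × ℝ → ℝ) : Prop :=
  ContDiffOn ℝ 2 f (Teps (aconst S) ε) ∧
  f (0, 0) = 0 ∧ pu f (0, 0) = 1 / Γ₀ S ∧ pv f (0, 0) = 1 ∧
  ∀ q ∈ Teps (aconst S) ε,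
    |pu (fun q' => pu f q') q| ≤ N₀ ∧ |pv (fun q' => pu f q') q| ≤ N₀ ∧
    |pv (fun q' => pv f q') q| ≤ N₀

/-- Membership in the ball `B_A` of `C²[0, aε]` functions with `f(0) = β₀`, `f′(0) = α₀′`
and second derivative bounded by `A`. -/
def memBA (S : Setup) (ε A : ℝ) (f : ℝ → ℝ) : Prop :=
  ContDiffOn ℝ 2 f (Icc 0 (aconst S * ε)) ∧
  f 0 = β₀ S ∧ deriv f 0 = α₀' S ∧
  ∀ u ∈ Icc (0 : ℝ) (aconst S * ε), |deriv (deriv f) u| ≤ A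

/-- Membership in the ball `B_B` of `C²[0, ε]` functions with `f(0) = β₀`, `f′(0) = β₀′`
and second derivative bounded by `B`. -/
def memBB (S : Setup) (ε B : ℝ) (f : ℝ → ℝ) : Prop :=
  ContDiffOn ℝ 2 f (Icc 0 ε) ∧
  f 0 = β₀ S ∧ deriv f 0 = β₀' S ∧
  ∀ v ∈ Icc (0 : ℝ) ε, |deriv (deriv f) v| ≤ B

open Metric Topology

section Analysis

theorem mem_ball_prod {δ : ℝ} {q : ℝ × ℝ} :
    q ∈ ball (0 : ℝ × ℝ) δ ↔ |q.1| < δ ∧ |q.2| < δ := by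
  rw [mem_ball_zero_iff, Prod.norm_def, max_lt_iff, Real.norm_eq_abs, Real.norm_eq_abs]

theorem mem_ball_real {δ u : ℝ} : u ∈ ball (0 : ℝ) δ ↔ |u| < δ := by
  rw [mem_ball_zero_iff, Real.norm_eq_abs]

theorem abs_le_max_of_mem_uIcc {x y t : ℝ} (ht : t ∈ uIcc x y) : |t| ≤ max |x| |y| := by
  rw [mem_uIcc] at ht
  rcases ht with h | h
  · exact abs_le_max_abs_abs h.1 h.2
  · rw [max_comm]; exact abs_le_max_abs_abs h.1 h.2

theorem continuousOn_parametric_intervalIntegral {Y Y' : Type*} [NormedAddCommGroup Y]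
    [NormedAddCommGroup Y'] {f : Y' → ℝ} {δ : ℝ} (hf : ContinuousOn f (ball 0 δ))
    {j : Y → ℝ → Y'} (hj : Continuous (Function.uncurry j))
    (hjn : ∀ y t, ‖j y t‖ ≤ max ‖y‖ |t|) {α β : Y → ℝ} (hα : Continuous α) (hβ : Continuous β)
    (hαn : ∀ y, |α y| ≤ ‖y‖) (hβn : ∀ y, |β y| ≤ ‖y‖) :
    ContinuousOn (fun y => ∫ t in α y..β y, f (j y t)) (ball 0 δ) := by
  intro y₀ hy₀
  rw [mem_ball_zero_iff] at hy₀
  obtain ⟨r, hr₀, hr⟩ := exists_between hy₀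
  obtain ⟨g, hg⟩ := ContinuousMap.exists_restrict_eq (isClosed_closedBall (x := (0 : Y')) (ε := r))
    ⟨(closedBall (0 : Y') r).domRestrict f,
      (hf.mono (closedBall_subset_ball hr)).domRestrict⟩
  have hg' : ∀ x ∈ closedBall (0 : Y') r, g x = f x := fun x hx =>
    DFunLike.congr_fun hg ⟨x, hx⟩
  have hcont : Continuous (fun y => ∫ t in α y..β y, g (j y t)) := by
    have hc : Continuous (Function.uncurry fun y t => g (j y t)) := g.continuous.comp hj
    have h1 := intervalIntegral.continuous_parametric_intervalIntegral_of_continuous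
      (μ := MeasureTheory.volume) (a₀ := 0) hc hα
    have h2 := intervalIntegral.continuous_parametric_intervalIntegral_of_continuous
      (μ := MeasureTheory.volume) (a₀ := 0) hc hβ
    refine (h2.sub h1).congr fun y => ?_
    have hcy : Continuous fun t => g (j y t) := hc.comp (Continuous.prodMk_right y)
    exact intervalIntegral.integral_interval_sub_left (hcy.intervalIntegrable _ _)
      (hcy.intervalIntegrable _ _)
  refine (hcont.continuousAt.congr ?_).continuousWithinAt
  filter_upwards [isOpen_ball.mem_nhds (show y₀ ∈ ball (0 : Y) r by simpa using hr₀)] with y hy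
  rw [mem_ball_zero_iff] at hy
  refine intervalIntegral.integral_congr fun t ht => hg' _ ?_
  rw [mem_closedBall_zero_iff]
  exact (hjn y t).trans (max_le hy.le ((abs_le_max_of_mem_uIcc ht).trans
    (max_le ((hαn y).trans hy.le) ((hβn y).trans hy.le))))

theorem continuousOn_slice_right {f : ℝ × ℝ → ℝ} {δ y : ℝ} (hf : ContinuousOn f (ball 0 δ))
    (hy : |y| < δ) : ContinuousOn (fun t => f (y, t)) (ball 0 δ) :=
  hf.comp (by fun_prop) fun t ht => mem_ball_prod.2 ⟨hy, mem_ball_real.1 ht⟩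

theorem uIcc_subset_ball {δ x y : ℝ} (hx : |x| < δ) (hy : |y| < δ) : uIcc x y ⊆ ball 0 δ :=
  fun _ ht => mem_ball_real.2 ((abs_le_max_of_mem_uIcc ht).trans_lt (max_lt hx hy))

theorem intervalIntegrable_of_continuousOn_ball {f : ℝ → ℝ} {δ x y : ℝ}
    (hf : ContinuousOn f (ball 0 δ)) (hx : |x| < δ) (hy : |y| < δ) :
    IntervalIntegrable f MeasureTheory.volume x y :=
  (hf.mono (uIcc_subset_ball hx hy)).intervalIntegrable

theorem hasDerivAt_primitive {f : ℝ → ℝ} {δ c x : ℝ}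
    (hf : ContinuousOn f (ball 0 δ)) (hc : |c| < δ) (hx : |x| < δ) :
    HasDerivAt (fun z => ∫ t in c..z, f t) (f x) x := by
  have hx' : x ∈ ball (0 : ℝ) δ := mem_ball_real.2 hx
  exact intervalIntegral.integral_hasDerivAt_right (intervalIntegrable_of_continuousOn_ball hf hc hx)
    (hf.stronglyMeasurableAtFilter isOpen_ball x hx') (hf.continuousAt (isOpen_ball.mem_nhds hx'))

/-- A function with continuous partial derivatives on a box is differentiable there. -/
theorem hasFDerivAt_of_partials {f fu fv : ℝ × ℝ → ℝ} {δ : ℝ}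
    (hfu : ContinuousOn fu (ball 0 δ)) (hfv : ContinuousOn fv (ball 0 δ))
    (hu : ∀ q ∈ ball (0 : ℝ × ℝ) δ, HasDerivAt (fun x => f (x, q.2)) (fu q) q.1)
    (hv : ∀ q ∈ ball (0 : ℝ × ℝ) δ, HasDerivAt (fun y => f (q.1, y)) (fv q) q.2)
    {q : ℝ × ℝ} (hq : q ∈ ball (0 : ℝ × ℝ) δ) :
    HasFDerivAt f (fu q • ContinuousLinearMap.fst ℝ ℝ ℝ + fv q • ContinuousLinearMap.snd ℝ ℝ ℝ)
      q := by
  have hn : ball (0 : ℝ × ℝ) δ ∈ 𝓝 q := isOpen_ball.mem_nhds hq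
  have h := hasStrictFDerivAt_uncurry_coprod (𝕜 := ℝ) (u := q) (f := fun x y => f (x, y))
    (f₁ := fun x y => ContinuousLinearMap.toSpanSingleton ℝ (fu (x, y)))
    (f₂ := fun x y => ContinuousLinearMap.toSpanSingleton ℝ (fv (x, y)))
    (by filter_upwards [hn] with v hv' using (hu v hv').hasFDerivAt)
    (by filter_upwards [hn] with v hv' using (hv v hv').hasFDerivAt)
    ((ContinuousLinearMap.toSpanSingletonCLE (𝕜 := ℝ) (E := ℝ)).continuous.continuousAt.comp
      (hfu.continuousAt hn))
    ((ContinuousLinearMap.toSpanSingletonCLE (𝕜 := ℝ) (E := ℝ)).continuous.continuousAt.comp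
      (hfv.continuousAt hn))
  have h2 : HasFDerivAt f _ q := h.hasFDerivAt
  refine h2.congr_fderiv ?_
  ext <;> simp [Function.HasUncurry.uncurry]

theorem hasDerivAt_parametric_intervalIntegral {f fu : ℝ × ℝ → ℝ} {δ : ℝ}
    (hf : ContinuousOn f (ball 0 δ)) (hfu : ContinuousOn fu (ball 0 δ))
    (hu : ∀ q ∈ ball (0 : ℝ × ℝ) δ, HasDerivAt (fun x => f (x, q.2)) (fu q) q.1)
    {x c d : ℝ} (hx : |x| < δ) (hc : |c| < δ) (hd : |d| < δ) :
    HasDerivAt (fun y => ∫ t in c..d, f (y, t)) (∫ t in c..d, fu (x, t)) x := by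
  obtain ⟨r, hr₁, hr⟩ := exists_between (max_lt hx (max_lt hc hd))
  have hcomp : IsCompact (closedBall (0 : ℝ × ℝ) r) := isCompact_closedBall _ _
  obtain ⟨K, hK⟩ := hcomp.exists_bound_of_continuousOn (hfu.mono (closedBall_subset_ball hr))
  have hxr := (le_max_left _ _).trans_lt hr₁
  have hcdr := (le_max_right _ _).trans_lt hr₁
  have hsub : ∀ {g : ℝ × ℝ → ℝ}, ContinuousOn g (ball 0 δ) → ∀ {y}, |y| < r →
      IntervalIntegrable (fun t => g (y, t)) MeasureTheory.volume c d := fun hg y hy =>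
    intervalIntegrable_of_continuousOn_ball (continuousOn_slice_right hg (hy.trans hr)) hc hd
  have hI : ∀ t ∈ uIoc c d, |t| < r := fun t ht =>
    (abs_le_max_of_mem_uIcc (uIoc_subset_uIcc ht)).trans_lt hcdr
  refine (intervalIntegral.hasDerivAt_integral_of_dominated_loc_of_deriv_le
    (F := fun y t => f (y, t)) (F' := fun y t => fu (y, t)) (bound := fun _ => K)
    (isOpen_ball.mem_nhds (mem_ball_real.2 hxr)) ?_ (hsub hf hxr) (hsub hfu hxr).def'.1 ?_
    (by simp) ?_).2
  · filter_upwards [isOpen_ball.mem_nhds (mem_ball_real.2 hxr)] with y hy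
    exact (hsub hf (mem_ball_real.1 hy)).def'.1
  · refine Eventually.of_forall fun t ht y hy => hK _ ?_
    exact ball_subset_closedBall (mem_ball_prod.2 ⟨mem_ball_real.1 hy, hI t ht⟩)
  · refine Eventually.of_forall fun t ht y hy => hu (y, t) ?_
    exact mem_ball_prod.2 ⟨(mem_ball_real.1 hy).trans hr, (hI t ht).trans hr⟩

/-- Leibniz rule for an integral along the second variable. -/
theorem hasDerivAt_integral_snd {f fu : ℝ × ℝ → ℝ} {δ : ℝ}
    (hf : ContinuousOn f (ball 0 δ)) (hfu : ContinuousOn fu (ball 0 δ))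
    (hu : ∀ q ∈ ball (0 : ℝ × ℝ) δ, HasDerivAt (fun x => f (x, q.2)) (fu q) q.1)
    {p α β : ℝ → ℝ} {x p' α' β' : ℝ} (hp : HasDerivAt p p' x) (hα : HasDerivAt α α' x)
    (hβ : HasDerivAt β β' x) (hpx : |p x| < δ) (hαx : |α x| < δ) (hβx : |β x| < δ) :
    HasDerivAt (fun y => ∫ t in α y..β y, f (p y, t))
      (β' * f (p x, β x) - α' * f (p x, α x) + p' * ∫ t in α x..β x, fu (p x, t)) x := by
  have h0 : |(0 : ℝ)| < δ := by simpa using (abs_nonneg _).trans_lt hpx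
  have h_int : ∀ {g : ℝ × ℝ → ℝ}, ContinuousOn g (ball 0 δ) → ∀ {y c d}, |y| < δ → |c| < δ →
      |d| < δ → IntervalIntegrable (fun t => g (y, t)) MeasureTheory.volume c d :=
    fun hg y c d hy hc hd =>
      intervalIntegrable_of_continuousOn_ball (continuousOn_slice_right hg hy) hc hd
  let G : ℝ × ℝ → ℝ := fun q => ∫ t in (0 : ℝ)..q.2, f (q.1, t)
  let Gu : ℝ × ℝ → ℝ := fun q => ∫ t in (0 : ℝ)..q.2, fu (q.1, t)
  have hGu : ContinuousOn Gu (ball 0 δ) :=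
    continuousOn_parametric_intervalIntegral (Y := ℝ × ℝ) (j := fun q t => (q.1, t)) hfu
      (by fun_prop) (fun q t => by
        rw [Prod.norm_def]; exact max_le_max (norm_fst_le q) le_rfl)
      continuous_const continuous_snd (by simp) (fun q => norm_snd_le q)
  have hG : ∀ q ∈ ball (0 : ℝ × ℝ) δ, HasFDerivAt G
      (Gu q • ContinuousLinearMap.fst ℝ ℝ ℝ + f q • ContinuousLinearMap.snd ℝ ℝ ℝ) q := by
    intro q hq
    refine hasFDerivAt_of_partials hGu hf (fun q hq => ?_) (fun q hq => ?_) hq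
    · obtain ⟨h1, h2⟩ := mem_ball_prod.1 hq
      exact hasDerivAt_parametric_intervalIntegral hf hfu hu h1 h0 h2
    · obtain ⟨h1, h2⟩ := mem_ball_prod.1 hq
      exact hasDerivAt_primitive (continuousOn_slice_right hf h1) h0 h2
  have h1 := (hG (p x, β x) (mem_ball_prod.2 ⟨hpx, hβx⟩)).comp_hasDerivAt x (hp.prodMk hβ)
  have h2 := (hG (p x, α x) (mem_ball_prod.2 ⟨hpx, hαx⟩)).comp_hasDerivAt x (hp.prodMk hα)
  have h3 := h1.sub h2
  have e : ∀ {y}, |p y| < δ → |α y| < δ → |β y| < δ → ∀ {g : ℝ × ℝ → ℝ},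
      ContinuousOn g (ball 0 δ) → (∫ t in α y..β y, g (p y, t)) =
        (∫ t in (0 : ℝ)..β y, g (p y, t)) - ∫ t in (0 : ℝ)..α y, g (p y, t) :=
    fun hp hα hβ g hg => (intervalIntegral.integral_interval_sub_left (h_int hg hp h0 hβ)
      (h_int hg hp h0 hα)).symm
  have hev : ∀ {g : ℝ → ℝ}, ContinuousAt g x → |g x| < δ → ∀ᶠ y in 𝓝 x, |g y| < δ :=
    fun hg hgx => hg.abs.eventually_lt_const hgx
  refine (h3.congr_deriv ?_).congr_of_eventuallyEq ?_
  · simp only [Gu, e hpx hαx hβx hfu, add_apply, smul_apply,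
      ContinuousLinearMap.coe_fst', ContinuousLinearMap.coe_snd', smul_eq_mul]
    ring
  · filter_upwards [hev hp.continuousAt hpx, hev hα.continuousAt hαx, hev hβ.continuousAt hβx]
      with y h1 h2 h3
    exact e h1 h2 h3 hf

theorem swap_mem_ball {δ : ℝ} {q : ℝ × ℝ} (hq : q ∈ ball (0 : ℝ × ℝ) δ) :
    q.swap ∈ ball (0 : ℝ × ℝ) δ :=
  mem_ball_prod.2 (mem_ball_prod.1 hq).symm

/-- Leibniz rule for an integral along the first variable. -/
theorem hasDerivAt_integral_fst {f fv : ℝ × ℝ → ℝ} {δ : ℝ}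
    (hf : ContinuousOn f (ball 0 δ)) (hfv : ContinuousOn fv (ball 0 δ))
    (hv : ∀ q ∈ ball (0 : ℝ × ℝ) δ, HasDerivAt (fun y => f (q.1, y)) (fv q) q.2)
    {p α β : ℝ → ℝ} {x p' α' β' : ℝ} (hp : HasDerivAt p p' x) (hα : HasDerivAt α α' x)
    (hβ : HasDerivAt β β' x) (hpx : |p x| < δ) (hαx : |α x| < δ) (hβx : |β x| < δ) :
    HasDerivAt (fun y => ∫ t in α y..β y, f (t, p y))
      (β' * f (β x, p x) - α' * f (α x, p x) + p' * ∫ t in α x..β x, fv (t, p x)) x :=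
  hasDerivAt_integral_snd (f := fun q => f q.swap) (fu := fun q => fv q.swap)
    (hf.comp continuous_swap.continuousOn fun _ => swap_mem_ball)
    (hfv.comp continuous_swap.continuousOn fun _ => swap_mem_ball)
    (fun q hq => hv q.swap (swap_mem_ball hq)) hp hα hβ hpx hαx hβx

end Analysis

section Calculus

set_option linter.unusedSectionVars false

/-- A class `V δ` of admissible states on the box of size `δ`, and a relation `R δ d` saying that
two admissible states are at distance at most `d`. -/
structure Ctx (S : Type*) where
  V : ℝ → S → Prop
  R : ℝ → ℝ → S → S → Prop
  left_mem : ∀ {δ d s s'}, R δ d s s' → V δ s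
  right_mem : ∀ {δ d s s'}, R δ d s s' → V δ s'
  nonneg : ∀ {δ d s s'}, R δ d s s' → 0 ≤ d

variable {S : Type*} (c : Ctx S) {Y Y' E F G : Type*} [NormedAddCommGroup Y] [NormedAddCommGroup Y']
  [NormedAddCommGroup E] [NormedSpace ℝ E] [NormedAddCommGroup F] [NormedSpace ℝ F]
  [NormedAddCommGroup G] [NormedSpace ℝ G]

/-- A quantity depending on the state which is `O(δ)`-close to `q₀` and whose dependence on the
state is `O(δ)`-Lipschitz. -/
def Small (Q : S → Y → E) (q₀ : E) : Prop :=
  ∃ C, 0 ≤ C ∧ ∀ᶠ δ in 𝓝[>] (0 : ℝ),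
    (∀ s, c.V δ s → ContinuousOn (Q s) (ball 0 δ) ∧ ∀ y ∈ ball (0 : Y) δ, ‖Q s y - q₀‖ ≤ C * δ) ∧
    ∀ s s' d, c.R δ d s s' → ∀ y ∈ ball (0 : Y) δ, ‖Q s y - Q s' y‖ ≤ C * δ * d

/-- A bounded quantity depending on the state in a `K + O(δ)`-Lipschitz way. -/
def Lead (Q : S → Y → E) (K : ℝ) : Prop :=
  0 ≤ K ∧ ∃ C, 0 ≤ C ∧ ∀ᶠ δ in 𝓝[>] (0 : ℝ),
    (∀ s, c.V δ s → ContinuousOn (Q s) (ball 0 δ) ∧ ∀ y ∈ ball (0 : Y) δ, ‖Q s y‖ ≤ C) ∧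
    ∀ s s' d, c.R δ d s s' → ∀ y ∈ ball (0 : Y) δ, ‖Q s y - Q s' y‖ ≤ (K + C * δ) * d

variable {c}

theorem eventually_pos_le_one : ∀ᶠ δ in 𝓝[>] (0 : ℝ), 0 < δ ∧ δ ≤ 1 := by
  filter_upwards [Ioc_mem_nhdsGT (zero_lt_one (α := ℝ))] with δ hδ using hδ

theorem eventually_mul_lt (C : ℝ) {ρ : ℝ} (hρ : 0 < ρ) : ∀ᶠ δ in 𝓝[>] (0 : ℝ), C * δ < ρ := by
  have : Tendsto (fun δ : ℝ => C * δ) (𝓝[>] 0) (𝓝 (C * 0)) :=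
    ((continuous_const.mul continuous_id).tendsto 0).mono_left nhdsWithin_le_nhds
  rw [mul_zero] at this
  exact this.eventually_lt_const hρ

theorem Small.const (e : E) : Small c (fun _ (_ : Y) => e) e := by
  refine ⟨0, le_rfl, Eventually.of_forall fun δ => ⟨fun s _ => ⟨continuousOn_const, ?_⟩, ?_⟩⟩ <;>
    simp

theorem Small.prodMk {Q : S → Y → E} {q₀ : E} {Q' : S → Y → F} {q₀' : F} (h : Small c Q q₀)
    (h' : Small c Q' q₀') : Small c (fun s y => (Q s y, Q' s y)) (q₀, q₀') := by
  obtain ⟨C, hC, h⟩ := h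
  obtain ⟨C', hC', h'⟩ := h'
  refine ⟨max C C', le_max_of_le_left hC, ?_⟩
  filter_upwards [h, h', eventually_pos_le_one] with δ h h' hδ
  have hm : C * δ ≤ max C C' * δ := mul_le_mul_of_nonneg_right (le_max_left _ _) hδ.1.le
  have hm' : C' * δ ≤ max C C' * δ := mul_le_mul_of_nonneg_right (le_max_right _ _) hδ.1.le
  refine ⟨fun s hs => ⟨(h.1 s hs).1.prodMk (h'.1 s hs).1, fun y hy => ?_⟩,
    fun s s' d hd y hy => ?_⟩
  · exact max_le (((h.1 s hs).2 y hy).trans hm) (((h'.1 s hs).2 y hy).trans hm')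
  · have hd0 := c.nonneg hd
    exact max_le ((h.2 s s' d hd y hy).trans (by gcongr)) ((h'.2 s s' d hd y hy).trans (by gcongr))

theorem Small.eventually {Q : S → Y → E} {q₀ : E} (h : Small c Q q₀) {p : E → Prop}
    (hp : ∀ᶠ x in 𝓝 q₀, p x) :
    ∀ᶠ δ in 𝓝[>] (0 : ℝ), ∀ s, c.V δ s → ∀ y ∈ ball (0 : Y) δ, p (Q s y) := by
  obtain ⟨C, hC, h⟩ := h
  obtain ⟨ρ, hρ, hp⟩ := Metric.eventually_nhds_iff.1 hp
  filter_upwards [h, eventually_mul_lt C hρ] with δ h hδ s hs y hy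
  exact hp (by rw [dist_eq_norm]; exact ((h.1 s hs).2 y hy).trans_lt hδ)

theorem Small.comp {Q : S → Y → E} {q₀ : E} (h : Small c Q q₀) {f : E → F}
    (hf : ContDiffAt ℝ 1 f q₀) : Small c (fun s y => f (Q s y)) (f q₀) := by
  obtain ⟨K, t, ht, hK⟩ := hf.exists_lipschitzOnWith
  have hev := h.eventually ht
  obtain ⟨C, hC, h⟩ := h
  refine ⟨K * C, by positivity, ?_⟩
  filter_upwards [h, hev, eventually_pos_le_one] with δ h hev hδ
  have hq₀ := mem_of_mem_nhds ht
  refine ⟨fun s hs => ⟨hK.continuousOn.comp (h.1 s hs).1 fun y hy => hev s hs y hy,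
    fun y hy => ?_⟩, fun s s' d hd y hy => ?_⟩
  · have := hK.norm_sub_le (hev s hs y hy) hq₀
    have h2 := (h.1 s hs).2 y hy
    calc _ ≤ K * ‖Q s y - q₀‖ := this
      _ ≤ K * (C * δ) := by gcongr
      _ = _ := by ring
  · have := hK.norm_sub_le (hev s (c.left_mem hd) y hy) (hev s' (c.right_mem hd) y hy)
    have h2 := h.2 s s' d hd y hy
    calc _ ≤ K * ‖Q s y - Q s' y‖ := this
      _ ≤ K * (C * δ * d) := by gcongr
      _ = _ := by ring

theorem Small.add {Q Q' : S → Y → E} {q₀ q₀' : E} (h : Small c Q q₀) (h' : Small c Q' q₀') :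
    Small c (fun s y => Q s y + Q' s y) (q₀ + q₀') :=
  (h.prodMk h').comp (f := fun p : E × E => p.1 + p.2) (by fun_prop)

theorem Small.sub {Q Q' : S → Y → E} {q₀ q₀' : E} (h : Small c Q q₀) (h' : Small c Q' q₀') :
    Small c (fun s y => Q s y - Q' s y) (q₀ - q₀') :=
  (h.prodMk h').comp (f := fun p : E × E => p.1 - p.2) (by fun_prop)

theorem Small.mul {Q Q' : S → Y → ℝ} {q₀ q₀' : ℝ} (h : Small c Q q₀) (h' : Small c Q' q₀') :
    Small c (fun s y => Q s y * Q' s y) (q₀ * q₀') :=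
  (h.prodMk h').comp (f := fun p : ℝ × ℝ => p.1 * p.2) (by fun_prop)

theorem Small.div {Q Q' : S → Y → ℝ} {q₀ q₀' : ℝ} (h : Small c Q q₀) (h' : Small c Q' q₀')
    (h0 : q₀' ≠ 0) : Small c (fun s y => Q s y / Q' s y) (q₀ / q₀') :=
  (h.prodMk h').comp (f := fun p : ℝ × ℝ => p.1 / p.2) (contDiffAt_fst.div contDiffAt_snd h0)

theorem Small.clm_apply {Q : S → Y → E →L[ℝ] F} {q₀ : E →L[ℝ] F} {Q' : S → Y → E} {q₀' : E}
    (h : Small c Q q₀) (h' : Small c Q' q₀') : Small c (fun s y => Q s y (Q' s y)) (q₀ q₀') :=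
  (h.prodMk h').comp (f := fun p : (E →L[ℝ] F) × E => p.1 p.2)
    (contDiff_fst.clm_apply contDiff_snd).contDiffAt

theorem Small.pre {Q : S → Y' → E} {q₀ : E} (h : Small c Q q₀) {j : Y → Y'} (hj : Continuous j)
    (hjn : ∀ y, ‖j y‖ ≤ ‖y‖) : Small c (fun s y => Q s (j y)) q₀ := by
  obtain ⟨C, hC, h⟩ := h
  refine ⟨C, hC, h.mono fun δ h => ?_⟩
  have hm : ∀ y ∈ ball (0 : Y) δ, j y ∈ ball (0 : Y') δ := fun y hy => by
    rw [mem_ball_zero_iff] at *; exact (hjn y).trans_lt hy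
  exact ⟨fun s hs => ⟨(h.1 s hs).1.comp hj.continuousOn hm, fun y hy => (h.1 s hs).2 _ (hm y hy)⟩,
    fun s s' d hd y hy => h.2 s s' d hd _ (hm y hy)⟩

theorem Lead.pre {Q : S → Y' → E} {K : ℝ} (h : Lead c Q K) {j : Y → Y'} (hj : Continuous j)
    (hjn : ∀ y, ‖j y‖ ≤ ‖y‖) : Lead c (fun s y => Q s (j y)) K := by
  obtain ⟨hK, C, hC, h⟩ := h
  refine ⟨hK, C, hC, h.mono fun δ h => ?_⟩
  have hm : ∀ y ∈ ball (0 : Y) δ, j y ∈ ball (0 : Y') δ := fun y hy => by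
    rw [mem_ball_zero_iff] at *; exact (hjn y).trans_lt hy
  exact ⟨fun s hs => ⟨(h.1 s hs).1.comp hj.continuousOn hm, fun y hy => (h.1 s hs).2 _ (hm y hy)⟩,
    fun s s' d hd y hy => h.2 s s' d hd _ (hm y hy)⟩

theorem Small.lead {Q : S → Y → E} {q₀ : E} (h : Small c Q q₀) : Lead c Q 0 := by
  obtain ⟨C, hC, h⟩ := h
  refine ⟨le_rfl, C + ‖q₀‖, by positivity, ?_⟩
  filter_upwards [h, eventually_pos_le_one] with δ h hδ
  refine ⟨fun s hs => ⟨(h.1 s hs).1, fun y hy => ?_⟩, fun s s' d hd y hy => ?_⟩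
  · have h1 := (h.1 s hs).2 y hy
    have h2 : C * δ ≤ C := mul_le_of_le_one_right hC hδ.2
    calc ‖Q s y‖ = ‖(Q s y - q₀) + q₀‖ := by rw [sub_add_cancel]
      _ ≤ _ := (norm_add_le _ _).trans (by linarith)
  · have h0 := hδ.1.le
    have h1 := c.nonneg hd
    refine (h.2 s s' d hd y hy).trans ?_
    rw [zero_add]
    gcongr
    linarith [norm_nonneg q₀]

theorem Lead.mono {Q : S → Y → E} {K K' : ℝ} (h : Lead c Q K) (hK : K ≤ K') : Lead c Q K' := by
  obtain ⟨hK0, C, hC, h⟩ := h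
  refine ⟨hK0.trans hK, C, hC, h.mono fun δ h => ⟨h.1, fun s s' d hd y hy => ?_⟩⟩
  have h1 := c.nonneg hd
  exact (h.2 s s' d hd y hy).trans (by gcongr)

theorem Lead.prodMk {Q : S → Y → E} {Q' : S → Y → F} {K K' : ℝ} (h : Lead c Q K)
    (h' : Lead c Q' K') : Lead c (fun s y => (Q s y, Q' s y)) (max K K') := by
  obtain ⟨hK, C, hC, h⟩ := h
  obtain ⟨hK', C', hC', h'⟩ := h'
  refine ⟨le_max_of_le_left hK, max C C', le_max_of_le_left hC, ?_⟩
  filter_upwards [h, h', eventually_pos_le_one] with δ h h' hδ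
  refine ⟨fun s hs => ⟨(h.1 s hs).1.prodMk (h'.1 s hs).1, fun y hy => ?_⟩,
    fun s s' d hd y hy => ?_⟩
  · exact max_le (((h.1 s hs).2 y hy).trans (le_max_left _ _))
      (((h'.1 s hs).2 y hy).trans (le_max_right _ _))
  · have hd0 := c.nonneg hd
    have hδ0 := hδ.1.le
    refine max_le ((h.2 s s' d hd y hy).trans ?_) ((h'.2 s s' d hd y hy).trans ?_)
    · gcongr <;> exact le_max_left _ _
    · gcongr <;> exact le_max_right _ _

theorem Lead.clm_apply {Q : S → Y → E →L[ℝ] F} {q₀ : E →L[ℝ] F} {Q' : S → Y → E} {K : ℝ}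
    (h : Small c Q q₀) (h' : Lead c Q' K) : Lead c (fun s y => Q s y (Q' s y)) (‖q₀‖ * K) := by
  obtain ⟨C, hC, h⟩ := h
  obtain ⟨hK, C', hC', h'⟩ := h'
  refine ⟨by positivity, C * K + ‖q₀‖ * C' + 2 * (C * C'), by positivity, ?_⟩
  filter_upwards [h, h', eventually_pos_le_one] with δ h h' hδ
  have hδ0 := hδ.1.le
  have hQ : ∀ s, c.V δ s → ∀ y ∈ ball (0 : Y) δ, ‖Q s y‖ ≤ ‖q₀‖ + C * δ := fun s hs y hy => by
    calc ‖Q s y‖ = ‖q₀ + (Q s y - q₀)‖ := by rw [add_sub_cancel]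
      _ ≤ _ := (norm_add_le _ _).trans (by linarith [(h.1 s hs).2 y hy])
  have hCδ : C * δ ≤ C := mul_le_of_le_one_right hC hδ.2
  refine ⟨fun s hs => ⟨(h.1 s hs).1.clm_apply (h'.1 s hs).1, fun y hy => ?_⟩,
    fun s s' d hd y hy => ?_⟩
  · calc _ ≤ ‖Q s y‖ * ‖Q' s y‖ := ContinuousLinearMap.le_opNorm _ _
      _ ≤ (‖q₀‖ + C * δ) * C' := mul_le_mul (hQ s hs y hy) ((h'.1 s hs).2 y hy) (norm_nonneg _)
        (by positivity)
      _ ≤ (‖q₀‖ + C) * C' := by gcongr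
      _ ≤ _ := by nlinarith [mul_nonneg hC hC', mul_nonneg hC hK]
  · have hd0 := c.nonneg hd
    have hs := c.left_mem hd
    have hs' := c.right_mem hd
    calc _ = ‖Q s y (Q' s y - Q' s' y) + (Q s y - Q s' y) (Q' s' y)‖ := by
          simp only [map_sub, sub_apply]; abel_nf
      _ ≤ ‖Q s y‖ * ‖Q' s y - Q' s' y‖ + ‖Q s y - Q s' y‖ * ‖Q' s' y‖ :=
          (norm_add_le _ _).trans (add_le_add (ContinuousLinearMap.le_opNorm _ _)
            (ContinuousLinearMap.le_opNorm _ _))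
      _ ≤ (‖q₀‖ + C * δ) * ((K + C' * δ) * d) + (C * δ * d) * C' :=
          add_le_add (mul_le_mul (hQ s hs y hy) (h'.2 s s' d hd y hy) (norm_nonneg _)
            (by positivity)) (mul_le_mul (h.2 s s' d hd y hy) ((h'.1 s' hs').2 y hy)
            (norm_nonneg _) (by positivity))
      _ = (‖q₀‖ * K + (C * K + ‖q₀‖ * C' + C * C' + (C * δ) * C') * δ) * d := by ring
      _ ≤ (‖q₀‖ * K + (C * K + ‖q₀‖ * C' + C * C' + C * C') * δ) * d := by gcongr
      _ = _ := by ring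

theorem Lead.add {Q Q' : S → Y → E} {K K' : ℝ} (h : Lead c Q K) (h' : Lead c Q' K') :
    Lead c (fun s y => Q s y + Q' s y) (K + K') := by
  obtain ⟨hK, C, hC, h⟩ := h
  obtain ⟨hK', C', hC', h'⟩ := h'
  refine ⟨by positivity, C + C', by positivity, ?_⟩
  filter_upwards [h, h'] with δ h h'
  refine ⟨fun s hs => ⟨(h.1 s hs).1.add (h'.1 s hs).1, fun y hy => ?_⟩,
    fun s s' d hd y hy => ?_⟩
  · exact (norm_add_le _ _).trans (add_le_add ((h.1 s hs).2 y hy) ((h'.1 s hs).2 y hy))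
  · rw [add_sub_add_comm]
    refine (norm_add_le _ _).trans ((add_le_add (h.2 s s' d hd y hy) (h'.2 s s' d hd y hy)).trans
      (le_of_eq (by ring)))

theorem Lead.mul {Q Q' : S → Y → ℝ} {q₀ K : ℝ} (h : Small c Q q₀) (h' : Lead c Q' K) :
    Lead c (fun s y => Q s y * Q' s y) (|q₀| * K) := by
  have h1 : Small c (fun s y => ContinuousLinearMap.toSpanSingleton ℝ (Q s y))
      (ContinuousLinearMap.toSpanSingleton ℝ q₀) :=
    h.comp (ContinuousLinearMap.toSpanSingletonCLE (𝕜 := ℝ) (E := ℝ)).contDiff.contDiffAt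
  have h2 := Lead.clm_apply h1 h'
  simpa [mul_comm] using h2

theorem Lead.const_mul {Q : S → Y → ℝ} {K : ℝ} (h : Lead c Q K) (r : ℝ) :
    Lead c (fun s y => r * Q s y) (|r| * K) :=
  Lead.mul (Small.const r) h

theorem Lead.sub {Q Q' : S → Y → ℝ} {K K' : ℝ} (h : Lead c Q K) (h' : Lead c Q' K') :
    Lead c (fun s y => Q s y - Q' s y) (K + K') := by
  simpa [sub_eq_add_neg] using h.add (h'.const_mul (-1))

/-- Integrals over intervals of length `O(δ)` gain a factor `δ`. -/
theorem Lead.integral {Q : S → Y' → ℝ} {K : ℝ} (h : Lead c Q K) {j : Y → ℝ → Y'}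
    (hj : Continuous (Function.uncurry j)) (hjn : ∀ y t, ‖j y t‖ ≤ max ‖y‖ |t|) {α β : Y → ℝ}
    (hα : Continuous α) (hβ : Continuous β) (hαn : ∀ y, |α y| ≤ ‖y‖) (hβn : ∀ y, |β y| ≤ ‖y‖) :
    Small c (fun s y => ∫ t in α y..β y, Q s (j y t)) 0 := by
  obtain ⟨hK, C, hC, h⟩ := h
  refine ⟨2 * (K + C), by positivity, ?_⟩
  filter_upwards [h, eventually_pos_le_one] with δ h hδ
  have hδ0 := hδ.1.le
  have hm : ∀ y ∈ ball (0 : Y) δ, ∀ t ∈ uIcc (α y) (β y), j y t ∈ ball (0 : Y') δ := by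
    intro y hy t ht
    rw [mem_ball_zero_iff] at *
    exact (hjn y t).trans_lt (max_lt hy ((abs_le_max_of_mem_uIcc ht).trans_lt
      (max_lt ((hαn y).trans_lt hy) ((hβn y).trans_lt hy))))
  have hlen : ∀ y ∈ ball (0 : Y) δ, |β y - α y| ≤ 2 * δ := by
    intro y hy
    rw [mem_ball_zero_iff] at hy
    have h1 := hαn y
    have h2 := hβn y
    have h3 := abs_sub (β y) (α y)
    linarith
  have h_int : ∀ s, c.V δ s → ∀ y ∈ ball (0 : Y) δ,
      IntervalIntegrable (fun t => Q s (j y t)) MeasureTheory.volume (α y) (β y) :=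
    fun s hs y hy => ((h.1 s hs).1.comp (hj.comp (Continuous.prodMk_right y)).continuousOn
      (hm y hy)).intervalIntegrable
  refine ⟨fun s hs => ⟨continuousOn_parametric_intervalIntegral (h.1 s hs).1 hj hjn hα hβ hαn hβn,
    fun y hy => ?_⟩, fun s s' d hd y hy => ?_⟩
  · rw [sub_zero]
    have := intervalIntegral.norm_integral_le_of_norm_le_const (a := α y) (b := β y) (C := C)
      (f := fun t => Q s (j y t))
      fun t ht => (h.1 s hs).2 _ (hm y hy t (uIoc_subset_uIcc ht))
    have h3 := hlen y hy
    calc _ ≤ C * |β y - α y| := this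
      _ ≤ C * (2 * δ) := by gcongr
      _ ≤ _ := by nlinarith
  · have hd0 := c.nonneg hd
    rw [← intervalIntegral.integral_sub (h_int s (c.left_mem hd) y hy)
      (h_int s' (c.right_mem hd) y hy)]
    have := intervalIntegral.norm_integral_le_of_norm_le_const (a := α y) (b := β y)
      (C := (K + C * δ) * d) (f := fun t => Q s (j y t) - Q s' (j y t))
      fun t ht => h.2 s s' d hd _ (hm y hy t (uIoc_subset_uIcc ht))
    have h3 := hlen y hy
    have h4 : C * δ ≤ C := mul_le_of_le_one_right hC hδ.2
    calc _ ≤ (K + C * δ) * d * |β y - α y| := this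
      _ ≤ (K + C) * d * (2 * δ) := by gcongr
      _ = _ := by ring

end Calculus

section System

/-- `fu` and `fv` are the continuous partial derivatives of `f` on the box of size `δ`. -/
structure Partials (δ : ℝ) (f fu fv : ℝ × ℝ → ℝ) : Prop where
  cu : ContinuousOn fu (ball 0 δ)
  cv : ContinuousOn fv (ball 0 δ)
  du : ∀ q ∈ ball (0 : ℝ × ℝ) δ, HasDerivAt (fun u => f (u, q.2)) (fu q) q.1
  dv : ∀ q ∈ ball (0 : ℝ × ℝ) δ, HasDerivAt (fun v => f (q.1, v)) (fv q) q.2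

theorem Partials.hasFDerivAt {δ : ℝ} {f fu fv : ℝ × ℝ → ℝ} (h : Partials δ f fu fv) {q : ℝ × ℝ}
    (hq : q ∈ ball (0 : ℝ × ℝ) δ) : HasFDerivAt f
      (fu q • ContinuousLinearMap.fst ℝ ℝ ℝ + fv q • ContinuousLinearMap.snd ℝ ℝ ℝ) q :=
  hasFDerivAt_of_partials h.cu h.cv h.du h.dv hq

theorem Partials.continuousOn {δ : ℝ} {f fu fv : ℝ × ℝ → ℝ} (h : Partials δ f fu fv) :
    ContinuousOn f (ball 0 δ) :=
  fun _ hq => (h.hasFDerivAt hq).continuousAt.continuousWithinAt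

theorem Partials.curve {δ : ℝ} {f fu fv : ℝ × ℝ → ℝ} (h : Partials δ f fu fv) {p r : ℝ → ℝ}
    {x p' r' : ℝ} (hp : HasDerivAt p p' x) (hr : HasDerivAt r r' x) (hpx : |p x| < δ)
    (hrx : |r x| < δ) :
    HasDerivAt (fun y => f (p y, r y)) (p' * fu (p x, r x) + r' * fv (p x, r x)) x := by
  have h1 := (h.hasFDerivAt (q := (p x, r x)) (mem_ball_prod.2 ⟨hpx, hrx⟩)).comp_hasDerivAt x
    (hp.prodMk hr)
  refine h1.congr_deriv ?_
  simp only [add_apply, smul_apply, ContinuousLinearMap.coe_fst', ContinuousLinearMap.coe_snd',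
    smul_eq_mul]
  ring

/-- The nonlinear structure of the iteration: `F = P / c_in` and `O = Q / c_out` are the
derivatives of `t`, `M` is the right hand side of the wave equation for `x`, `Gᵢ` are the boundary
coefficients and `hᵢ` the values behind the shocks. -/
structure System where
  a : ℝ
  Γ : ℝ
  β : ℝ
  α' : ℝ
  β' : ℝ
  F : ℝ × ℝ × ℝ → ℝ
  O : ℝ × ℝ × ℝ → ℝ
  M : ℝ × ℝ × ℝ × ℝ × ℝ × ℝ → ℝ
  G₁ : ℝ × ℝ × ℝ × ℝ → ℝ
  G₂ : ℝ × ℝ × ℝ × ℝ → ℝ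
  h₁ : ℝ × ℝ × ℝ → ℝ
  h₂ : ℝ × ℝ × ℝ → ℝ
  a_pos : 0 < a
  a_lt : a < 1
  Γ_ne : Γ ≠ 0
  contDiff_F : ContDiffAt ℝ 3 F (β, β, 1 / Γ)
  contDiff_O : ContDiffAt ℝ 3 O (β, β, 1)
  contDiff_M : ContDiffAt ℝ 3 M (β, β, α', β', 1 / Γ, 1)
  contDiff_G₁ : ContDiffAt ℝ 3 G₁ (β, β, 0, 0)
  contDiff_G₂ : ContDiffAt ℝ 3 G₂ (β, β, 0, 0)
  contDiff_h₁ : ContDiffAt ℝ 3 h₁ (β, 0, 0)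
  contDiff_h₂ : ContDiffAt ℝ 3 h₂ (β, 0, 0)
  G₁_base : G₁ (β, β, 0, 0) = Γ
  G₂_base : G₂ (β, β, 0, 0) = Γ
  h₁_base : h₁ (β, 0, 0) = β
  h₂_base : h₂ (β, 0, 0) = β
  h₁_deriv : fderiv ℝ h₁ (β, 0, 0) (β', F (β, β, 1 / Γ) + O (β, β, 1), 1 / Γ + 1) = α'
  h₂_deriv : fderiv ℝ h₂ (β, 0, 0) (a * α', a * F (β, β, 1 / Γ) + O (β, β, 1), a * (1 / Γ) + 1) = β'
  h₁_contr : |fderiv ℝ h₁ (β, 0, 0) (1, 0, 0)| < 1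
  h₂_contr : |fderiv ℝ h₂ (β, 0, 0) (1, 0, 0)| < 1

/-- An iterate together with its derivatives. -/
structure State where
  A : ℝ → ℝ
  A₁ : ℝ → ℝ
  A₂ : ℝ → ℝ
  B : ℝ → ℝ
  B₁ : ℝ → ℝ
  B₂ : ℝ → ℝ
  X : ℝ × ℝ → ℝ
  P : ℝ × ℝ → ℝ
  Q : ℝ × ℝ → ℝ
  Pu : ℝ × ℝ → ℝ
  W : ℝ × ℝ → ℝ
  Qv : ℝ × ℝ → ℝ
  Wu : ℝ × ℝ → ℝ

namespace State

variable (s : State)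

def cF (q : ℝ × ℝ) : ℝ × ℝ × ℝ := (s.A q.1, s.B q.2, s.P q)
def cFu (q : ℝ × ℝ) : ℝ × ℝ × ℝ := (s.A₁ q.1, 0, s.Pu q)
def cFv (q : ℝ × ℝ) : ℝ × ℝ × ℝ := (0, s.B₁ q.2, s.W q)
def cO (q : ℝ × ℝ) : ℝ × ℝ × ℝ := (s.A q.1, s.B q.2, s.Q q)
def cOu (q : ℝ × ℝ) : ℝ × ℝ × ℝ := (s.A₁ q.1, 0, s.W q)
def cOv (q : ℝ × ℝ) : ℝ × ℝ × ℝ := (0, s.B₁ q.2, s.Qv q)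
def cOuu (q : ℝ × ℝ) : ℝ × ℝ × ℝ := (s.A₂ q.1, 0, s.Wu q)
def cM (q : ℝ × ℝ) : ℝ × ℝ × ℝ × ℝ × ℝ × ℝ := (s.A q.1, s.B q.2, s.A₁ q.1, s.B₁ q.2, s.P q, s.Q q)
def cMu (q : ℝ × ℝ) : ℝ × ℝ × ℝ × ℝ × ℝ × ℝ := (s.A₁ q.1, 0, s.A₂ q.1, 0, s.Pu q, s.W q)
def cMv (q : ℝ × ℝ) : ℝ × ℝ × ℝ × ℝ × ℝ × ℝ := (0, s.B₁ q.2, 0, s.B₂ q.2, s.W q, s.Qv q)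

/-- The derivative relations and the values at the interaction point. -/
structure Reg (y : System) (δ : ℝ) : Prop where
  dA : ∀ u ∈ ball (0 : ℝ) δ, HasDerivAt s.A (s.A₁ u) u
  dA₁ : ∀ u ∈ ball (0 : ℝ) δ, HasDerivAt s.A₁ (s.A₂ u) u
  cA₂ : ContinuousOn s.A₂ (ball 0 δ)
  dB : ∀ u ∈ ball (0 : ℝ) δ, HasDerivAt s.B (s.B₁ u) u
  dB₁ : ∀ u ∈ ball (0 : ℝ) δ, HasDerivAt s.B₁ (s.B₂ u) u
  cB₂ : ContinuousOn s.B₂ (ball 0 δ)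
  dX : Partials δ s.X s.P s.Q
  dP : Partials δ s.P s.Pu s.W
  dQ : Partials δ s.Q s.W s.Qv
  dW : ∀ q ∈ ball (0 : ℝ × ℝ) δ, HasDerivAt (fun u => s.W (u, q.2)) (s.Wu q) q.1
  cWu : ContinuousOn s.Wu (ball 0 δ)
  A_zero : s.A 0 = y.β
  A₁_zero : s.A₁ 0 = y.α'
  B_zero : s.B 0 = y.β
  B₁_zero : s.B₁ 0 = y.β'
  X_zero : s.X (0, 0) = 0
  P_zero : s.P (0, 0) = 1 / y.Γ
  Q_zero : s.Q (0, 0) = 1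

end State

namespace System

variable (y : System) (s : State)

def φ (q : ℝ × ℝ) : ℝ := y.F (s.cF q)
def φu (q : ℝ × ℝ) : ℝ := fderiv ℝ y.F (s.cF q) (s.cFu q)
def φv (q : ℝ × ℝ) : ℝ := fderiv ℝ y.F (s.cF q) (s.cFv q)
def ψ (q : ℝ × ℝ) : ℝ := y.O (s.cO q)
def ψu (q : ℝ × ℝ) : ℝ := fderiv ℝ y.O (s.cO q) (s.cOu q)
def ψv (q : ℝ × ℝ) : ℝ := fderiv ℝ y.O (s.cO q) (s.cOv q)
def ψuu (q : ℝ × ℝ) : ℝ :=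
  fderiv ℝ (fderiv ℝ y.O) (s.cO q) (s.cOu q) (s.cOu q) + fderiv ℝ y.O (s.cO q) (s.cOuu q)
def m (q : ℝ × ℝ) : ℝ := y.M (s.cM q)
def mu (q : ℝ × ℝ) : ℝ := fderiv ℝ y.M (s.cM q) (s.cMu q)
def mv (q : ℝ × ℝ) : ℝ := fderiv ℝ y.M (s.cM q) (s.cMv q)

/-- Time along the left shock. -/
def lt (u : ℝ) : ℝ := ∫ t in (0 : ℝ)..u, (y.φ s (t, t) + y.ψ s (t, t))
def lt₁ (u : ℝ) : ℝ := y.φ s (u, u) + y.ψ s (u, u)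
def lt₂ (u : ℝ) : ℝ := y.φu s (u, u) + y.φv s (u, u) + (y.ψu s (u, u) + y.ψv s (u, u))

/-- Position along the left shock. -/
def lx (_ : System) (s : State) (u : ℝ) : ℝ := s.X (u, u)
def lx₁ (_ : System) (s : State) (u : ℝ) : ℝ := s.P (u, u) + s.Q (u, u)
def lx₂ (_ : System) (s : State) (u : ℝ) : ℝ :=
  s.Pu (u, u) + s.W (u, u) + (s.W (u, u) + s.Qv (u, u))

/-- Time along the right shock. -/
def rt (v : ℝ) : ℝ :=
  (∫ t in (0 : ℝ)..y.a * v, (y.φ s (t, t) + y.ψ s (t, t))) + ∫ t in (y.a * v)..v, y.ψ s (y.a * v, t)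
def rt₁ (v : ℝ) : ℝ :=
  y.a * y.φ s (y.a * v, y.a * v) + y.ψ s (y.a * v, v)
    + y.a * ∫ t in (y.a * v)..v, y.ψu s (y.a * v, t)
def rt₂ (v : ℝ) : ℝ :=
  y.a * (y.a * (y.φu s (y.a * v, y.a * v) + y.φv s (y.a * v, y.a * v)))
    + (y.a * y.ψu s (y.a * v, v) + y.ψv s (y.a * v, v))
    + y.a * (y.ψu s (y.a * v, v) - y.a * y.ψu s (y.a * v, y.a * v)
      + y.a * ∫ t in (y.a * v)..v, y.ψuu s (y.a * v, t))

/-- Position along the right shock. -/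
def rx (v : ℝ) : ℝ := s.X (y.a * v, v)
def rx₁ (v : ℝ) : ℝ := y.a * s.P (y.a * v, v) + s.Q (y.a * v, v)
def rx₂ (v : ℝ) : ℝ :=
  y.a * (y.a * s.Pu (y.a * v, v) + s.W (y.a * v, v)) + (y.a * s.W (y.a * v, v) + s.Qv (y.a * v, v))

def k₁ (u : ℝ) : ℝ × ℝ × ℝ × ℝ := (s.A u, s.B u, y.lt s u, y.lx s u)
def k₁' (u : ℝ) : ℝ × ℝ × ℝ × ℝ := (s.A₁ u, s.B₁ u, y.lt₁ s u, y.lx₁ s u)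
def k₂ (v : ℝ) : ℝ × ℝ × ℝ × ℝ := (s.A (y.a * v), s.B v, y.rt s v, y.rx s v)
def k₂' (v : ℝ) : ℝ × ℝ × ℝ × ℝ := (y.a * s.A₁ (y.a * v), s.B₁ v, y.rt₁ s v, y.rx₁ s v)

def g₁ (u : ℝ) : ℝ := y.G₁ (y.k₁ s u)
def g₁' (u : ℝ) : ℝ := fderiv ℝ y.G₁ (y.k₁ s u) (y.k₁' s u)
def g₂ (v : ℝ) : ℝ := y.G₂ (y.k₂ s v)
def g₂' (v : ℝ) : ℝ := fderiv ℝ y.G₂ (y.k₂ s v) (y.k₂' s v)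

def γ₁ (u : ℝ) : ℝ := y.g₂ s u / y.g₁ s u
def γ₁' (u : ℝ) : ℝ := (y.g₂' s u * y.g₁ s u - y.g₂ s u * y.g₁' s u) / y.g₁ s u ^ 2
def γ₂ (v : ℝ) : ℝ := y.g₂ s v / y.g₁ s (y.a * v)
def γ₂' (v : ℝ) : ℝ :=
  (y.g₂' s v * y.g₁ s (y.a * v) - y.g₂ s v * (y.a * y.g₁' s (y.a * v))) / y.g₁ s (y.a * v) ^ 2

def Λ₁ (u : ℝ) : ℝ :=
  y.γ₁' s u * s.P (y.a * u, u) + y.a * y.γ₁ s u * s.Pu (y.a * u, u) + y.γ₁ s u * y.m s (y.a * u, u)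
def Λ₂ (v : ℝ) : ℝ :=
  y.γ₂' s v * s.Q (y.a * v, y.a * v) + y.a * y.γ₂ s v * s.Qv (y.a * v, y.a * v)
    + y.a * y.γ₂ s v * y.m s (y.a * v, y.a * v)

def Φ₁ (u : ℝ) : ℝ :=
  (∫ t in (0 : ℝ)..u, y.Λ₁ s t) + (1 / y.g₁ s u) * ∫ t in (y.a * u)..u, y.m s (t, u)
def Φ₁' (u : ℝ) : ℝ :=
  y.Λ₁ s u + (-(y.g₁' s u) / y.g₁ s u ^ 2 * (∫ t in (y.a * u)..u, y.m s (t, u))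
    + 1 / y.g₁ s u * (y.m s (u, u) - y.a * y.m s (y.a * u, u)
      + ∫ t in (y.a * u)..u, y.mv s (t, u)))
def Φ₂ (v : ℝ) : ℝ :=
  (∫ t in (0 : ℝ)..v, y.Λ₂ s t) + y.g₂ s v * ∫ t in (y.a * v)..v, y.m s (y.a * v, t)
def Φ₂' (v : ℝ) : ℝ :=
  y.Λ₂ s v + (y.g₂' s v * (∫ t in (y.a * v)..v, y.m s (y.a * v, t))
    + y.g₂ s v * (y.m s (y.a * v, v) - y.a * y.m s (y.a * v, y.a * v)
      + y.a * ∫ t in (y.a * v)..v, y.mu s (y.a * v, t)))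

def l₁ (u : ℝ) : ℝ × ℝ × ℝ := (s.B u, y.lt s u, y.lx s u)
def l₁' (u : ℝ) : ℝ × ℝ × ℝ := (s.B₁ u, y.lt₁ s u, y.lx₁ s u)
def l₂ (v : ℝ) : ℝ × ℝ × ℝ := (s.A (y.a * v), y.rt s v, y.rx s v)
def l₂' (v : ℝ) : ℝ × ℝ × ℝ := (y.a * s.A₁ (y.a * v), y.rt₁ s v, y.rx₁ s v)

/-- The next iterate. -/
def next : State where
  A u := y.h₁ (y.l₁ s u)
  A₁ u := fderiv ℝ y.h₁ (y.l₁ s u) (y.l₁' s u)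
  A₂ u := fderiv ℝ (fderiv ℝ y.h₁) (y.l₁ s u) (y.l₁' s u) (y.l₁' s u)
    + (fderiv ℝ y.h₁ (y.l₁ s u) (1, 0, 0) * s.B₂ u
      + fderiv ℝ y.h₁ (y.l₁ s u) (0, y.lt₂ s u, y.lx₂ s u))
  B v := y.h₂ (y.l₂ s v)
  B₁ v := fderiv ℝ y.h₂ (y.l₂ s v) (y.l₂' s v)
  B₂ v := fderiv ℝ (fderiv ℝ y.h₂) (y.l₂ s v) (y.l₂' s v) (y.l₂' s v)
    + (fderiv ℝ y.h₂ (y.l₂ s v) (1, 0, 0) * (y.a * (y.a * s.A₂ (y.a * v)))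
      + fderiv ℝ y.h₂ (y.l₂ s v) (0, y.rt₂ s v, y.rx₂ s v))
  X q := q.1 / y.Γ + q.2 + (∫ t in (0 : ℝ)..q.1, y.Φ₁ s t) + (∫ t in (0 : ℝ)..q.2, y.Φ₂ s t)
    + (∫ v in (0 : ℝ)..q.1, ∫ u in (y.a * v)..v, y.m s (u, v))
    + ∫ v in q.1..q.2, ∫ u in (y.a * v)..q.1, y.m s (u, v)
  P q := 1 / y.Γ + y.Φ₁ s q.1 + ∫ t in q.1..q.2, y.m s (q.1, t)
  Q q := 1 + y.Φ₂ s q.2 + ∫ t in (y.a * q.2)..q.1, y.m s (t, q.2)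
  Pu q := y.Φ₁' s q.1 + (-y.m s (q.1, q.1) + ∫ t in q.1..q.2, y.mu s (q.1, t))
  W q := y.m s q
  Qv q := y.Φ₂' s q.2
    + (-(y.a * y.m s (y.a * q.2, q.2)) + ∫ t in (y.a * q.2)..q.1, y.mv s (t, q.2))
  Wu q := y.mu s q

/-- The smoothness and continuity needed to differentiate the next iterate. -/
structure Nice (δ : ℝ) : Prop where
  F : ∀ q ∈ ball (0 : ℝ × ℝ) δ, ContDiffAt ℝ 3 y.F (s.cF q)
  O : ∀ q ∈ ball (0 : ℝ × ℝ) δ, ContDiffAt ℝ 3 y.O (s.cO q)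
  M : ∀ q ∈ ball (0 : ℝ × ℝ) δ, ContDiffAt ℝ 3 y.M (s.cM q)
  G₁ : ∀ u ∈ ball (0 : ℝ) δ, ContDiffAt ℝ 3 y.G₁ (y.k₁ s u)
  G₂ : ∀ u ∈ ball (0 : ℝ) δ, ContDiffAt ℝ 3 y.G₂ (y.k₂ s u)
  h₁ : ∀ u ∈ ball (0 : ℝ) δ, ContDiffAt ℝ 3 y.h₁ (y.l₁ s u)
  h₂ : ∀ u ∈ ball (0 : ℝ) δ, ContDiffAt ℝ 3 y.h₂ (y.l₂ s u)
  g₁_ne : ∀ u ∈ ball (0 : ℝ) δ, y.g₁ s u ≠ 0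
  cφu : ContinuousOn (y.φu s) (ball 0 δ)
  cφv : ContinuousOn (y.φv s) (ball 0 δ)
  cψu : ContinuousOn (y.ψu s) (ball 0 δ)
  cψv : ContinuousOn (y.ψv s) (ball 0 δ)
  cψuu : ContinuousOn (y.ψuu s) (ball 0 δ)
  cmu : ContinuousOn (y.mu s) (ball 0 δ)
  cmv : ContinuousOn (y.mv s) (ball 0 δ)
  cΛ₁ : ContinuousOn (y.Λ₁ s) (ball 0 δ)
  cΛ₂ : ContinuousOn (y.Λ₂ s) (ball 0 δ)
  cA₂ : ContinuousOn (y.next s).A₂ (ball 0 δ)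
  cB₂ : ContinuousOn (y.next s).B₂ (ball 0 δ)
  cPu : ContinuousOn (y.next s).Pu (ball 0 δ)
  cQv : ContinuousOn (y.next s).Qv (ball 0 δ)

section Derivatives

variable {y s} {δ : ℝ}

theorem abs_a_mul_le (v : ℝ) : |y.a * v| ≤ |v| := by
  rw [abs_mul, abs_of_pos y.a_pos]
  exact mul_le_of_le_one_left (abs_nonneg _) y.a_lt.le

theorem hasDerivAt_comp_curve {E : Type*} [NormedAddCommGroup E] [NormedSpace ℝ E]
    {f : E → ℝ} {c : ℝ → E} {c' : E} {x : ℝ} (hf : ContDiffAt ℝ 3 f (c x))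
    (hc : HasDerivAt c c' x) : HasDerivAt (fun t => f (c t)) (fderiv ℝ f (c x) c') x :=
  (hf.differentiableAt (by norm_num)).hasFDerivAt.comp_hasDerivAt x hc

/-- Second derivative of a composition with a curve. -/
theorem hasDerivAt_fderiv_comp_curve {E : Type*} [NormedAddCommGroup E] [NormedSpace ℝ E]
    {f : E → ℝ} {c e : ℝ → E} {c' e' : E} {x : ℝ} (hf : ContDiffAt ℝ 3 f (c x))
    (hc : HasDerivAt c c' x) (he : HasDerivAt e e' x) :
    HasDerivAt (fun t => fderiv ℝ f (c t) (e t))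
      (fderiv ℝ (fderiv ℝ f) (c x) c' (e x) + fderiv ℝ f (c x) e') x := by
  have h1 : ContDiffAt ℝ 2 (fderiv ℝ f) (c x) := hf.fderiv_right (by norm_num)
  have h2 : HasDerivAt (fun t => fderiv ℝ f (c t)) (fderiv ℝ (fderiv ℝ f) (c x) c') x :=
    (h1.differentiableAt (by norm_num)).hasFDerivAt.comp_hasDerivAt x hc
  exact h2.clm_apply he

theorem hasDerivAt_cF_fst (hs : s.Reg y δ) {q : ℝ × ℝ} (hq : q ∈ ball (0 : ℝ × ℝ) δ) :
    HasDerivAt (fun u => s.cF (u, q.2)) (s.cFu q) q.1 :=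
  (hs.dA _ (mem_ball_real.2 (mem_ball_prod.1 hq).1)).prodMk
    ((hasDerivAt_const q.1 (s.B q.2)).prodMk (hs.dP.du q hq))

theorem hasDerivAt_cF_snd (hs : s.Reg y δ) {q : ℝ × ℝ} (hq : q ∈ ball (0 : ℝ × ℝ) δ) :
    HasDerivAt (fun v => s.cF (q.1, v)) (s.cFv q) q.2 :=
  (hasDerivAt_const q.2 (s.A q.1)).prodMk
    ((hs.dB _ (mem_ball_real.2 (mem_ball_prod.1 hq).2)).prodMk (hs.dP.dv q hq))

theorem hasDerivAt_cO_fst (hs : s.Reg y δ) {q : ℝ × ℝ} (hq : q ∈ ball (0 : ℝ × ℝ) δ) :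
    HasDerivAt (fun u => s.cO (u, q.2)) (s.cOu q) q.1 :=
  (hs.dA _ (mem_ball_real.2 (mem_ball_prod.1 hq).1)).prodMk
    ((hasDerivAt_const q.1 (s.B q.2)).prodMk (hs.dQ.du q hq))

theorem hasDerivAt_cO_snd (hs : s.Reg y δ) {q : ℝ × ℝ} (hq : q ∈ ball (0 : ℝ × ℝ) δ) :
    HasDerivAt (fun v => s.cO (q.1, v)) (s.cOv q) q.2 :=
  (hasDerivAt_const q.2 (s.A q.1)).prodMk
    ((hs.dB _ (mem_ball_real.2 (mem_ball_prod.1 hq).2)).prodMk (hs.dQ.dv q hq))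

theorem hasDerivAt_cOu_fst (hs : s.Reg y δ) {q : ℝ × ℝ} (hq : q ∈ ball (0 : ℝ × ℝ) δ) :
    HasDerivAt (fun u => s.cOu (u, q.2)) (s.cOuu q) q.1 :=
  (hs.dA₁ _ (mem_ball_real.2 (mem_ball_prod.1 hq).1)).prodMk
    ((hasDerivAt_const q.1 (0 : ℝ)).prodMk (hs.dW q hq))

theorem hasDerivAt_cM_fst (hs : s.Reg y δ) {q : ℝ × ℝ} (hq : q ∈ ball (0 : ℝ × ℝ) δ) :
    HasDerivAt (fun u => s.cM (u, q.2)) (s.cMu q) q.1 := by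
  have hu := mem_ball_real.2 (mem_ball_prod.1 hq).1
  have h1 := (hs.dP.du q hq).prodMk (hs.dQ.du q hq)
  have h2 := (hasDerivAt_const q.1 (s.B₁ q.2)).prodMk h1
  have h3 := (hs.dA₁ _ hu).prodMk h2
  have h4 := (hasDerivAt_const q.1 (s.B q.2)).prodMk h3
  exact (hs.dA _ hu).prodMk h4

theorem hasDerivAt_cM_snd (hs : s.Reg y δ) {q : ℝ × ℝ} (hq : q ∈ ball (0 : ℝ × ℝ) δ) :
    HasDerivAt (fun v => s.cM (q.1, v)) (s.cMv q) q.2 := by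
  have hv := mem_ball_real.2 (mem_ball_prod.1 hq).2
  have h1 := (hs.dP.dv q hq).prodMk (hs.dQ.dv q hq)
  have h2 := (hs.dB₁ _ hv).prodMk h1
  have h3 := (hasDerivAt_const q.2 (s.A₁ q.1)).prodMk h2
  have h4 := (hs.dB _ hv).prodMk h3
  exact (hasDerivAt_const q.2 (s.A q.1)).prodMk h4

theorem partials_φ (hs : s.Reg y δ) (hn : y.Nice s δ) :
    Partials δ (y.φ s) (y.φu s) (y.φv s) :=
  ⟨hn.cφu, hn.cφv, fun q hq => hasDerivAt_comp_curve (hn.F q hq) (hasDerivAt_cF_fst hs hq),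
    fun q hq => hasDerivAt_comp_curve (hn.F q hq) (hasDerivAt_cF_snd hs hq)⟩

theorem partials_ψ (hs : s.Reg y δ) (hn : y.Nice s δ) :
    Partials δ (y.ψ s) (y.ψu s) (y.ψv s) :=
  ⟨hn.cψu, hn.cψv, fun q hq => hasDerivAt_comp_curve (hn.O q hq) (hasDerivAt_cO_fst hs hq),
    fun q hq => hasDerivAt_comp_curve (hn.O q hq) (hasDerivAt_cO_snd hs hq)⟩

theorem partials_m (hs : s.Reg y δ) (hn : y.Nice s δ) :
    Partials δ (y.m s) (y.mu s) (y.mv s) :=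
  ⟨hn.cmu, hn.cmv, fun q hq => hasDerivAt_comp_curve (hn.M q hq) (hasDerivAt_cM_fst hs hq),
    fun q hq => hasDerivAt_comp_curve (hn.M q hq) (hasDerivAt_cM_snd hs hq)⟩

theorem hasDerivAt_ψu (hs : s.Reg y δ) (hn : y.Nice s δ) (q : ℝ × ℝ)
    (hq : q ∈ ball (0 : ℝ × ℝ) δ) : HasDerivAt (fun u => y.ψu s (u, q.2)) (y.ψuu s q) q.1 :=
  hasDerivAt_fderiv_comp_curve (hn.O q hq) (hasDerivAt_cO_fst hs hq) (hasDerivAt_cOu_fst hs hq)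

theorem hasDerivAt_a_mul (v : ℝ) : HasDerivAt (fun t => y.a * t) y.a v := by
  simpa using (hasDerivAt_id v).const_mul y.a

variable {u : ℝ}

theorem abs_a_mul_lt (hu : u ∈ ball (0 : ℝ) δ) : |y.a * u| < δ :=
  (abs_a_mul_le u).trans_lt (mem_ball_real.1 hu)

theorem continuousOn_diagonal {f : ℝ × ℝ → ℝ} (hf : ContinuousOn f (ball 0 δ)) :
    ContinuousOn (fun t : ℝ => f (t, t)) (ball 0 δ) :=
  hf.comp (by fun_prop) fun t ht => mem_ball_prod.2 ⟨mem_ball_real.1 ht, mem_ball_real.1 ht⟩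

theorem hasDerivAt_lt (hs : s.Reg y δ) (hn : y.Nice s δ) (hu : u ∈ ball (0 : ℝ) δ) :
    HasDerivAt (y.lt s) (y.lt₁ s u) u := by
  have h0 : |(0 : ℝ)| < δ := by simpa using (abs_nonneg _).trans_lt (mem_ball_real.1 hu)
  exact hasDerivAt_primitive (f := fun t => y.φ s (t, t) + y.ψ s (t, t))
    ((continuousOn_diagonal (partials_φ hs hn).continuousOn).add
    (continuousOn_diagonal (partials_ψ hs hn).continuousOn)) h0 (mem_ball_real.1 hu)

theorem hasDerivAt_lt₁ (hs : s.Reg y δ) (hn : y.Nice s δ) (hu : u ∈ ball (0 : ℝ) δ) :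
    HasDerivAt (y.lt₁ s) (y.lt₂ s u) u := by
  have hu' := mem_ball_real.1 hu
  refine (((partials_φ hs hn).curve (hasDerivAt_id u) (hasDerivAt_id u) hu' hu').add
    ((partials_ψ hs hn).curve (hasDerivAt_id u) (hasDerivAt_id u) hu' hu')).congr_deriv ?_
  simp only [lt₂, id, one_mul]

theorem hasDerivAt_lx (hs : s.Reg y δ) (hu : u ∈ ball (0 : ℝ) δ) :
    HasDerivAt (y.lx s) (y.lx₁ s u) u := by
  have hu' := mem_ball_real.1 hu
  refine (hs.dX.curve (hasDerivAt_id u) (hasDerivAt_id u) hu' hu').congr_deriv ?_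
  simp only [lx₁, id, one_mul]

theorem hasDerivAt_lx₁ (hs : s.Reg y δ) (hu : u ∈ ball (0 : ℝ) δ) :
    HasDerivAt (y.lx₁ s) (y.lx₂ s u) u := by
  have hu' := mem_ball_real.1 hu
  refine ((hs.dP.curve (hasDerivAt_id u) (hasDerivAt_id u) hu' hu').add
    (hs.dQ.curve (hasDerivAt_id u) (hasDerivAt_id u) hu' hu')).congr_deriv ?_
  simp only [lx₂, id, one_mul]

theorem hasDerivAt_rx (hs : s.Reg y δ) (hu : u ∈ ball (0 : ℝ) δ) :
    HasDerivAt (y.rx s) (y.rx₁ s u) u := by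
  refine (hs.dX.curve (hasDerivAt_a_mul u) (hasDerivAt_id u) (abs_a_mul_lt hu)
    (mem_ball_real.1 hu)).congr_deriv ?_
  simp only [rx₁, id, one_mul]

theorem hasDerivAt_rx₁ (hs : s.Reg y δ) (hu : u ∈ ball (0 : ℝ) δ) :
    HasDerivAt (y.rx₁ s) (y.rx₂ s u) u := by
  have hu' := mem_ball_real.1 hu
  refine (((hs.dP.curve (hasDerivAt_a_mul u) (hasDerivAt_id u) (abs_a_mul_lt hu)
    hu').const_mul y.a).add
    (hs.dQ.curve (hasDerivAt_a_mul u) (hasDerivAt_id u) (abs_a_mul_lt hu) hu')).congr_deriv ?_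
  simp only [rx₂, id, one_mul]

theorem hasDerivAt_rt (hs : s.Reg y δ) (hn : y.Nice s δ) (hu : u ∈ ball (0 : ℝ) δ) :
    HasDerivAt (y.rt s) (y.rt₁ s u) u := by
  have hu' := mem_ball_real.1 hu
  have hau := abs_a_mul_lt (y := y) hu
  have h1 := (hasDerivAt_lt hs hn (mem_ball_real.2 hau)).comp u (hasDerivAt_a_mul u)
  have h2 := hasDerivAt_integral_snd (partials_ψ hs hn).continuousOn hn.cψu (partials_ψ hs hn).du
    (hasDerivAt_a_mul (y := y) u) (hasDerivAt_a_mul (y := y) u) (hasDerivAt_id u) hau hau hu'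
  refine (h1.add h2).congr_deriv ?_
  simp only [rt₁, lt₁, id]
  ring

theorem hasDerivAt_rt₁ (hs : s.Reg y δ) (hn : y.Nice s δ) (hu : u ∈ ball (0 : ℝ) δ) :
    HasDerivAt (y.rt₁ s) (y.rt₂ s u) u := by
  have hu' := mem_ball_real.1 hu
  have hau := abs_a_mul_lt (y := y) hu
  have ha := hasDerivAt_a_mul (y := y) u
  have h1 := ((partials_φ hs hn).curve ha ha hau hau).const_mul y.a
  have h2 := (partials_ψ hs hn).curve ha (hasDerivAt_id u) hau hu'
  have h3 := (hasDerivAt_integral_snd hn.cψu hn.cψuu (hasDerivAt_ψu hs hn)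
    ha ha (hasDerivAt_id u) hau hau hu').const_mul y.a
  refine ((h1.add h2).add h3).congr_deriv ?_
  simp only [rt₂, id]
  ring

theorem hasDerivAt_A_a_mul (hs : s.Reg y δ) (hu : u ∈ ball (0 : ℝ) δ) :
    HasDerivAt (fun v => s.A (y.a * v)) (y.a * s.A₁ (y.a * u)) u :=
  ((hs.dA _ (mem_ball_real.2 (abs_a_mul_lt hu))).comp u (hasDerivAt_a_mul u)).congr_deriv
    (mul_comm _ _)

theorem hasDerivAt_A₁_a_mul (hs : s.Reg y δ) (hu : u ∈ ball (0 : ℝ) δ) :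
    HasDerivAt (fun v => y.a * s.A₁ (y.a * v)) (y.a * (y.a * s.A₂ (y.a * u))) u :=
  (((hs.dA₁ _ (mem_ball_real.2 (abs_a_mul_lt hu))).comp u
    (hasDerivAt_a_mul u)).congr_deriv (mul_comm _ _)).const_mul y.a

theorem hasDerivAt_g₁ (hs : s.Reg y δ) (hn : y.Nice s δ) (hu : u ∈ ball (0 : ℝ) δ) :
    HasDerivAt (y.g₁ s) (y.g₁' s u) u :=
  hasDerivAt_comp_curve (hn.G₁ u hu) ((hs.dA _ hu).prodMk ((hs.dB _ hu).prodMk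
    ((hasDerivAt_lt hs hn hu).prodMk (hasDerivAt_lx hs hu))))

theorem hasDerivAt_g₂ (hs : s.Reg y δ) (hn : y.Nice s δ) (hu : u ∈ ball (0 : ℝ) δ) :
    HasDerivAt (y.g₂ s) (y.g₂' s u) u :=
  hasDerivAt_comp_curve (hn.G₂ u hu) ((hasDerivAt_A_a_mul hs hu).prodMk
    ((hs.dB _ hu).prodMk ((hasDerivAt_rt hs hn hu).prodMk (hasDerivAt_rx hs hu))))

theorem hasDerivAt_γ₁ (hs : s.Reg y δ) (hn : y.Nice s δ) (hu : u ∈ ball (0 : ℝ) δ) :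
    HasDerivAt (y.γ₁ s) (y.γ₁' s u) u :=
  (hasDerivAt_g₂ hs hn hu).div (hasDerivAt_g₁ hs hn hu) (hn.g₁_ne u hu)

theorem hasDerivAt_γ₂ (hs : s.Reg y δ) (hn : y.Nice s δ) (hu : u ∈ ball (0 : ℝ) δ) :
    HasDerivAt (y.γ₂ s) (y.γ₂' s u) u := by
  have hau := mem_ball_real.2 (abs_a_mul_lt (y := y) hu)
  have h1 := ((hasDerivAt_g₁ hs hn hau).comp u (hasDerivAt_a_mul u)).congr_deriv (mul_comm _ _)
  exact (hasDerivAt_g₂ hs hn hu).div h1 (hn.g₁_ne _ hau)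

theorem hasDerivAt_Φ₁ (hs : s.Reg y δ) (hn : y.Nice s δ) (hu : u ∈ ball (0 : ℝ) δ) :
    HasDerivAt (y.Φ₁ s) (y.Φ₁' s u) u := by
  have hu' := mem_ball_real.1 hu
  have h0 : |(0 : ℝ)| < δ := by simpa using (abs_nonneg _).trans_lt hu'
  have hau := abs_a_mul_lt (y := y) hu
  have h1 := hasDerivAt_primitive hn.cΛ₁ h0 hu'
  have h2 := (hasDerivAt_g₁ hs hn hu).inv (hn.g₁_ne u hu)
  have h3 := hasDerivAt_integral_fst (partials_m hs hn).continuousOn hn.cmv (partials_m hs hn).dv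
    (hasDerivAt_id u) (hasDerivAt_a_mul (y := y) u) (hasDerivAt_id u) hu' hau hu'
  have h4 := h1.add (h2.mul h3)
  simp only [id, ← one_div] at h4
  refine (h4.congr_deriv ?_).congr_of_eventuallyEq (Eventually.of_forall fun t => ?_)
  · simp [Φ₁']
  · simp [Φ₁]

theorem hasDerivAt_Φ₂ (hs : s.Reg y δ) (hn : y.Nice s δ) (hu : u ∈ ball (0 : ℝ) δ) :
    HasDerivAt (y.Φ₂ s) (y.Φ₂' s u) u := by
  have hu' := mem_ball_real.1 hu
  have h0 : |(0 : ℝ)| < δ := by simpa using (abs_nonneg _).trans_lt hu'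
  have hau := abs_a_mul_lt (y := y) hu
  have h1 := hasDerivAt_primitive hn.cΛ₂ h0 hu'
  have h3 := hasDerivAt_integral_snd (partials_m hs hn).continuousOn hn.cmu (partials_m hs hn).du
    (hasDerivAt_a_mul (y := y) u) (hasDerivAt_a_mul (y := y) u) (hasDerivAt_id u) hau hau hu'
  refine (h1.add ((hasDerivAt_g₂ hs hn hu).mul h3)).congr_deriv ?_
  simp [Φ₂']

theorem hasDerivAt_next_X_fst (hs : s.Reg y δ) (hn : y.Nice s δ) (q : ℝ × ℝ)
    (hq : q ∈ ball (0 : ℝ × ℝ) δ) :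
    HasDerivAt (fun u => (y.next s).X (u, q.2)) ((y.next s).P q) q.1 := by
  obtain ⟨hq1, hq2⟩ := mem_ball_prod.1 hq
  have h0 : |(0 : ℝ)| < δ := by simpa using (abs_nonneg _).trans_lt hq1
  have hm := (partials_m hs hn).continuousOn
  have hΦ : ContinuousOn (y.Φ₁ s) (ball 0 δ) := fun u hu =>
    (hasDerivAt_Φ₁ hs hn hu).continuousAt.continuousWithinAt
  have h1 := hasDerivAt_primitive hΦ h0 hq1
  have hN : ContinuousOn (fun r : ℝ × ℝ => ∫ u in (y.a * r.2)..r.1, y.m s (u, r.2)) (ball 0 δ) :=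
    continuousOn_parametric_intervalIntegral (Y := ℝ × ℝ) (Y' := ℝ × ℝ) hm
      (j := fun r t => (t, r.2)) (α := fun r => y.a * r.2) (β := fun r => r.1)
      (by fun_prop) (fun r t => by
        rw [Prod.norm_def, Real.norm_eq_abs, max_comm]
        exact max_le_max (norm_snd_le r) le_rfl) (by fun_prop) (by fun_prop)
      (fun r => (abs_a_mul_le _).trans (norm_snd_le r)) (fun r => norm_fst_le r)
  have hI : ContinuousOn (fun v : ℝ => ∫ u in (y.a * v)..v, y.m s (u, v)) (ball 0 δ) :=
    continuousOn_diagonal hN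
  have h2 := hasDerivAt_primitive hI h0 hq1
  have hNu : ∀ r ∈ ball (0 : ℝ × ℝ) δ,
      HasDerivAt (fun z => ∫ u in (y.a * r.2)..z, y.m s (u, r.2)) (y.m s r) r.1 := fun r hr => by
    obtain ⟨hr1, hr2⟩ := mem_ball_prod.1 hr
    exact hasDerivAt_primitive (f := fun u => y.m s (u, r.2))
      (hm.comp (by fun_prop) fun t ht => mem_ball_prod.2 ⟨mem_ball_real.1 ht, hr2⟩)
      ((abs_a_mul_le _).trans_lt hr2) hr1
  have h3 := hasDerivAt_integral_snd (f := fun r => ∫ u in (y.a * r.2)..r.1, y.m s (u, r.2))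
    hN hm hNu (hasDerivAt_id q.1) (hasDerivAt_id q.1) (hasDerivAt_const q.1 q.2) hq1 hq1 hq2
  refine (((((((hasDerivAt_id q.1).div_const y.Γ).add_const q.2).add h1).add_const
    (∫ t in (0 : ℝ)..q.2, y.Φ₂ s t)).add h2).add h3).congr_deriv ?_
  simp only [next, id]
  ring

theorem hasDerivAt_next_X_snd (hs : s.Reg y δ) (hn : y.Nice s δ) (q : ℝ × ℝ)
    (hq : q ∈ ball (0 : ℝ × ℝ) δ) :
    HasDerivAt (fun v => (y.next s).X (q.1, v)) ((y.next s).Q q) q.2 := by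
  obtain ⟨hq1, hq2⟩ := mem_ball_prod.1 hq
  have h0 : |(0 : ℝ)| < δ := by simpa using (abs_nonneg _).trans_lt hq1
  have hm := (partials_m hs hn).continuousOn
  have hΦ : ContinuousOn (y.Φ₂ s) (ball 0 δ) := fun u hu =>
    (hasDerivAt_Φ₂ hs hn hu).continuousAt.continuousWithinAt
  have h1 := hasDerivAt_primitive hΦ h0 hq2
  have hN : ContinuousOn (fun r : ℝ × ℝ => ∫ u in (y.a * r.2)..r.1, y.m s (u, r.2)) (ball 0 δ) :=
    continuousOn_parametric_intervalIntegral (Y := ℝ × ℝ) (Y' := ℝ × ℝ) hm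
      (j := fun r t => (t, r.2)) (α := fun r => y.a * r.2) (β := fun r => r.1)
      (by fun_prop) (fun r t => by
        rw [Prod.norm_def, Real.norm_eq_abs, max_comm]
        exact max_le_max (norm_snd_le r) le_rfl) (by fun_prop) (by fun_prop)
      (fun r => (abs_a_mul_le _).trans (norm_snd_le r)) (fun r => norm_fst_le r)
  have h3 := hasDerivAt_primitive (continuousOn_slice_right hN hq1) hq1 hq2
  have h4 : HasDerivAt (fun v : ℝ => q.1 / y.Γ + v) 1 q.2 := by
    simpa using (hasDerivAt_id q.2).const_add (q.1 / y.Γ)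
  refine ((((h4.add_const (∫ t in (0 : ℝ)..q.1, y.Φ₁ s t)).add h1).add_const
    (∫ v in (0 : ℝ)..q.1, ∫ u in (y.a * v)..v, y.m s (u, v))).add h3).congr_deriv ?_
  simp only [next]

theorem partials_next_P (hs : s.Reg y δ) (hn : y.Nice s δ) :
    Partials δ (y.next s).P (y.next s).Pu (y.next s).W := by
  have hm := (partials_m hs hn).continuousOn
  refine ⟨hn.cPu, hm, fun q hq => ?_, fun q hq => ?_⟩ <;> obtain ⟨hq1, hq2⟩ := mem_ball_prod.1 hq
  · have h1 := hasDerivAt_integral_snd hm hn.cmu (partials_m hs hn).du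
      (hasDerivAt_id q.1) (hasDerivAt_id q.1) (hasDerivAt_const q.1 q.2) hq1 hq1 hq2
    refine (((hasDerivAt_Φ₁ hs hn (mem_ball_real.2 hq1)).const_add (1 / y.Γ)).add h1).congr_deriv ?_
    simp only [next, id]
    ring
  · have h1 := hasDerivAt_primitive (continuousOn_slice_right hm hq1) hq1 hq2
    exact h1.const_add (1 / y.Γ + y.Φ₁ s q.1)

theorem partials_next_Q (hs : s.Reg y δ) (hn : y.Nice s δ) :
    Partials δ (y.next s).Q (y.next s).W (y.next s).Qv := by
  have hm := (partials_m hs hn).continuousOn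
  refine ⟨hm, hn.cQv, fun q hq => ?_, fun q hq => ?_⟩ <;> obtain ⟨hq1, hq2⟩ := mem_ball_prod.1 hq
  · have h1 := hasDerivAt_primitive (f := fun u => y.m s (u, q.2))
      (hm.comp (by fun_prop) fun t ht => mem_ball_prod.2 ⟨mem_ball_real.1 ht, hq2⟩)
      ((abs_a_mul_le (y := y) _).trans_lt hq2) hq1
    exact h1.const_add (1 + y.Φ₂ s q.2)
  · have h1 := hasDerivAt_integral_fst hm hn.cmv (partials_m hs hn).dv
      (hasDerivAt_id q.2) (hasDerivAt_a_mul (y := y) q.2) (hasDerivAt_const q.2 q.1) hq2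
      ((abs_a_mul_le _).trans_lt hq2) hq1
    refine (((hasDerivAt_Φ₂ hs hn (mem_ball_real.2 hq2)).const_add 1).add h1).congr_deriv ?_
    simp only [next, id]
    ring

theorem hasDerivAt_next_A₁ (hs : s.Reg y δ) (hn : y.Nice s δ) (hu : u ∈ ball (0 : ℝ) δ) :
    HasDerivAt (y.next s).A₁ ((y.next s).A₂ u) u := by
  refine (hasDerivAt_fderiv_comp_curve (hn.h₁ u hu)
    ((hs.dB _ hu).prodMk ((hasDerivAt_lt hs hn hu).prodMk (hasDerivAt_lx hs hu)))
    ((hs.dB₁ _ hu).prodMk ((hasDerivAt_lt₁ hs hn hu).prodMk (hasDerivAt_lx₁ hs hu)))).congr_deriv ?_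
  have h : (s.B₂ u, y.lt₂ s u, y.lx₂ s u)
      = s.B₂ u • ((1, 0, 0) : ℝ × ℝ × ℝ) + (0, y.lt₂ s u, y.lx₂ s u) := by simp
  simp only [next]
  rw [h, map_add, map_smul, smul_eq_mul, mul_comm (fderiv ℝ _ _ _)]
  rfl

theorem hasDerivAt_next_B₁ (hs : s.Reg y δ) (hn : y.Nice s δ) (hu : u ∈ ball (0 : ℝ) δ) :
    HasDerivAt (y.next s).B₁ ((y.next s).B₂ u) u := by
  refine (hasDerivAt_fderiv_comp_curve (hn.h₂ u hu)
    ((hasDerivAt_A_a_mul hs hu).prodMk ((hasDerivAt_rt hs hn hu).prodMk (hasDerivAt_rx hs hu)))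
    ((hasDerivAt_A₁_a_mul hs hu).prodMk
      ((hasDerivAt_rt₁ hs hn hu).prodMk (hasDerivAt_rx₁ hs hu)))).congr_deriv ?_
  have h : (y.a * (y.a * s.A₂ (y.a * u)), y.rt₂ s u, y.rx₂ s u)
      = (y.a * (y.a * s.A₂ (y.a * u))) • ((1, 0, 0) : ℝ × ℝ × ℝ) + (0, y.rt₂ s u, y.rx₂ s u) := by
    simp
  simp only [next]
  rw [h, map_add, map_smul, smul_eq_mul, mul_comm (fderiv ℝ _ _ _)]
  rfl

theorem lt_zero : y.lt s 0 = 0 := by simp [lt]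

theorem rt_zero : y.rt s 0 = 0 := by simp [rt]

theorem lt₁_zero (hs : s.Reg y δ) :
    y.lt₁ s 0 = y.F (y.β, y.β, 1 / y.Γ) + y.O (y.β, y.β, 1) := by
  simp only [lt₁, φ, ψ, State.cF, State.cO, hs.A_zero, hs.B_zero, hs.P_zero, hs.Q_zero]

theorem rt₁_zero (hs : s.Reg y δ) :
    y.rt₁ s 0 = y.a * y.F (y.β, y.β, 1 / y.Γ) + y.O (y.β, y.β, 1) := by
  simp [rt₁, φ, ψ, State.cF, State.cO, hs.A_zero, hs.B_zero, hs.P_zero, hs.Q_zero]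

theorem reg_next (hs : s.Reg y δ) (hn : y.Nice s δ) : (y.next s).Reg y δ where
  dA u hu := hasDerivAt_comp_curve (hn.h₁ u hu)
    ((hs.dB _ hu).prodMk ((hasDerivAt_lt hs hn hu).prodMk (hasDerivAt_lx hs hu)))
  dA₁ u hu := hasDerivAt_next_A₁ hs hn hu
  cA₂ := hn.cA₂
  dB u hu := hasDerivAt_comp_curve (hn.h₂ u hu)
    ((hasDerivAt_A_a_mul hs hu).prodMk ((hasDerivAt_rt hs hn hu).prodMk (hasDerivAt_rx hs hu)))
  dB₁ u hu := hasDerivAt_next_B₁ hs hn hu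
  cB₂ := hn.cB₂
  dX := ⟨(partials_next_P hs hn).continuousOn, (partials_next_Q hs hn).continuousOn,
    hasDerivAt_next_X_fst hs hn, hasDerivAt_next_X_snd hs hn⟩
  dP := partials_next_P hs hn
  dQ := partials_next_Q hs hn
  dW := (partials_m hs hn).du
  cWu := hn.cmu
  A_zero := by simp [next, l₁, lt_zero, lx, hs.B_zero, hs.X_zero, y.h₁_base]
  A₁_zero := by
    simp only [next, l₁, l₁', lt_zero, lx, lx₁, hs.B_zero, hs.X_zero, hs.B₁_zero, lt₁_zero hs,
      hs.P_zero, hs.Q_zero]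
    exact y.h₁_deriv
  B_zero := by simp [next, l₂, rt_zero, rx, hs.A_zero, hs.X_zero, y.h₂_base]
  B₁_zero := by
    simp only [next, l₂, l₂', rt_zero, rx, rx₁, mul_zero, hs.A_zero, hs.X_zero, hs.A₁_zero,
      rt₁_zero hs, hs.P_zero, hs.Q_zero]
    exact y.h₂_deriv
  X_zero := by simp [next]
  P_zero := by simp [next, Φ₁]
  Q_zero := by simp [next, Φ₂]

end Derivatives

end System

end System

section Basic

theorem Lead.clm_apply_lead {S : Type*} {c : Ctx S} {Y E F : Type*} [NormedAddCommGroup Y]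
    [NormedAddCommGroup E] [NormedSpace ℝ E] [NormedAddCommGroup F] [NormedSpace ℝ F]
    {Q : S → Y → E →L[ℝ] F} {Q' : S → Y → E} {K K' : ℝ} (h : Lead c Q K) (h' : Lead c Q' K') :
    ∃ K'', Lead c (fun s y => Q s y (Q' s y)) K'' := by
  obtain ⟨hK, C, hC, h⟩ := h
  obtain ⟨hK', C', hC', h'⟩ := h'
  refine ⟨C * (K' + C') + (K + C) * C', by positivity, C * C', by positivity, ?_⟩
  filter_upwards [h, h', eventually_pos_le_one] with δ h h' hδ
  have hδ0 := hδ.1.le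
  refine ⟨fun s hs => ⟨(h.1 s hs).1.clm_apply (h'.1 s hs).1, fun y hy =>
    (ContinuousLinearMap.le_opNorm _ _).trans (mul_le_mul ((h.1 s hs).2 y hy) ((h'.1 s hs).2 y hy)
      (norm_nonneg _) hC)⟩, fun s s' d hd y hy => ?_⟩
  have hd0 := c.nonneg hd
  have hs := c.left_mem hd
  have hs' := c.right_mem hd
  calc _ = ‖Q s y (Q' s y - Q' s' y) + (Q s y - Q s' y) (Q' s' y)‖ := by
        simp only [map_sub, sub_apply]; abel_nf
    _ ≤ ‖Q s y‖ * ‖Q' s y - Q' s' y‖ + ‖Q s y - Q s' y‖ * ‖Q' s' y‖ :=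
        (norm_add_le _ _).trans (add_le_add (ContinuousLinearMap.le_opNorm _ _)
          (ContinuousLinearMap.le_opNorm _ _))
    _ ≤ C * ((K' + C' * δ) * d) + ((K + C * δ) * d) * C' :=
        add_le_add (mul_le_mul ((h.1 s hs).2 y hy) (h'.2 s s' d hd y hy) (norm_nonneg _)
          hC) (mul_le_mul (h.2 s s' d hd y hy) ((h'.1 s' hs').2 y hy)
          (norm_nonneg _) (by positivity))
    _ ≤ C * ((K' + C' * 1) * d) + ((K + C * 1) * d) * C' := by
        gcongr <;> exact hδ.2
    _ = (C * (K' + C') + (K + C) * C') * d := by ring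
    _ ≤ _ := by
        have : 0 ≤ C * C' * δ := by positivity
        nlinarith

theorem Small.of_hasDerivAt {S : Type*} {c : Ctx S} {Q Q' : S → ℝ → ℝ} {q₀ K : ℝ}
    (hQ : ∀ δ s, c.V δ s → ∀ u ∈ ball (0 : ℝ) δ, HasDerivAt (Q s) (Q' s u) u)
    (h0 : ∀ δ s, c.V δ s → Q s 0 = q₀) (h : Lead c Q' K) : Small c Q q₀ := by
  obtain ⟨hK, C, hC, h⟩ := h
  refine ⟨C + K, by positivity, ?_⟩
  filter_upwards [h, eventually_pos_le_one] with δ h hδ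
  have hδ0 := hδ.1.le
  have key : ∀ {f f' : ℝ → ℝ} {D : ℝ}, 0 ≤ D → (∀ u ∈ ball (0 : ℝ) δ, HasDerivAt f (f' u) u) →
      (∀ u ∈ ball (0 : ℝ) δ, ‖f' u‖ ≤ D) → ∀ u ∈ ball (0 : ℝ) δ, ‖f u - f 0‖ ≤ D * δ := by
    intro f f' D hD hf hf' u hu
    have h1 := (convex_ball (0 : ℝ) δ).norm_image_sub_le_of_norm_hasDerivWithin_le
      (fun x hx => (hf x hx).hasDerivWithinAt) hf' (mem_ball_self hδ.1) hu
    refine h1.trans (mul_le_mul_of_nonneg_left ?_ hD)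
    rw [sub_zero]
    exact (mem_ball_zero_iff.1 hu).le
  refine ⟨fun s hs => ⟨fun u hu => (hQ δ s hs u hu).continuousAt.continuousWithinAt,
    fun u hu => ?_⟩, fun s s' d hd u hu => ?_⟩
  · have := key hC (hQ δ s hs) (h.1 s hs).2 u hu
    rw [h0 δ s hs] at this
    exact this.trans (by gcongr; linarith)
  · have hs := c.left_mem hd
    have hs' := c.right_mem hd
    have hd0 := c.nonneg hd
    have := key (f := fun u => Q s u - Q s' u) (f' := fun u => Q' s u - Q' s' u)
      (D := (K + C * δ) * d) (by positivity)
      (fun x hx => (hQ δ s hs x hx).sub (hQ δ s' hs' x hx)) (h.2 s s' d hd) u hu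
    simp only [h0 δ s hs, h0 δ s' hs', sub_self, sub_zero] at this
    calc _ ≤ (K + C * δ) * d * δ := this
      _ ≤ (K + C * 1) * d * δ := by gcongr; exact hδ.2
      _ = _ := by ring

theorem Small.of_partials {S : Type*} {c : Ctx S} {Q Qu Qv : S → ℝ × ℝ → ℝ} {q₀ K K' : ℝ}
    (hQ : ∀ δ s, c.V δ s → Partials δ (Q s) (Qu s) (Qv s))
    (h0 : ∀ δ s, c.V δ s → Q s (0, 0) = q₀) (h : Lead c Qu K) (h' : Lead c Qv K') :
    Small c Q q₀ := by
  obtain ⟨hK, C, hC, h⟩ := h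
  obtain ⟨hK', C', hC', h'⟩ := h'
  refine ⟨(C + K) + (C' + K'), by positivity, ?_⟩
  filter_upwards [h, h', eventually_pos_le_one] with δ h h' hδ
  have hδ0 := hδ.1.le
  have key : ∀ {f fu fv : ℝ × ℝ → ℝ} {D D' : ℝ}, 0 ≤ D → 0 ≤ D' →
      (∀ q ∈ ball (0 : ℝ × ℝ) δ, HasFDerivAt f (fu q • ContinuousLinearMap.fst ℝ ℝ ℝ
        + fv q • ContinuousLinearMap.snd ℝ ℝ ℝ) q) →
      (∀ q ∈ ball (0 : ℝ × ℝ) δ, ‖fu q‖ ≤ D) → (∀ q ∈ ball (0 : ℝ × ℝ) δ, ‖fv q‖ ≤ D') →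
      ∀ q ∈ ball (0 : ℝ × ℝ) δ, ‖f q - f (0, 0)‖ ≤ (D + D') * δ := by
    intro f fu fv D D' hD hD' hf hfu hfv q hq
    have h1 := (convex_ball (0 : ℝ × ℝ) δ).norm_image_sub_le_of_norm_hasFDerivWithin_le
      (C := D + D') (fun x hx => (hf x hx).hasFDerivWithinAt) (fun x hx => ?_)
      (mem_ball_self hδ.1) hq
    · refine h1.trans (mul_le_mul_of_nonneg_left ?_ (by positivity))
      rw [sub_zero]
      exact (mem_ball_zero_iff.1 hq).le
    · refine (norm_add_le _ _).trans (add_le_add ?_ ?_) <;> rw [norm_smul]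
      · exact (mul_le_of_le_one_right (norm_nonneg _)
          (ContinuousLinearMap.norm_fst_le ℝ ℝ ℝ)).trans (hfu x hx)
      · exact (mul_le_of_le_one_right (norm_nonneg _)
          (ContinuousLinearMap.norm_snd_le ℝ ℝ ℝ)).trans (hfv x hx)
  refine ⟨fun s hs => ⟨(hQ δ s hs).continuousOn, fun u hu => ?_⟩, fun s s' d hd u hu => ?_⟩
  · have := key hC hC' (fun q hq => (hQ δ s hs).hasFDerivAt hq) (h.1 s hs).2 (h'.1 s hs).2 u hu
    rw [h0 δ s hs] at this
    exact this.trans (by gcongr <;> linarith)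
  · have hs := c.left_mem hd
    have hs' := c.right_mem hd
    have hd0 := c.nonneg hd
    have := key (f := fun u => Q s u - Q s' u) (fu := fun u => Qu s u - Qu s' u)
      (fv := fun u => Qv s u - Qv s' u)
      (D := (K + C * δ) * d) (D' := (K' + C' * δ) * d) (by positivity) (by positivity)
      (fun x hx => by
        refine (((hQ δ s hs).hasFDerivAt hx).sub ((hQ δ s' hs').hasFDerivAt hx)).congr_fderiv ?_
        module) (h.2 s s' d hd) (h'.2 s s' d hd) u hu
    simp only [h0 δ s hs, h0 δ s' hs', sub_self, sub_zero] at this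
    calc _ ≤ ((K + C * δ) * d + (K' + C' * δ) * d) * δ := this
      _ ≤ ((K + C * 1) * d + (K' + C' * 1) * d) * δ := by gcongr <;> exact hδ.2
      _ = _ := by ring

end Basic

/-- The second derivatives of two states differ by at most `d`, with weights `κ` and `L`. -/
def State.Dif (κ L δ d : ℝ) (s s' : State) : Prop :=
  (∀ u ∈ ball (0 : ℝ) δ, |s.A₂ u - s'.A₂ u| ≤ d ∧ |s.B₂ u - s'.B₂ u| ≤ d) ∧
  ∀ q ∈ ball (0 : ℝ × ℝ) δ, |s.Pu q - s'.Pu q| ≤ κ * d ∧ |s.W q - s'.W q| ≤ κ * d ∧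
    |s.Qv q - s'.Qv q| ≤ κ * d ∧ |s.Wu q - s'.Wu q| ≤ L * d

namespace System

variable (y : System)

/-- The initial iterate. -/
def start : State where
  A u := y.β + y.α' * u
  A₁ _ := y.α'
  A₂ _ := 0
  B v := y.β + y.β' * v
  B₁ _ := y.β'
  B₂ _ := 0
  X q := q.1 / y.Γ + q.2
  P _ := 1 / y.Γ
  Q _ := 1
  Pu _ := 0
  W _ := 0
  Qv _ := 0
  Wu _ := 0

theorem reg_start (δ : ℝ) : y.start.Reg y δ where
  dA u _ := (((hasDerivAt_id u).const_mul y.α').const_add y.β).congr_deriv (mul_one _)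
  dA₁ u _ := hasDerivAt_const _ _
  cA₂ := continuousOn_const
  dB u _ := (((hasDerivAt_id u).const_mul y.β').const_add y.β).congr_deriv (mul_one _)
  dB₁ u _ := hasDerivAt_const _ _
  cB₂ := continuousOn_const
  dX := ⟨continuousOn_const, continuousOn_const,
    fun q _ => ((hasDerivAt_id q.1).div_const y.Γ).add_const q.2,
    fun q _ => (hasDerivAt_id q.2).const_add (q.1 / y.Γ)⟩
  dP := ⟨continuousOn_const, continuousOn_const, fun _ _ => hasDerivAt_const _ _,
    fun _ _ => hasDerivAt_const _ _⟩
  dQ := ⟨continuousOn_const, continuousOn_const, fun _ _ => hasDerivAt_const _ _,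
    fun _ _ => hasDerivAt_const _ _⟩
  dW _ _ := hasDerivAt_const _ _
  cWu := continuousOn_const
  A_zero := by simp [start]
  A₁_zero := rfl
  B_zero := by simp [start]
  B₁_zero := rfl
  X_zero := by simp [start]
  P_zero := rfl
  Q_zero := rfl

/-- Admissible states are the regular ones within distance `N` of the initial iterate. -/
def ctx (κ L N : ℝ) : Ctx State where
  V δ s := s.Reg y δ ∧ State.Dif κ L δ N s y.start
  R δ d s s' := ((s.Reg y δ ∧ State.Dif κ L δ N s y.start) ∧
    (s'.Reg y δ ∧ State.Dif κ L δ N s' y.start)) ∧ 0 ≤ d ∧ State.Dif κ L δ d s s'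
  left_mem h := h.1.1
  right_mem h := h.1.2
  nonneg h := h.2.1

variable {y} {κ L N : ℝ}

theorem norm_diag_le (u : ℝ) : ‖((u, u) : ℝ × ℝ)‖ ≤ ‖u‖ := by simp [Prod.norm_def]

theorem norm_right_le (u : ℝ) : ‖((y.a * u, u) : ℝ × ℝ)‖ ≤ ‖u‖ :=
  max_le (abs_a_mul_le u) le_rfl

theorem norm_right_diag_le (u : ℝ) : ‖((y.a * u, y.a * u) : ℝ × ℝ)‖ ≤ ‖u‖ :=
  max_le (abs_a_mul_le u) (abs_a_mul_le u)

theorem norm_a_mul_le (u : ℝ) : ‖y.a * u‖ ≤ ‖u‖ := abs_a_mul_le u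

theorem lead_A₂ : Lead (y.ctx κ L N) (fun s => s.A₂) 1 := by
  refine ⟨zero_le_one, |N|, abs_nonneg _, Filter.mem_of_superset self_mem_nhdsWithin
    fun δ hδ => ⟨fun s hs => ⟨hs.1.cA₂, fun u hu => ?_⟩, fun s s' d hd u hu => ?_⟩⟩
  · have := (hs.2.1 u hu).1
    simp only [start, sub_zero] at this
    exact this.trans (le_abs_self N)
  · refine ((hd.2.2.1 u hu).1).trans ?_
    have := mul_nonneg (mul_nonneg (abs_nonneg N) (le_of_lt hδ)) hd.2.1
    linarith

theorem lead_B₂ : Lead (y.ctx κ L N) (fun s => s.B₂) 1 := by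
  refine ⟨zero_le_one, |N|, abs_nonneg _, Filter.mem_of_superset self_mem_nhdsWithin
    fun δ hδ => ⟨fun s hs => ⟨hs.1.cB₂, fun u hu => ?_⟩, fun s s' d hd u hu => ?_⟩⟩
  · have := (hs.2.1 u hu).2
    simp only [start, sub_zero] at this
    exact this.trans (le_abs_self N)
  · refine ((hd.2.2.1 u hu).2).trans ?_
    have := mul_nonneg (mul_nonneg (abs_nonneg N) (le_of_lt hδ)) hd.2.1
    linarith

theorem lead_of_dif {Q : State → ℝ × ℝ → ℝ} {w : ℝ} (hw : 0 ≤ w) (h0 : ∀ q, Q y.start q = 0)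
    (hc : ∀ δ s, s.Reg y δ → ContinuousOn (Q s) (ball 0 δ))
    (h : ∀ δ d s s', State.Dif κ L δ d s s' → ∀ q ∈ ball (0 : ℝ × ℝ) δ,
      |Q s q - Q s' q| ≤ w * d) : Lead (y.ctx κ L N) Q w := by
  refine ⟨hw, |w * N|, abs_nonneg _, Filter.mem_of_superset self_mem_nhdsWithin
    fun δ hδ => ⟨fun s hs => ⟨hc δ s hs.1, fun u hu => ?_⟩, fun s s' d hd u hu => ?_⟩⟩
  · have := h _ _ _ _ hs.2 u hu
    rw [h0, sub_zero] at this
    exact this.trans (le_abs_self _)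
  · refine (h _ _ _ _ hd.2.2 u hu).trans ?_
    have := mul_nonneg (mul_nonneg (abs_nonneg (w * N)) (le_of_lt hδ)) hd.2.1
    linarith

theorem lead_Pu (hκ : 0 ≤ κ) : Lead (y.ctx κ L N) (fun s => s.Pu) κ :=
  lead_of_dif hκ (fun _ => rfl) (fun _ _ hs => hs.dP.cu) fun _ _ _ _ h q hq => (h.2 q hq).1

theorem lead_W (hκ : 0 ≤ κ) : Lead (y.ctx κ L N) (fun s => s.W) κ :=
  lead_of_dif hκ (fun _ => rfl) (fun _ _ hs => hs.dP.cv) fun _ _ _ _ h q hq => (h.2 q hq).2.1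

theorem lead_Qv (hκ : 0 ≤ κ) : Lead (y.ctx κ L N) (fun s => s.Qv) κ :=
  lead_of_dif hκ (fun _ => rfl) (fun _ _ hs => hs.dQ.cv) fun _ _ _ _ h q hq => (h.2 q hq).2.2.1

theorem lead_Wu (hL : 0 ≤ L) : Lead (y.ctx κ L N) (fun s => s.Wu) L :=
  lead_of_dif hL (fun _ => rfl) (fun _ _ hs => hs.cWu) fun _ _ _ _ h q hq => (h.2 q hq).2.2.2

theorem small_A₁ : Small (y.ctx κ L N) (fun s => s.A₁) y.α' :=
  Small.of_hasDerivAt (fun _ _ hs => hs.1.dA₁) (fun _ _ hs => hs.1.A₁_zero) lead_A₂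

theorem small_A : Small (y.ctx κ L N) (fun s => s.A) y.β :=
  Small.of_hasDerivAt (fun _ _ hs => hs.1.dA) (fun _ _ hs => hs.1.A_zero) small_A₁.lead

theorem small_B₁ : Small (y.ctx κ L N) (fun s => s.B₁) y.β' :=
  Small.of_hasDerivAt (fun _ _ hs => hs.1.dB₁) (fun _ _ hs => hs.1.B₁_zero) lead_B₂

theorem small_B : Small (y.ctx κ L N) (fun s => s.B) y.β :=
  Small.of_hasDerivAt (fun _ _ hs => hs.1.dB) (fun _ _ hs => hs.1.B_zero) small_B₁.lead

theorem small_P (hκ : 0 ≤ κ) : Small (y.ctx κ L N) (fun s => s.P) (1 / y.Γ) :=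
  Small.of_partials (fun _ _ hs => hs.1.dP) (fun _ _ hs => hs.1.P_zero) (lead_Pu hκ) (lead_W hκ)

theorem small_Q (hκ : 0 ≤ κ) : Small (y.ctx κ L N) (fun s => s.Q) 1 :=
  Small.of_partials (fun _ _ hs => hs.1.dQ) (fun _ _ hs => hs.1.Q_zero) (lead_W hκ) (lead_Qv hκ)

theorem small_X (hκ : 0 ≤ κ) : Small (y.ctx κ L N) (fun s => s.X) 0 :=
  Small.of_partials (fun _ _ hs => hs.1.dX) (fun _ _ hs => hs.1.X_zero) (small_P hκ).lead
    (small_Q hκ).lead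

section Pullback

variable {E : Type*} [NormedAddCommGroup E] [NormedSpace ℝ E] {c : Ctx State} {q₀ : E} {K : ℝ}

theorem _root_.ShockInteraction.Small.fst {Q : State → ℝ → E} (h : Small c Q q₀) :
    Small c (fun s (q : ℝ × ℝ) => Q s q.1) q₀ := h.pre continuous_fst norm_fst_le

theorem _root_.ShockInteraction.Small.snd {Q : State → ℝ → E} (h : Small c Q q₀) :
    Small c (fun s (q : ℝ × ℝ) => Q s q.2) q₀ := h.pre continuous_snd norm_snd_le

theorem _root_.ShockInteraction.Lead.fst {Q : State → ℝ → E} (h : Lead c Q K) :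
    Lead c (fun s (q : ℝ × ℝ) => Q s q.1) K := h.pre continuous_fst norm_fst_le

theorem _root_.ShockInteraction.Lead.snd {Q : State → ℝ → E} (h : Lead c Q K) :
    Lead c (fun s (q : ℝ × ℝ) => Q s q.2) K := h.pre continuous_snd norm_snd_le

theorem _root_.ShockInteraction.Small.diag {Q : State → ℝ × ℝ → E} (h : Small c Q q₀) :
    Small c (fun s (u : ℝ) => Q s (u, u)) q₀ :=
  h.pre (j := fun u => (u, u)) (by fun_prop) norm_diag_le

theorem _root_.ShockInteraction.Lead.diag {Q : State → ℝ × ℝ → E} (h : Lead c Q K) :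
    Lead c (fun s (u : ℝ) => Q s (u, u)) K :=
  h.pre (j := fun u => (u, u)) (by fun_prop) norm_diag_le

variable (y)

theorem _root_.ShockInteraction.Small.right {Q : State → ℝ × ℝ → E} (h : Small c Q q₀) :
    Small c (fun s (u : ℝ) => Q s (y.a * u, u)) q₀ :=
  h.pre (j := fun u => (y.a * u, u)) (by fun_prop) norm_right_le

theorem _root_.ShockInteraction.Lead.right {Q : State → ℝ × ℝ → E} (h : Lead c Q K) :
    Lead c (fun s (u : ℝ) => Q s (y.a * u, u)) K :=
  h.pre (j := fun u => (y.a * u, u)) (by fun_prop) norm_right_le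

theorem _root_.ShockInteraction.Small.rightDiag {Q : State → ℝ × ℝ → E} (h : Small c Q q₀) :
    Small c (fun s (u : ℝ) => Q s (y.a * u, y.a * u)) q₀ :=
  h.pre (j := fun u => (y.a * u, y.a * u)) (by fun_prop) norm_right_diag_le

theorem _root_.ShockInteraction.Lead.rightDiag {Q : State → ℝ × ℝ → E} (h : Lead c Q K) :
    Lead c (fun s (u : ℝ) => Q s (y.a * u, y.a * u)) K :=
  h.pre (j := fun u => (y.a * u, y.a * u)) (by fun_prop) norm_right_diag_le

theorem _root_.ShockInteraction.Small.scaled {Q : State → ℝ → E} (h : Small c Q q₀) :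
    Small c (fun s (u : ℝ) => Q s (y.a * u)) q₀ :=
  h.pre (j := fun u => y.a * u) (by fun_prop) norm_a_mul_le

theorem _root_.ShockInteraction.Lead.scaled {Q : State → ℝ → E} (h : Lead c Q K) :
    Lead c (fun s (u : ℝ) => Q s (y.a * u)) K :=
  h.pre (j := fun u => y.a * u) (by fun_prop) norm_a_mul_le

end Pullback

theorem lead_zero {c : Ctx State} {Y : Type*} [NormedAddCommGroup Y] :
    Lead c (fun _ (_ : Y) => (0 : ℝ)) 0 := (Small.const (0 : ℝ)).lead

theorem small_cF (hκ : 0 ≤ κ) : Small (y.ctx κ L N) State.cF (y.β, y.β, 1 / y.Γ) :=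
  small_A.fst.prodMk (small_B.snd.prodMk (small_P hκ))

theorem small_cO (hκ : 0 ≤ κ) : Small (y.ctx κ L N) State.cO (y.β, y.β, 1) :=
  small_A.fst.prodMk (small_B.snd.prodMk (small_Q hκ))

theorem small_cM (hκ : 0 ≤ κ) :
    Small (y.ctx κ L N) State.cM (y.β, y.β, y.α', y.β', 1 / y.Γ, 1) :=
  small_A.fst.prodMk (small_B.snd.prodMk (small_A₁.fst.prodMk (small_B₁.snd.prodMk
    ((small_P hκ).prodMk (small_Q hκ)))))

theorem lead_cFu (hκ : 0 ≤ κ) : Lead (y.ctx κ L N) State.cFu κ :=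
  (small_A₁.lead.fst.prodMk (lead_zero.prodMk (lead_Pu hκ))).mono (by simp [hκ])

theorem lead_cFv (hκ : 0 ≤ κ) : Lead (y.ctx κ L N) State.cFv κ :=
  (lead_zero.prodMk (small_B₁.lead.snd.prodMk (lead_W hκ))).mono (by simp [hκ])

theorem lead_cOu (hκ : 0 ≤ κ) : Lead (y.ctx κ L N) State.cOu κ :=
  (small_A₁.lead.fst.prodMk (lead_zero.prodMk (lead_W hκ))).mono (by simp [hκ])

theorem lead_cOv (hκ : 0 ≤ κ) : Lead (y.ctx κ L N) State.cOv κ :=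
  (lead_zero.prodMk (small_B₁.lead.snd.prodMk (lead_Qv hκ))).mono (by simp [hκ])

theorem lead_cOuu (hL : 0 ≤ L) : Lead (y.ctx κ L N) State.cOuu (max 1 (max 0 L)) :=
  lead_A₂.fst.prodMk (lead_zero.prodMk (lead_Wu hL))

theorem lead_cMu (hκ : 0 ≤ κ) (hκ1 : κ ≤ 1) : Lead (y.ctx κ L N) State.cMu 1 :=
  (small_A₁.lead.fst.prodMk (lead_zero.prodMk (lead_A₂.fst.prodMk (lead_zero.prodMk
    ((lead_Pu hκ).prodMk (lead_W hκ)))))).mono (by simp [hκ1])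

theorem lead_cMv (hκ : 0 ≤ κ) (hκ1 : κ ≤ 1) : Lead (y.ctx κ L N) State.cMv 1 :=
  (lead_zero.prodMk (small_B₁.lead.snd.prodMk (lead_zero.prodMk (lead_B₂.snd.prodMk
    ((lead_W hκ).prodMk (lead_Qv hκ)))))).mono (by simp [hκ1])

section Fderiv

variable {E G : Type*} [NormedAddCommGroup E] [NormedSpace ℝ E] [NormedAddCommGroup G]
  {c : Ctx State} {f : E → ℝ} {Q : State → G → E} {q₀ : E}

theorem _root_.ShockInteraction.Small.fderiv (h : Small c Q q₀) (hf : ContDiffAt ℝ 3 f q₀) :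
    Small c (fun s x => fderiv ℝ f (Q s x)) (fderiv ℝ f q₀) :=
  h.comp (hf.fderiv_right (by norm_num))

theorem _root_.ShockInteraction.Small.fderiv_fderiv (h : Small c Q q₀)
    (hf : ContDiffAt ℝ 3 f q₀) :
    Small c (fun s x => _root_.fderiv ℝ (_root_.fderiv ℝ f) (Q s x))
      (_root_.fderiv ℝ (_root_.fderiv ℝ f) q₀) := by
  have h2 : ContDiffAt ℝ 2 (_root_.fderiv ℝ f) q₀ := hf.fderiv_right (by norm_num)
  exact h.comp (h2.fderiv_right (by norm_num))

theorem _root_.ShockInteraction.Small.comp_three (h : Small c Q q₀) (hf : ContDiffAt ℝ 3 f q₀) :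
    Small c (fun s x => f (Q s x)) (f q₀) :=
  h.comp (hf.of_le (by norm_num))

end Fderiv

variable (y) in
/-- Size of the derivative of `F` at the interaction point. -/
def normF : ℝ := ‖fderiv ℝ y.F (y.β, y.β, 1 / y.Γ)‖

variable (y) in
/-- Size of the derivative of `O` at the interaction point. -/
def normO : ℝ := ‖fderiv ℝ y.O (y.β, y.β, 1)‖

variable (y) in
/-- Size of the derivative of `M` at the interaction point. -/
def normM : ℝ := ‖fderiv ℝ y.M (y.β, y.β, y.α', y.β', 1 / y.Γ, 1)‖

theorem normF_nonneg : 0 ≤ y.normF := norm_nonneg _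

theorem normO_nonneg : 0 ≤ y.normO := norm_nonneg _

theorem normM_nonneg : 0 ≤ y.normM := norm_nonneg _

theorem small_φ (hκ : 0 ≤ κ) : Small (y.ctx κ L N) y.φ (y.F (y.β, y.β, 1 / y.Γ)) :=
  (small_cF hκ).comp_three y.contDiff_F

theorem small_ψ (hκ : 0 ≤ κ) : Small (y.ctx κ L N) y.ψ (y.O (y.β, y.β, 1)) :=
  (small_cO hκ).comp_three y.contDiff_O

theorem small_m (hκ : 0 ≤ κ) :
    Small (y.ctx κ L N) y.m (y.M (y.β, y.β, y.α', y.β', 1 / y.Γ, 1)) :=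
  (small_cM hκ).comp_three y.contDiff_M

theorem lead_φu (hκ : 0 ≤ κ) : Lead (y.ctx κ L N) y.φu (y.normF * κ) :=
  Lead.clm_apply ((small_cF hκ).fderiv y.contDiff_F) (lead_cFu hκ)

theorem lead_φv (hκ : 0 ≤ κ) : Lead (y.ctx κ L N) y.φv (y.normF * κ) :=
  Lead.clm_apply ((small_cF hκ).fderiv y.contDiff_F) (lead_cFv hκ)

theorem lead_ψu (hκ : 0 ≤ κ) : Lead (y.ctx κ L N) y.ψu (y.normO * κ) :=
  Lead.clm_apply ((small_cO hκ).fderiv y.contDiff_O) (lead_cOu hκ)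

theorem lead_ψv (hκ : 0 ≤ κ) : Lead (y.ctx κ L N) y.ψv (y.normO * κ) :=
  Lead.clm_apply ((small_cO hκ).fderiv y.contDiff_O) (lead_cOv hκ)

theorem lead_ψuu (hκ : 0 ≤ κ) (hL : 0 ≤ L) : ∃ K, Lead (y.ctx κ L N) y.ψuu K := by
  obtain ⟨K, hK⟩ := Lead.clm_apply_lead
    (Lead.clm_apply ((small_cO (L := L) (N := N) hκ).fderiv_fderiv y.contDiff_O) (lead_cOu hκ))
    (lead_cOu hκ)
  exact ⟨_, hK.add (Lead.clm_apply ((small_cO hκ).fderiv y.contDiff_O) (lead_cOuu hL))⟩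

theorem lead_mu (hκ : 0 ≤ κ) (hκ1 : κ ≤ 1) : Lead (y.ctx κ L N) y.mu y.normM :=
  (Lead.clm_apply ((small_cM hκ).fderiv y.contDiff_M) (lead_cMu hκ hκ1)).mono
    (by rw [mul_one]; rfl)

theorem lead_mv (hκ : 0 ≤ κ) (hκ1 : κ ≤ 1) : Lead (y.ctx κ L N) y.mv y.normM :=
  (Lead.clm_apply ((small_cM hκ).fderiv y.contDiff_M) (lead_cMv hκ hκ1)).mono
    (by rw [mul_one]; rfl)

end System

namespace System

variable {y : System} {κ L N : ℝ}

theorem abs_a : |y.a| = y.a := abs_of_pos y.a_pos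

theorem Small.neg {Y : Type*} [NormedAddCommGroup Y] {c : Ctx State} {Q : State → Y → ℝ} {r : ℝ}
    (h : Small c Q r) : Small c (fun s u => -Q s u) (0 - r) := by
  simpa only [zero_sub] using (Small.const (0 : ℝ)).sub h

theorem small_lt (hκ : 0 ≤ κ) : Small (y.ctx κ L N) y.lt 0 :=
  Lead.integral (Q := fun s t => y.φ s (t, t) + y.ψ s (t, t)) (j := fun _ t => t)
    ((small_φ hκ).diag.add (small_ψ hκ).diag).lead continuous_snd (fun _ _ => le_max_right _ _)
    continuous_const continuous_id (fun u => by simp) (fun _ => le_rfl)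

theorem small_lt₁ (hκ : 0 ≤ κ) :
    Small (y.ctx κ L N) y.lt₁ (y.F (y.β, y.β, 1 / y.Γ) + y.O (y.β, y.β, 1)) :=
  (small_φ hκ).diag.add (small_ψ hκ).diag

theorem small_lx (hκ : 0 ≤ κ) : Small (y.ctx κ L N) y.lx 0 := (small_X hκ).diag

theorem small_lx₁ (hκ : 0 ≤ κ) : Small (y.ctx κ L N) y.lx₁ (1 / y.Γ + 1) :=
  (small_P hκ).diag.add (small_Q hκ).diag

/-- Integrals over vertical segments ending on the right shock. -/
theorem Lead.integral_right {c : Ctx State} {Q : State → ℝ × ℝ → ℝ} {K : ℝ} (h : Lead c Q K) :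
    Small c (fun s v => ∫ t in (y.a * v)..v, Q s (y.a * v, t)) 0 :=
  h.integral (j := fun v t => (y.a * v, t)) (by fun_prop)
    (fun v _ => max_le_max (abs_a_mul_le v) le_rfl) (by fun_prop) (by fun_prop)
    (fun v => abs_a_mul_le v) (fun _ => le_rfl)

/-- Integrals over horizontal segments from the right shock to the left shock. -/
theorem Lead.integral_left {c : Ctx State} {Q : State → ℝ × ℝ → ℝ} {K : ℝ} (h : Lead c Q K) :
    Small c (fun s v => ∫ t in (y.a * v)..v, Q s (t, v)) 0 :=
  h.integral (j := fun v t => (t, v)) (by fun_prop)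
    (fun v t => max_le (le_max_right _ _) (le_max_left _ _)) (by fun_prop) (by fun_prop)
    (fun v => abs_a_mul_le v) (fun _ => le_rfl)

theorem small_rt (hκ : 0 ≤ κ) : Small (y.ctx κ L N) y.rt 0 := by
  have h1 : Small (y.ctx κ L N)
      (fun s v => ∫ t in (0 : ℝ)..y.a * v, (y.φ s (t, t) + y.ψ s (t, t))) 0 := (small_lt hκ).scaled y
  have h2 := h1.add (Lead.integral_right (y := y) (small_ψ hκ).lead)
  rw [add_zero] at h2
  exact h2

theorem small_rt₁ (hκ : 0 ≤ κ) : Small (y.ctx κ L N) y.rt₁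
    (y.a * y.F (y.β, y.β, 1 / y.Γ) + y.O (y.β, y.β, 1) + y.a * 0) :=
  (((Small.const y.a).mul ((small_φ hκ).rightDiag y)).add ((small_ψ hκ).right y)).add
    ((Small.const y.a).mul (Lead.integral_right (lead_ψu hκ)))

theorem small_rx (hκ : 0 ≤ κ) : Small (y.ctx κ L N) y.rx 0 := (small_X hκ).right y

theorem small_rx₁ (hκ : 0 ≤ κ) : Small (y.ctx κ L N) y.rx₁ (y.a * (1 / y.Γ) + 1) :=
  ((Small.const y.a).mul ((small_P hκ).right y)).add ((small_Q hκ).right y)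

variable (y) in
/-- Bound for the second derivatives of the shock curves in terms of those of the iterate. -/
def traceBound : ℝ := 4 * (y.normF + y.normO + 1)

theorem lead_lt₂ (hκ : 0 ≤ κ) : Lead (y.ctx κ L N) y.lt₂ (y.traceBound * κ) := by
  refine (((lead_φu hκ).diag.add (lead_φv hκ).diag).add
    ((lead_ψu hκ).diag.add (lead_ψv hκ).diag)).mono ?_
  unfold traceBound
  nlinarith [mul_nonneg (normF_nonneg (y := y)) hκ, mul_nonneg (normO_nonneg (y := y)) hκ]

theorem lead_lx₂ (hκ : 0 ≤ κ) : Lead (y.ctx κ L N) y.lx₂ (y.traceBound * κ) := by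
  refine (((lead_Pu hκ).diag.add (lead_W hκ).diag).add
    ((lead_W hκ).diag.add (lead_Qv hκ).diag)).mono ?_
  unfold traceBound
  nlinarith [mul_nonneg (normF_nonneg (y := y)) hκ, mul_nonneg (normO_nonneg (y := y)) hκ]

theorem lead_rt₂ (hκ : 0 ≤ κ) (hL : 0 ≤ L) :
    Lead (y.ctx κ L N) y.rt₂ (y.traceBound * κ) := by
  obtain ⟨K, hK⟩ := lead_ψuu (y := y) (N := N) hκ hL
  have h_int := Lead.integral_right (y := y) hK
  refine ((((((lead_φu hκ).rightDiag y).add ((lead_φv hκ).rightDiag y)).const_mul y.a).const_mul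
    y.a).add ((((lead_ψu hκ).right y).const_mul y.a).add ((lead_ψv hκ).right y)) |>.add
    (((((lead_ψu hκ).right y).sub (((lead_ψu hκ).rightDiag y).const_mul y.a)).add
      (h_int.lead.const_mul y.a)).const_mul y.a)).mono ?_
  rw [abs_a]
  have h1 := mul_nonneg (normF_nonneg (y := y)) hκ
  have h2 := mul_nonneg (normO_nonneg (y := y)) hκ
  have h3 := y.a_pos.le
  have h4 := y.a_lt.le
  have h5 : y.a * y.a ≤ 1 := mul_le_one₀ h4 h3 h4
  unfold traceBound
  nlinarith [mul_nonneg h1 (sub_nonneg.2 h5), mul_nonneg h2 (sub_nonneg.2 h5),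
    mul_nonneg h2 (sub_nonneg.2 h4)]

theorem lead_rx₂ (hκ : 0 ≤ κ) : Lead (y.ctx κ L N) y.rx₂ (y.traceBound * κ) := by
  refine ((((((lead_Pu hκ).right y).const_mul y.a).add ((lead_W hκ).right y)).const_mul y.a).add
    ((((lead_W hκ).right y).const_mul y.a).add ((lead_Qv hκ).right y))).mono ?_
  rw [abs_a]
  have h1 := mul_nonneg (normF_nonneg (y := y)) hκ
  have h2 := mul_nonneg (normO_nonneg (y := y)) hκ
  have h3 := y.a_pos.le
  have h4 := y.a_lt.le
  have h5 : y.a * y.a ≤ 1 := mul_le_one₀ h4 h3 h4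
  unfold traceBound
  nlinarith [mul_nonneg hκ (sub_nonneg.2 h5), mul_nonneg hκ (sub_nonneg.2 h4)]

theorem small_k₁ (hκ : 0 ≤ κ) : Small (y.ctx κ L N) y.k₁ (y.β, y.β, 0, 0) :=
  small_A.prodMk (small_B.prodMk ((small_lt hκ).prodMk (small_lx hκ)))

theorem small_k₁' (hκ : 0 ≤ κ) : ∃ r, Small (y.ctx κ L N) y.k₁' r :=
  ⟨_, small_A₁.prodMk (small_B₁.prodMk ((small_lt₁ hκ).prodMk (small_lx₁ hκ)))⟩

theorem small_k₂ (hκ : 0 ≤ κ) : Small (y.ctx κ L N) y.k₂ (y.β, y.β, 0, 0) :=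
  (small_A.scaled y).prodMk (small_B.prodMk ((small_rt hκ).prodMk (small_rx hκ)))

theorem small_k₂' (hκ : 0 ≤ κ) : ∃ r, Small (y.ctx κ L N) y.k₂' r :=
  ⟨_, ((Small.const y.a).mul (small_A₁.scaled y)).prodMk
    (small_B₁.prodMk ((small_rt₁ hκ).prodMk (small_rx₁ hκ)))⟩

theorem small_g₁ (hκ : 0 ≤ κ) : Small (y.ctx κ L N) y.g₁ y.Γ := by
  have := (small_k₁ (L := L) (N := N) hκ).comp_three y.contDiff_G₁
  rwa [y.G₁_base] at this

theorem small_g₂ (hκ : 0 ≤ κ) : Small (y.ctx κ L N) y.g₂ y.Γ := by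
  have := (small_k₂ (L := L) (N := N) hκ).comp_three y.contDiff_G₂
  rwa [y.G₂_base] at this

theorem small_g₁' (hκ : 0 ≤ κ) : ∃ r, Small (y.ctx κ L N) y.g₁' r := by
  obtain ⟨r, hr⟩ := small_k₁' (y := y) (L := L) (N := N) hκ
  exact ⟨_, ((small_k₁ hκ).fderiv y.contDiff_G₁).clm_apply hr⟩

theorem small_g₂' (hκ : 0 ≤ κ) : ∃ r, Small (y.ctx κ L N) y.g₂' r := by
  obtain ⟨r, hr⟩ := small_k₂' (y := y) (L := L) (N := N) hκ
  exact ⟨_, ((small_k₂ hκ).fderiv y.contDiff_G₂).clm_apply hr⟩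

theorem small_sq {c : Ctx State} {Q : State → ℝ → ℝ} {r : ℝ} (h : Small c Q r) :
    Small c (fun s u => Q s u ^ 2) (r ^ 2) := by
  simpa only [pow_two] using h.mul h

theorem small_γ₁ (hκ : 0 ≤ κ) : Small (y.ctx κ L N) y.γ₁ 1 := by
  have := (small_g₂ (L := L) (N := N) hκ).div (small_g₁ hκ) y.Γ_ne
  rwa [div_self y.Γ_ne] at this

theorem small_γ₂ (hκ : 0 ≤ κ) : Small (y.ctx κ L N) y.γ₂ 1 := by
  have := (small_g₂ (L := L) (N := N) hκ).div ((small_g₁ hκ).scaled y) y.Γ_ne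
  rwa [div_self y.Γ_ne] at this

theorem small_γ₁' (hκ : 0 ≤ κ) : ∃ r, Small (y.ctx κ L N) y.γ₁' r := by
  obtain ⟨r, hr⟩ := small_g₁' (y := y) (L := L) (N := N) hκ
  obtain ⟨r', hr'⟩ := small_g₂' (y := y) (L := L) (N := N) hκ
  exact ⟨_, ((hr'.mul (small_g₁ hκ)).sub ((small_g₂ hκ).mul hr)).div (small_sq (small_g₁ hκ))
    (pow_ne_zero 2 y.Γ_ne)⟩

theorem small_γ₂' (hκ : 0 ≤ κ) : ∃ r, Small (y.ctx κ L N) y.γ₂' r := by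
  obtain ⟨r, hr⟩ := small_g₁' (y := y) (L := L) (N := N) hκ
  obtain ⟨r', hr'⟩ := small_g₂' (y := y) (L := L) (N := N) hκ
  have h1 := (small_g₁ (y := y) (L := L) (N := N) hκ).scaled y
  exact ⟨_, ((hr'.mul h1).sub ((small_g₂ hκ).mul ((Small.const y.a).mul (hr.scaled y)))).div
    (small_sq h1) (pow_ne_zero 2 y.Γ_ne)⟩

theorem lead_Λ₁ (hκ : 0 ≤ κ) : Lead (y.ctx κ L N) y.Λ₁ (y.a * κ) := by
  obtain ⟨r, hr⟩ := small_γ₁' (y := y) (L := L) (N := N) hκ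
  refine (((hr.mul ((small_P hκ).right y)).lead.add (Lead.mul ((Small.const y.a).mul (small_γ₁ hκ))
    ((lead_Pu hκ).right y))).add ((small_γ₁ hκ).mul ((small_m hκ).right y)).lead).mono ?_
  simp [abs_a]

theorem lead_Λ₂ (hκ : 0 ≤ κ) : Lead (y.ctx κ L N) y.Λ₂ (y.a * κ) := by
  obtain ⟨r, hr⟩ := small_γ₂' (y := y) (L := L) (N := N) hκ
  have ha : Small (y.ctx κ L N) (fun s v => y.a * y.γ₂ s v) (y.a * 1) :=
    (Small.const y.a).mul (small_γ₂ hκ)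
  refine (((hr.mul ((small_Q hκ).rightDiag y)).lead.add (Lead.mul ha
    ((lead_Qv hκ).rightDiag y))).add (ha.mul ((small_m hκ).rightDiag y)).lead).mono ?_
  simp [abs_a]

theorem lead_Φ₁' (hκ : 0 ≤ κ) (hκ1 : κ ≤ 1) : Lead (y.ctx κ L N) y.Φ₁' (y.a * κ) := by
  obtain ⟨r, hr⟩ := small_g₁' (y := y) (L := L) (N := N) hκ
  have h2 := ((Small.neg hr).div (small_sq (small_g₁ hκ)) (pow_ne_zero 2 y.Γ_ne)).mul
    (Lead.integral_left (y := y) (small_m hκ).lead)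
  have h3 := ((Small.const (1 : ℝ)).div (small_g₁ (y := y) (L := L) (N := N) hκ) y.Γ_ne).mul
    (((small_m hκ).diag.sub ((Small.const y.a).mul ((small_m hκ).right y))).add
      (Lead.integral_left (y := y) (lead_mv hκ hκ1)))
  exact ((lead_Λ₁ hκ).add (h2.add h3).lead).mono (by simp)

theorem lead_Φ₂' (hκ : 0 ≤ κ) (hκ1 : κ ≤ 1) : Lead (y.ctx κ L N) y.Φ₂' (y.a * κ) := by
  obtain ⟨r, hr⟩ := small_g₂' (y := y) (L := L) (N := N) hκ
  have h2 := hr.mul (Lead.integral_right (y := y) (small_m hκ).lead)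
  have h3 := (small_g₂ (y := y) (L := L) (N := N) hκ).mul
    ((((small_m hκ).right y).sub ((Small.const y.a).mul ((small_m hκ).rightDiag y))).add
      ((Small.const y.a).mul (Lead.integral_right (y := y) (lead_mu hκ hκ1))))
  exact ((lead_Λ₂ hκ).add (h2.add h3).lead).mono (by simp)

theorem lead_next_W (hκ : 0 ≤ κ) : Lead (y.ctx κ L N) (fun s => (y.next s).W) 0 :=
  (small_m hκ).lead

theorem lead_next_Wu (hκ : 0 ≤ κ) (hκ1 : κ ≤ 1) :
    Lead (y.ctx κ L N) (fun s => (y.next s).Wu) y.normM :=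
  lead_mu hκ hκ1

theorem lead_next_Pu (hκ : 0 ≤ κ) (hκ1 : κ ≤ 1) :
    Lead (y.ctx κ L N) (fun s => (y.next s).Pu) (y.a * κ) := by
  have h1 := Small.neg (small_m (y := y) (L := L) (N := N) hκ).diag.fst
  have h2 : Small (y.ctx κ L N) (fun s (q : ℝ × ℝ) => ∫ t in q.1..q.2, y.mu s (q.1, t)) 0 :=
    (lead_mu hκ hκ1).integral (j := fun (q : ℝ × ℝ) t => (q.1, t)) (by fun_prop)
      (fun q _ => max_le_max (norm_fst_le q) le_rfl) continuous_fst continuous_snd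
      norm_fst_le norm_snd_le
  exact ((lead_Φ₁' hκ hκ1).fst.add (h1.add h2).lead).mono (by simp)

theorem lead_next_Qv (hκ : 0 ≤ κ) (hκ1 : κ ≤ 1) :
    Lead (y.ctx κ L N) (fun s => (y.next s).Qv) (y.a * κ) := by
  have h1 := Small.neg
    ((Small.const y.a).mul ((small_m (y := y) (L := L) (N := N) hκ).right y)).snd
  have h2 : Small (y.ctx κ L N) (fun s (q : ℝ × ℝ) => ∫ t in (y.a * q.2)..q.1, y.mv s (t, q.2)) 0 :=
    (lead_mv hκ hκ1).integral (j := fun (q : ℝ × ℝ) t => (t, q.2)) (by fun_prop)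
      (fun q t => max_le (le_max_right _ _) (le_max_of_le_left (norm_snd_le q))) (by fun_prop)
      continuous_fst (fun q => (abs_a_mul_le q.2).trans (norm_snd_le q)) norm_fst_le
  exact ((lead_Φ₂' hκ hκ1).snd.add (h1.add h2).lead).mono (by simp)

theorem small_l₁ (hκ : 0 ≤ κ) : Small (y.ctx κ L N) y.l₁ (y.β, 0, 0) :=
  small_B.prodMk ((small_lt hκ).prodMk (small_lx hκ))

theorem small_l₁' (hκ : 0 ≤ κ) : ∃ r, Small (y.ctx κ L N) y.l₁' r :=
  ⟨_, small_B₁.prodMk ((small_lt₁ hκ).prodMk (small_lx₁ hκ))⟩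

theorem small_l₂ (hκ : 0 ≤ κ) : Small (y.ctx κ L N) y.l₂ (y.β, 0, 0) :=
  (small_A.scaled y).prodMk ((small_rt hκ).prodMk (small_rx hκ))

theorem small_l₂' (hκ : 0 ≤ κ) : ∃ r, Small (y.ctx κ L N) y.l₂' r :=
  ⟨_, ((Small.const y.a).mul (small_A₁.scaled y)).prodMk ((small_rt₁ hκ).prodMk (small_rx₁ hκ))⟩

variable (y) in
/-- Contraction constant of the boundary value of `A`. -/
def rateA (κ : ℝ) : ℝ :=
  |fderiv ℝ y.h₁ (y.β, 0, 0) (1, 0, 0)| + ‖fderiv ℝ y.h₁ (y.β, 0, 0)‖ * (y.traceBound * κ)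

variable (y) in
/-- Contraction constant of the boundary value of `B`. -/
def rateB (κ : ℝ) : ℝ :=
  |fderiv ℝ y.h₂ (y.β, 0, 0) (1, 0, 0)| + ‖fderiv ℝ y.h₂ (y.β, 0, 0)‖ * (y.traceBound * κ)

theorem traceBound_nonneg : 0 ≤ y.traceBound := by
  have h1 := normF_nonneg (y := y)
  have h2 := normO_nonneg (y := y)
  unfold traceBound
  positivity

theorem lead_next_A₂ (hκ : 0 ≤ κ) :
    Lead (y.ctx κ L N) (fun s => (y.next s).A₂) (y.rateA κ) := by
  obtain ⟨r, hr⟩ := small_l₁' (y := y) (L := L) (N := N) hκ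
  have h0 := (small_l₁ (y := y) (L := L) (N := N) hκ).fderiv y.contDiff_h₁
  have h1 := ((small_l₁ (y := y) (L := L) (N := N) hκ).fderiv_fderiv y.contDiff_h₁).clm_apply hr
  have h2 := Lead.mul (h0.clm_apply (Small.const (1, 0, 0))) (lead_B₂ (y := y) (L := L) (N := N))
  have h3 := Lead.clm_apply h0 (lead_zero.prodMk ((lead_lt₂ hκ).prodMk (lead_lx₂ hκ)))
  refine ((h1.clm_apply hr).lead.add (h2.add h3)).mono (le_of_eq ?_)
  rw [max_self, max_eq_right (mul_nonneg traceBound_nonneg hκ), zero_add, mul_one, rateA]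

theorem lead_next_B₂ (hκ : 0 ≤ κ) (hL : 0 ≤ L) :
    Lead (y.ctx κ L N) (fun s => (y.next s).B₂) (y.rateB κ) := by
  obtain ⟨r, hr⟩ := small_l₂' (y := y) (L := L) (N := N) hκ
  have h0 := (small_l₂ (y := y) (L := L) (N := N) hκ).fderiv y.contDiff_h₂
  have h1 := ((small_l₂ (y := y) (L := L) (N := N) hκ).fderiv_fderiv y.contDiff_h₂).clm_apply hr
  have h2 := Lead.mul (h0.clm_apply (Small.const (1, 0, 0)))
    ((((lead_A₂ (y := y) (L := L) (N := N)).scaled y).const_mul y.a).const_mul y.a)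
  have h3 := Lead.clm_apply h0 (lead_zero.prodMk ((lead_rt₂ hκ hL).prodMk (lead_rx₂ hκ)))
  refine ((h1.clm_apply hr).lead.add (h2.add h3)).mono ?_
  rw [max_self, max_eq_right (mul_nonneg traceBound_nonneg hκ), zero_add, mul_one, rateB, abs_a]
  have h4 : y.a * y.a ≤ 1 := mul_le_one₀ y.a_lt.le y.a_pos.le y.a_lt.le
  exact add_le_add (mul_le_of_le_one_right (abs_nonneg _) h4) le_rfl

end System

section Limits

variable {S Y E : Type*} {c : Ctx S}

theorem exists_tendstoUniformlyOn_of_geometric {f : ℕ → Y → ℝ} {t : Set Y} {C k : ℝ}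
    (hk0 : 0 ≤ k) (hk : k < 1) (h : ∀ n, ∀ y ∈ t, |f (n + 1) y - f n y| ≤ C * k ^ n) :
    ∃ g, TendstoUniformlyOn f g atTop t := by
  have hd : ∀ y ∈ t, ∀ n, dist (f n y) (f (n + 1) y) ≤ C * k ^ n := fun y hy n => by
    rw [dist_comm]
    exact h n y hy
  have hg : ∀ y, ∃ g, y ∈ t → Tendsto (fun n => f n y) atTop (𝓝 g) := fun y => by
    by_cases hy : y ∈ t
    · obtain ⟨g, hg⟩ := cauchySeq_tendsto_of_complete (cauchySeq_of_le_geometric k C hk (hd y hy))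
      exact ⟨g, fun _ => hg⟩
    · exact ⟨0, fun h => absurd h hy⟩
  choose g hg using hg
  refine ⟨g, Metric.tendstoUniformlyOn_iff.2 fun ε hε => ?_⟩
  have hlim : Tendsto (fun n => C * k ^ n / (1 - k)) atTop (𝓝 0) := by
    have := ((tendsto_pow_atTop_nhds_zero_of_lt_one hk0 hk).const_mul C).div_const (1 - k)
    rwa [mul_zero, zero_div] at this
  filter_upwards [hlim.eventually_lt_const hε] with n hn y hy
  rw [dist_comm]
  exact (dist_le_of_le_geometric_of_tendsto k C hk (hd y hy) (hg y hy) n).trans_lt hn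

variable [NormedAddCommGroup Y] [NormedAddCommGroup E]

theorem Lead.eventually_le {Q : S → Y → E} {K K' : ℝ} (h : Lead c Q K) (hK : K < K') :
    ∀ᶠ δ in 𝓝[>] (0 : ℝ), ∀ s s' d, c.R δ d s s' → ∀ y ∈ ball (0 : Y) δ,
      ‖Q s y - Q s' y‖ ≤ K' * d := by
  obtain ⟨_, C, hC, h⟩ := h
  filter_upwards [h, eventually_mul_lt C (sub_pos.2 hK)] with δ h hδ s s' d hd y hy
  exact (h.2 s s' d hd y hy).trans (mul_le_mul_of_nonneg_right (by linarith) (c.nonneg hd))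

theorem Lead.continuousOn {Q : S → Y → E} {K : ℝ} (h : Lead c Q K) :
    ∀ᶠ δ in 𝓝[>] (0 : ℝ), ∀ s, c.V δ s → ContinuousOn (Q s) (ball 0 δ) := by
  obtain ⟨_, C, hC, h⟩ := h
  exact h.mono fun δ h s hs => (h.1 s hs).1

theorem Lead.exists_bound {Q : S → Y → E} {K : ℝ} (h : Lead c Q K) :
    ∃ C, 0 ≤ C ∧ ∀ᶠ δ in 𝓝[>] (0 : ℝ), ∀ s, c.V δ s → ∀ y ∈ ball (0 : Y) δ, ‖Q s y‖ ≤ C := by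
  obtain ⟨_, C, hC, h⟩ := h
  exact ⟨C, hC, h.mono fun δ h s hs => (h.1 s hs).2⟩

theorem Lead.exists_limit {Q : S → Y → ℝ} {K k : ℝ} (h : Lead c Q K) (hk0 : 0 ≤ k) (hk : k < 1)
    (D : ℝ) : ∀ᶠ δ in 𝓝[>] (0 : ℝ), ∀ f : ℕ → S, (∀ n, c.R δ (D * k ^ n) (f (n + 1)) (f n)) →
      ∃ g, TendstoUniformlyOn (fun n => Q (f n)) g atTop (ball 0 δ) := by
  filter_upwards [h.eventually_le (lt_add_one K)] with δ h f hf
  refine exists_tendstoUniformlyOn_of_geometric (C := (K + 1) * D) hk0 hk fun n y hy => ?_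
  rw [mul_assoc]
  exact h _ _ _ (hf n) y hy

end Limits

namespace State.Dif

variable {κ L δ d d' : ℝ} {s s' s'' : State}

theorem refl (κ L δ : ℝ) (s : State) : State.Dif κ L δ 0 s s := by
  simp [State.Dif]

theorem mono (hκ : 0 ≤ κ) (hL : 0 ≤ L) (h : State.Dif κ L δ d s s') (hd : d ≤ d') :
    State.Dif κ L δ d' s s' :=
  ⟨fun u hu => ⟨(h.1 u hu).1.trans hd, (h.1 u hu).2.trans hd⟩, fun q hq =>
    ⟨(h.2 q hq).1.trans (by gcongr), (h.2 q hq).2.1.trans (by gcongr),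
      (h.2 q hq).2.2.1.trans (by gcongr), (h.2 q hq).2.2.2.trans (by gcongr)⟩⟩

theorem trans (h : State.Dif κ L δ d s s') (h' : State.Dif κ L δ d' s' s'') :
    State.Dif κ L δ (d + d') s s'' := by
  refine ⟨fun u hu => ?_, fun q hq => ?_⟩
  · exact ⟨(abs_sub_le _ _ _).trans (add_le_add (h.1 u hu).1 (h'.1 u hu).1),
      (abs_sub_le _ _ _).trans (add_le_add (h.1 u hu).2 (h'.1 u hu).2)⟩
  · simp only [mul_add]
    exact ⟨(abs_sub_le _ _ _).trans (add_le_add (h.2 q hq).1 (h'.2 q hq).1),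
      (abs_sub_le _ _ _).trans (add_le_add (h.2 q hq).2.1 (h'.2 q hq).2.1),
      (abs_sub_le _ _ _).trans (add_le_add (h.2 q hq).2.2.1 (h'.2 q hq).2.2.1),
      (abs_sub_le _ _ _).trans (add_le_add (h.2 q hq).2.2.2 (h'.2 q hq).2.2.2)⟩

end State.Dif

namespace System

variable (y : System)

theorem exists_rates : ∃ k κ L : ℝ, 0 < k ∧ k < 1 ∧ 0 < κ ∧ κ ≤ 1 ∧ 0 < L ∧ y.a < k ∧
    y.rateA κ < k ∧ y.rateB κ < k ∧ y.normM < L * k := by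
  obtain ⟨k, hk, hk1⟩ := exists_between
    (max_lt (max_lt y.h₁_contr y.h₂_contr) y.a_lt)
  have hka := (le_max_right _ _).trans_lt hk
  have hkA := ((le_max_left _ _).trans (le_max_left _ _)).trans_lt hk
  have hkB := ((le_max_right _ _).trans (le_max_left _ _)).trans_lt hk
  have hk0 : 0 < k := y.a_pos.trans hka
  have hA : Tendsto y.rateA (𝓝[>] 0) (𝓝 (y.rateA 0)) :=
    (Continuous.tendsto (by unfold rateA; fun_prop) 0).mono_left nhdsWithin_le_nhds
  have hB : Tendsto y.rateB (𝓝[>] 0) (𝓝 (y.rateB 0)) :=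
    (Continuous.tendsto (by unfold rateB; fun_prop) 0).mono_left nhdsWithin_le_nhds
  simp only [rateA, rateB, mul_zero, add_zero] at hA hB
  obtain ⟨κ, ⟨hκA, hκB⟩, hκ⟩ := ((hA.eventually_lt_const hkA).and (hB.eventually_lt_const hkB)).and
    eventually_pos_le_one |>.exists
  refine ⟨k, κ, (y.normM + 1) / k, hk0, hk1, hκ.1, hκ.2, ?_, hka, hκA, hκB, ?_⟩
  · have := normM_nonneg (y := y)
    positivity
  · rw [div_mul_cancel₀ _ hk0.ne']
    exact lt_add_one _

variable {y}

theorem eventually_dif {k κ L : ℝ} (N : ℝ) (hk : 0 < k) (hκ : 0 < κ) (hκ1 : κ ≤ 1) (hL : 0 < L)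
    (ha : y.a < k) (hA : y.rateA κ < k) (hB : y.rateB κ < k) (hM : y.normM < L * k) :
    ∀ᶠ δ in 𝓝[>] (0 : ℝ), ∀ s s' d, (y.ctx κ L N).R δ d s s' →
      State.Dif κ L δ (k * d) (y.next s) (y.next s') := by
  have ha' : y.a * κ < κ * k := by rw [mul_comm]; exact mul_lt_mul_of_pos_left ha hκ
  filter_upwards [(lead_next_A₂ (y := y) (L := L) (N := N) hκ.le).eventually_le hA,
    (lead_next_B₂ (y := y) (N := N) hκ.le hL.le).eventually_le hB,
    (lead_next_Pu (y := y) (L := L) (N := N) hκ.le hκ1).eventually_le ha',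
    (lead_next_W (y := y) (L := L) (N := N) hκ.le).eventually_le (mul_pos hκ hk),
    (lead_next_Qv (y := y) (L := L) (N := N) hκ.le hκ1).eventually_le ha',
    (lead_next_Wu (y := y) (L := L) (N := N) hκ.le hκ1).eventually_le hM]
    with δ h1 h2 h3 h4 h5 h6 s s' d hd
  simp only [mul_assoc] at h3 h4 h5 h6
  exact ⟨fun u hu => ⟨h1 s s' d hd u hu, h2 s s' d hd u hu⟩, fun q hq => ⟨h3 s s' d hd q hq,
    h4 s s' d hd q hq, h5 s s' d hd q hq, h6 s s' d hd q hq⟩⟩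

theorem eventually_nice {κ L : ℝ} (N : ℝ) (hκ : 0 ≤ κ) (hκ1 : κ ≤ 1) (hL : 0 ≤ L) :
    ∀ᶠ δ in 𝓝[>] (0 : ℝ), ∀ s, (y.ctx κ L N).V δ s → y.Nice s δ := by
  have h3 : (3 : WithTop ℕ∞) ≠ ((⊤ : ℕ∞) : WithTop ℕ∞) := by decide
  obtain ⟨K, hK⟩ := lead_ψuu (y := y) (N := N) hκ hL
  filter_upwards [(small_cF (y := y) (L := L) (N := N) hκ).eventually (y.contDiff_F.eventually h3),
    (small_cO (y := y) (L := L) (N := N) hκ).eventually (y.contDiff_O.eventually h3),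
    (small_cM (y := y) (L := L) (N := N) hκ).eventually (y.contDiff_M.eventually h3),
    (small_k₁ (y := y) (L := L) (N := N) hκ).eventually (y.contDiff_G₁.eventually h3),
    (small_k₂ (y := y) (L := L) (N := N) hκ).eventually (y.contDiff_G₂.eventually h3),
    (small_l₁ (y := y) (L := L) (N := N) hκ).eventually (y.contDiff_h₁.eventually h3),
    (small_l₂ (y := y) (L := L) (N := N) hκ).eventually (y.contDiff_h₂.eventually h3),
    (small_g₁ (y := y) (L := L) (N := N) hκ).eventually (isOpen_ne.eventually_mem y.Γ_ne),
    (lead_φu (y := y) (L := L) (N := N) hκ).continuousOn,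
    (lead_φv (y := y) (L := L) (N := N) hκ).continuousOn,
    (lead_ψu (y := y) (L := L) (N := N) hκ).continuousOn,
    (lead_ψv (y := y) (L := L) (N := N) hκ).continuousOn, hK.continuousOn,
    (lead_mu (y := y) (L := L) (N := N) hκ hκ1).continuousOn,
    (lead_mv (y := y) (L := L) (N := N) hκ hκ1).continuousOn,
    (lead_Λ₁ (y := y) (L := L) (N := N) hκ).continuousOn,
    (lead_Λ₂ (y := y) (L := L) (N := N) hκ).continuousOn,
    (lead_next_A₂ (y := y) (L := L) (N := N) hκ).continuousOn,
    (lead_next_B₂ (y := y) (N := N) hκ hL).continuousOn,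
    (lead_next_Pu (y := y) (L := L) (N := N) hκ hκ1).continuousOn,
    (lead_next_Qv (y := y) (L := L) (N := N) hκ hκ1).continuousOn]
    with δ h1 h2 h3 h4 h5 h6 h7 h8 h9 h10 h11 h12 h13 h14 h15 h16 h17 h18 h19 h20 h21 s hs
  exact ⟨h1 s hs, h2 s hs, h3 s hs, h4 s hs, h5 s hs, h6 s hs, h7 s hs, h8 s hs, h9 s hs,
    h10 s hs, h11 s hs, h12 s hs, h13 s hs, h14 s hs, h15 s hs, h16 s hs, h17 s hs, h18 s hs,
    h19 s hs, h20 s hs, h21 s hs⟩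

theorem exists_first_step {κ L : ℝ} (hκ : 0 < κ) (hκ1 : κ ≤ 1) (hL : 0 < L) :
    ∃ D, 0 ≤ D ∧ ∀ᶠ δ in 𝓝[>] (0 : ℝ), State.Dif κ L δ D (y.next y.start) y.start := by
  obtain ⟨C₁, hC₁, h1⟩ := (lead_next_A₂ (y := y) (L := L) (N := 0) hκ.le).exists_bound
  obtain ⟨C₂, hC₂, h2⟩ := (lead_next_B₂ (y := y) (N := 0) hκ.le hL.le).exists_bound
  obtain ⟨C₃, hC₃, h3⟩ := (lead_next_Pu (y := y) (L := L) (N := 0) hκ.le hκ1).exists_bound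
  obtain ⟨C₄, hC₄, h4⟩ := (lead_next_W (y := y) (L := L) (N := 0) hκ.le).exists_bound
  obtain ⟨C₅, hC₅, h5⟩ := (lead_next_Qv (y := y) (L := L) (N := 0) hκ.le hκ1).exists_bound
  obtain ⟨C₆, hC₆, h6⟩ := (lead_next_Wu (y := y) (L := L) (N := 0) hκ.le hκ1).exists_bound
  set C := C₁ + C₂ + C₃ + C₄ + C₅ + C₆ with hC
  have hC0 : 0 ≤ C := by positivity
  refine ⟨C + C / κ + C / L, by positivity, ?_⟩
  have e1 : C ≤ C + C / κ + C / L := by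
    have : 0 ≤ C / κ + C / L := by positivity
    linarith
  have e2 : C ≤ κ * (C + C / κ + C / L) := by
    have : 0 ≤ κ * (C + C / L) := by positivity
    have h : κ * (C / κ) = C := mul_div_cancel₀ _ hκ.ne'
    linarith
  have e3 : C ≤ L * (C + C / κ + C / L) := by
    have : 0 ≤ L * (C + C / κ) := by positivity
    have h : L * (C / L) = C := mul_div_cancel₀ _ hL.ne'
    linarith
  filter_upwards [h1, h2, h3, h4, h5, h6] with δ h1 h2 h3 h4 h5 h6
  have hV : (y.ctx κ L 0).V δ y.start := ⟨y.reg_start δ, State.Dif.refl κ L δ _⟩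
  have red : ∀ {x r : ℝ}, ‖x‖ ≤ r → |x - 0| ≤ r := fun h => by rwa [sub_zero]
  exact ⟨fun u hu => ⟨red ((h1 _ hV u hu).trans (by linarith)),
    red ((h2 _ hV u hu).trans (by linarith))⟩, fun q hq => ⟨red ((h3 _ hV q hq).trans (by linarith)),
    red ((h4 _ hV q hq).trans (by linarith)), red ((h5 _ hV q hq).trans (by linarith)),
    red ((h6 _ hV q hq).trans (by linarith))⟩⟩

variable (y) in
/-- The iterates. -/
def iter (n : ℕ) : State := y.next^[n] y.start

theorem iter_succ (n : ℕ) : y.iter (n + 1) = y.next (y.iter n) :=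
  Function.iterate_succ_apply' _ _ _

variable (y) in
/-- Existence of a box on which all iterates are controlled. -/
theorem exists_control : ∃ k κ L N D : ℝ, 0 ≤ k ∧ k < 1 ∧ 0 ≤ κ ∧ κ ≤ 1 ∧ 0 ≤ L ∧ 0 ≤ N ∧
    ∀ᶠ δ in 𝓝[>] (0 : ℝ), (∀ n, (y.ctx κ L N).R δ (D * k ^ n) (y.iter (n + 1)) (y.iter n)) ∧
      ∀ n, y.Nice (y.iter n) δ := by
  obtain ⟨k, κ, L, hk, hk1, hκ, hκ1, hL, ha, hA, hB, hM⟩ := y.exists_rates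
  obtain ⟨D, hD, hfirst⟩ := exists_first_step (y := y) hκ hκ1 hL
  have h1k : 0 < 1 - k := by linarith
  refine ⟨k, κ, L, D / (1 - k), D, hk.le, hk1, hκ.le, hκ1, hL.le, by positivity, ?_⟩
  filter_upwards [hfirst, eventually_dif (D / (1 - k)) hk hκ hκ1 hL ha hA hB hM,
    eventually_nice (y := y) (D / (1 - k)) hκ.le hκ1 hL.le] with δ h0 h1 h2
  have hgeom : ∀ n, D * ((1 - k ^ n) / (1 - k)) ≤ D / (1 - k) := fun n => by
    rw [mul_div_assoc', div_le_div_iff_of_pos_right h1k]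
    have := mul_nonneg hD (pow_nonneg hk.le n)
    linarith
  have hV : ∀ n, (y.iter n).Reg y δ → State.Dif κ L δ (D * ((1 - k ^ n) / (1 - k))) (y.iter n) y.start
      → (y.ctx κ L (D / (1 - k))).V δ (y.iter n) :=
    fun n hr hd => ⟨hr, hd.mono hκ.le hL.le (hgeom n)⟩
  have key : ∀ n, (y.iter n).Reg y δ ∧ State.Dif κ L δ (D * k ^ n) (y.iter (n + 1)) (y.iter n) ∧
      State.Dif κ L δ (D * ((1 - k ^ n) / (1 - k))) (y.iter n) y.start := by
    intro n
    induction n with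
    | zero =>
      refine ⟨y.reg_start δ, ?_, ?_⟩
      · simp only [pow_zero, mul_one]
        exact h0
      · simp only [pow_zero, sub_self, zero_div, mul_zero]
        exact State.Dif.refl κ L δ _
    | succ n ih =>
      have hn := hV n ih.1 ih.2.2
      have hreg : (y.iter (n + 1)).Reg y δ := by
        rw [iter_succ]
        exact reg_next ih.1 (h2 _ hn)
      have hsum : State.Dif κ L δ (D * ((1 - k ^ (n + 1)) / (1 - k))) (y.iter (n + 1)) y.start := by
        convert ih.2.1.trans ih.2.2 using 1
        field_simp
        ring
      refine ⟨hreg, ?_, hsum⟩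
      have := h1 _ _ _ ⟨⟨hV (n + 1) hreg hsum, hn⟩, by positivity, ih.2.1⟩
      rw [← iter_succ, ← iter_succ] at this
      convert this using 1
      ring
  refine ⟨fun n => ⟨⟨hV _ (key (n + 1)).1 (key (n + 1)).2.2, hV _ (key n).1 (key n).2.2⟩,
    by positivity, (key n).2.1⟩, fun n => h2 _ (hV n (key n).1 (key n).2.2)⟩

end System

section UniformLimits

variable {δ : ℝ}

theorem hasDerivAt_of_tendstoUniformlyOn_ball {f f' : ℕ → ℝ → ℝ} {g g' : ℝ → ℝ}
    (hf : TendstoUniformlyOn f g atTop (ball 0 δ))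
    (hf' : TendstoUniformlyOn f' g' atTop (ball 0 δ))
    (h : ∀ n, ∀ u ∈ ball (0 : ℝ) δ, HasDerivAt (f n) (f' n u) u) :
    ∀ u ∈ ball (0 : ℝ) δ, HasDerivAt g (g' u) u := fun _ hu =>
  hasDerivAt_of_tendstoUniformlyOn isOpen_ball hf' (Eventually.of_forall h)
    (fun _ hx => hf.tendsto_at hx) hu

theorem hasDerivAt_fst_of_tendstoUniformlyOn {f f' : ℕ → ℝ × ℝ → ℝ} {g g' : ℝ × ℝ → ℝ}
    (hf : TendstoUniformlyOn f g atTop (ball 0 δ))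
    (hf' : TendstoUniformlyOn f' g' atTop (ball 0 δ))
    (h : ∀ n, ∀ q ∈ ball (0 : ℝ × ℝ) δ, HasDerivAt (fun u => f n (u, q.2)) (f' n q) q.1) :
    ∀ q ∈ ball (0 : ℝ × ℝ) δ, HasDerivAt (fun u => g (u, q.2)) (g' q) q.1 := by
  intro q hq
  have hm : ball (0 : ℝ) δ ⊆ (fun u => (u, q.2)) ⁻¹' ball (0 : ℝ × ℝ) δ := fun u hu =>
    mem_ball_prod.2 ⟨mem_ball_real.1 hu, (mem_ball_prod.1 hq).2⟩
  exact hasDerivAt_of_tendstoUniformlyOn_ball ((hf.comp fun u => (u, q.2)).mono hm)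
    ((hf'.comp fun u => (u, q.2)).mono hm) (fun n u hu => h n _ (hm hu)) q.1
    (mem_ball_real.2 (mem_ball_prod.1 hq).1)

theorem hasDerivAt_snd_of_tendstoUniformlyOn {f f' : ℕ → ℝ × ℝ → ℝ} {g g' : ℝ × ℝ → ℝ}
    (hf : TendstoUniformlyOn f g atTop (ball 0 δ))
    (hf' : TendstoUniformlyOn f' g' atTop (ball 0 δ))
    (h : ∀ n, ∀ q ∈ ball (0 : ℝ × ℝ) δ, HasDerivAt (fun v => f n (q.1, v)) (f' n q) q.2) :
    ∀ q ∈ ball (0 : ℝ × ℝ) δ, HasDerivAt (fun v => g (q.1, v)) (g' q) q.2 := by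
  intro q hq
  have hm : ball (0 : ℝ) δ ⊆ (fun v => (q.1, v)) ⁻¹' ball (0 : ℝ × ℝ) δ := fun v hv =>
    mem_ball_prod.2 ⟨(mem_ball_prod.1 hq).1, mem_ball_real.1 hv⟩
  exact hasDerivAt_of_tendstoUniformlyOn_ball ((hf.comp fun v => (q.1, v)).mono hm)
    ((hf'.comp fun v => (q.1, v)).mono hm) (fun n v hv => h n _ (hm hv)) q.2
    (mem_ball_real.2 (mem_ball_prod.1 hq).2)

theorem Partials.of_tendstoUniformlyOn {f fu fv : ℕ → ℝ × ℝ → ℝ} {g gu gv : ℝ × ℝ → ℝ}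
    (hf : TendstoUniformlyOn f g atTop (ball 0 δ))
    (hfu : TendstoUniformlyOn fu gu atTop (ball 0 δ))
    (hfv : TendstoUniformlyOn fv gv atTop (ball 0 δ)) (h : ∀ n, Partials δ (f n) (fu n) (fv n)) :
    Partials δ g gu gv where
  cu := hfu.continuousOn (Frequently.of_forall fun n => (h n).cu)
  cv := hfv.continuousOn (Frequently.of_forall fun n => (h n).cv)
  du := hasDerivAt_fst_of_tendstoUniformlyOn hf hfu fun n => (h n).du
  dv := hasDerivAt_snd_of_tendstoUniformlyOn hf hfv fun n => (h n).dv

theorem eq_of_tendstoUniformlyOn {Y : Type*} {f : ℕ → Y → ℝ} {g : Y → ℝ} {t : Set Y} {y : Y}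
    {c : ℝ} (hf : TendstoUniformlyOn f g atTop t) (hy : y ∈ t) (h : ∀ n, f n y = c) : g y = c := by
  have := hf.tendsto_at hy
  simp only [h] at this
  exact tendsto_nhds_unique this tendsto_const_nhds

theorem abs_le_of_tendstoUniformlyOn {Y : Type*} {f : ℕ → Y → ℝ} {g : Y → ℝ} {t : Set Y} {y : Y}
    {c : ℝ} (hf : TendstoUniformlyOn f g atTop t) (hy : y ∈ t) (h : ∀ n, |f n y| ≤ c) :
    |g y| ≤ c :=
  le_of_tendsto (hf.tendsto_at hy).abs (Eventually.of_forall h)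

end UniformLimits

/-- Uniform convergence of all components of a sequence of states. -/
structure State.Lim (δ : ℝ) (f : ℕ → State) (s : State) : Prop where
  A : TendstoUniformlyOn (fun n => (f n).A) s.A atTop (ball 0 δ)
  A₁ : TendstoUniformlyOn (fun n => (f n).A₁) s.A₁ atTop (ball 0 δ)
  A₂ : TendstoUniformlyOn (fun n => (f n).A₂) s.A₂ atTop (ball 0 δ)
  B : TendstoUniformlyOn (fun n => (f n).B) s.B atTop (ball 0 δ)
  B₁ : TendstoUniformlyOn (fun n => (f n).B₁) s.B₁ atTop (ball 0 δ)
  B₂ : TendstoUniformlyOn (fun n => (f n).B₂) s.B₂ atTop (ball 0 δ)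
  X : TendstoUniformlyOn (fun n => (f n).X) s.X atTop (ball 0 δ)
  P : TendstoUniformlyOn (fun n => (f n).P) s.P atTop (ball 0 δ)
  Q : TendstoUniformlyOn (fun n => (f n).Q) s.Q atTop (ball 0 δ)
  Pu : TendstoUniformlyOn (fun n => (f n).Pu) s.Pu atTop (ball 0 δ)
  W : TendstoUniformlyOn (fun n => (f n).W) s.W atTop (ball 0 δ)
  Qv : TendstoUniformlyOn (fun n => (f n).Qv) s.Qv atTop (ball 0 δ)
  Wu : TendstoUniformlyOn (fun n => (f n).Wu) s.Wu atTop (ball 0 δ)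

theorem State.Lim.reg {y : System} {δ : ℝ} {f : ℕ → State} {s : State} (h : State.Lim δ f s)
    (hδ : 0 < δ) (hf : ∀ n, (f n).Reg y δ) : s.Reg y δ where
  dA := hasDerivAt_of_tendstoUniformlyOn_ball h.A h.A₁ fun n => (hf n).dA
  dA₁ := hasDerivAt_of_tendstoUniformlyOn_ball h.A₁ h.A₂ fun n => (hf n).dA₁
  cA₂ := h.A₂.continuousOn (Frequently.of_forall fun n => (hf n).cA₂)
  dB := hasDerivAt_of_tendstoUniformlyOn_ball h.B h.B₁ fun n => (hf n).dB
  dB₁ := hasDerivAt_of_tendstoUniformlyOn_ball h.B₁ h.B₂ fun n => (hf n).dB₁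
  cB₂ := h.B₂.continuousOn (Frequently.of_forall fun n => (hf n).cB₂)
  dX := Partials.of_tendstoUniformlyOn h.X h.P h.Q fun n => (hf n).dX
  dP := Partials.of_tendstoUniformlyOn h.P h.Pu h.W fun n => (hf n).dP
  dQ := Partials.of_tendstoUniformlyOn h.Q h.W h.Qv fun n => (hf n).dQ
  dW := hasDerivAt_fst_of_tendstoUniformlyOn h.W h.Wu fun n => (hf n).dW
  cWu := h.Wu.continuousOn (Frequently.of_forall fun n => (hf n).cWu)
  A_zero := eq_of_tendstoUniformlyOn h.A (mem_ball_self hδ) fun n => (hf n).A_zero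
  A₁_zero := eq_of_tendstoUniformlyOn h.A₁ (mem_ball_self hδ) fun n => (hf n).A₁_zero
  B_zero := eq_of_tendstoUniformlyOn h.B (mem_ball_self hδ) fun n => (hf n).B_zero
  B₁_zero := eq_of_tendstoUniformlyOn h.B₁ (mem_ball_self hδ) fun n => (hf n).B₁_zero
  X_zero := eq_of_tendstoUniformlyOn h.X (mem_ball_self hδ) fun n => (hf n).X_zero
  P_zero := eq_of_tendstoUniformlyOn h.P (mem_ball_self hδ) fun n => (hf n).P_zero
  Q_zero := eq_of_tendstoUniformlyOn h.Q (mem_ball_self hδ) fun n => (hf n).Q_zero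

/-- The second derivatives of a state are bounded by `N`. -/
structure State.Bdd (N δ : ℝ) (s : State) : Prop where
  A₂ : ∀ u ∈ ball (0 : ℝ) δ, |s.A₂ u| ≤ N
  B₂ : ∀ u ∈ ball (0 : ℝ) δ, |s.B₂ u| ≤ N
  Pu : ∀ q ∈ ball (0 : ℝ × ℝ) δ, |s.Pu q| ≤ N
  W : ∀ q ∈ ball (0 : ℝ × ℝ) δ, |s.W q| ≤ N
  Qv : ∀ q ∈ ball (0 : ℝ × ℝ) δ, |s.Qv q| ≤ N

theorem State.Lim.bdd {N δ : ℝ} {f : ℕ → State} {s : State} (h : State.Lim δ f s)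
    (hf : ∀ n, (f n).Bdd N δ) : s.Bdd N δ where
  A₂ _ hu := abs_le_of_tendstoUniformlyOn h.A₂ hu fun n => (hf n).A₂ _ hu
  B₂ _ hu := abs_le_of_tendstoUniformlyOn h.B₂ hu fun n => (hf n).B₂ _ hu
  Pu _ hq := abs_le_of_tendstoUniformlyOn h.Pu hq fun n => (hf n).Pu _ hq
  W _ hq := abs_le_of_tendstoUniformlyOn h.W hq fun n => (hf n).W _ hq
  Qv _ hq := abs_le_of_tendstoUniformlyOn h.Qv hq fun n => (hf n).Qv _ hq

namespace System

variable (y : System)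

/-- The iterates converge, together with their derivatives up to second order, on some box. -/
theorem exists_limit : ∃ N δ : ℝ, 0 ≤ N ∧ 0 < δ ∧ (∀ n, (y.iter n).Reg y δ) ∧
    (∀ n, y.Nice (y.iter n) δ) ∧ ∃ s : State, s.Reg y δ ∧ s.Bdd N δ ∧ State.Lim δ y.iter s := by
  obtain ⟨k, κ, L, N, D, hk0, hk, hκ, hκ1, hL, hN, h⟩ := y.exists_control
  obtain ⟨δ, ⟨⟨⟨⟨⟨⟨⟨⟨⟨⟨⟨⟨⟨⟨h, h1⟩, h2⟩, h3⟩, h4⟩, h5⟩, h6⟩, h7⟩, h8⟩, h9⟩, h10⟩, h11⟩, h12⟩, h13⟩,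
    hδ⟩⟩ := (h.and ((small_A (y := y) (κ := κ) (L := L) (N := N)).lead.exists_limit hk0 hk D) |>.and
    ((small_A₁ (y := y) (κ := κ) (L := L) (N := N)).lead.exists_limit hk0 hk D) |>.and
    ((lead_A₂ (y := y) (κ := κ) (L := L) (N := N)).exists_limit hk0 hk D) |>.and
    ((small_B (y := y) (κ := κ) (L := L) (N := N)).lead.exists_limit hk0 hk D) |>.and
    ((small_B₁ (y := y) (κ := κ) (L := L) (N := N)).lead.exists_limit hk0 hk D) |>.and
    ((lead_B₂ (y := y) (κ := κ) (L := L) (N := N)).exists_limit hk0 hk D) |>.and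
    ((small_X (y := y) (L := L) (N := N) hκ).lead.exists_limit hk0 hk D) |>.and
    ((small_P (y := y) (L := L) (N := N) hκ).lead.exists_limit hk0 hk D) |>.and
    ((small_Q (y := y) (L := L) (N := N) hκ).lead.exists_limit hk0 hk D) |>.and
    ((lead_Pu (y := y) (L := L) (N := N) hκ).exists_limit hk0 hk D) |>.and
    ((lead_W (y := y) (L := L) (N := N) hκ).exists_limit hk0 hk D) |>.and
    ((lead_Qv (y := y) (L := L) (N := N) hκ).exists_limit hk0 hk D) |>.and
    ((lead_Wu (y := y) (κ := κ) (N := N) hL).exists_limit hk0 hk D) |>.and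
    eventually_pos_le_one).exists
  obtain ⟨A, hA⟩ := h1 _ h.1
  obtain ⟨A₁, hA₁⟩ := h2 _ h.1
  obtain ⟨A₂, hA₂⟩ := h3 _ h.1
  obtain ⟨B, hB⟩ := h4 _ h.1
  obtain ⟨B₁, hB₁⟩ := h5 _ h.1
  obtain ⟨B₂, hB₂⟩ := h6 _ h.1
  obtain ⟨X, hX⟩ := h7 _ h.1
  obtain ⟨P, hP⟩ := h8 _ h.1
  obtain ⟨Q, hQ⟩ := h9 _ h.1
  obtain ⟨Pu, hPu⟩ := h10 _ h.1
  obtain ⟨W, hW⟩ := h11 _ h.1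
  obtain ⟨Qv, hQv⟩ := h12 _ h.1
  obtain ⟨Wu, hWu⟩ := h13 _ h.1
  have hreg : ∀ n, (y.iter n).Reg y δ := fun n => (h.1 n).1.2.1
  have hlim : State.Lim δ y.iter ⟨A, A₁, A₂, B, B₁, B₂, X, P, Q, Pu, W, Qv, Wu⟩ :=
    ⟨hA, hA₁, hA₂, hB, hB₁, hB₂, hX, hP, hQ, hPu, hW, hQv, hWu⟩
  have hbdd : ∀ n, (y.iter n).Bdd N δ := fun n => by
    have hd := (h.1 n).1.2.2
    have hκN : κ * N ≤ N := mul_le_of_le_one_left hN hκ1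
    have red : ∀ {x r : ℝ}, |x - 0| ≤ r → |x| ≤ r := fun h => by rwa [sub_zero] at h
    exact ⟨fun u hu => red (hd.1 u hu).1, fun u hu => red (hd.1 u hu).2,
      fun q hq => (red (hd.2 q hq).1).trans hκN, fun q hq => (red (hd.2 q hq).2.1).trans hκN,
      fun q hq => (red (hd.2 q hq).2.2.1).trans hκN⟩
  exact ⟨N, δ, hN, hδ.1, hreg, h.2, _, hlim.reg hδ.1 hreg, hlim.bdd hbdd, hlim⟩

end System

section ContDiff

variable {y : System} {s : State} {δ : ℝ}

theorem contDiffOn_two_of_hasDerivAt {f f₁ f₂ : ℝ → ℝ}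
    (h : ∀ u ∈ ball (0 : ℝ) δ, HasDerivAt f (f₁ u) u)
    (h₁ : ∀ u ∈ ball (0 : ℝ) δ, HasDerivAt f₁ (f₂ u) u) (h₂ : ContinuousOn f₂ (ball 0 δ)) :
    ContDiffOn ℝ 2 f (ball 0 δ) := by
  have c1 : ContDiffOn ℝ 1 f₁ (ball 0 δ) := by
    rw [show (1 : WithTop ℕ∞) = 0 + 1 from rfl, contDiffOn_succ_iff_deriv_of_isOpen isOpen_ball]
    exact ⟨fun u hu => (h₁ u hu).differentiableAt.differentiableWithinAt, by simp,
      contDiffOn_zero.2 (h₂.congr fun u hu => (h₁ u hu).deriv)⟩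
  rw [show (2 : WithTop ℕ∞) = 1 + 1 from rfl, contDiffOn_succ_iff_deriv_of_isOpen isOpen_ball]
  exact ⟨fun u hu => (h u hu).differentiableAt.differentiableWithinAt, by simp,
    c1.congr fun u hu => (h u hu).deriv⟩

theorem Partials.contDiffOn_succ {f fu fv : ℝ × ℝ → ℝ} {n : ℕ} (h : Partials δ f fu fv)
    (hu : ContDiffOn ℝ n fu (ball 0 δ)) (hv : ContDiffOn ℝ n fv (ball 0 δ)) :
    ContDiffOn ℝ (n + 1) f (ball 0 δ) := by
  rw [contDiffOn_succ_iff_fderiv_of_isOpen isOpen_ball]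
  refine ⟨fun q hq => (h.hasFDerivAt hq).differentiableAt.differentiableWithinAt, by simp, ?_⟩
  exact ((hu.smul contDiffOn_const).add (hv.smul contDiffOn_const)).congr
    fun q hq => (h.hasFDerivAt hq).fderiv

theorem Partials.contDiffOn_one {f fu fv : ℝ × ℝ → ℝ} (h : Partials δ f fu fv) :
    ContDiffOn ℝ 1 f (ball 0 δ) := by
  simpa using h.contDiffOn_succ (n := 0) (by simpa using h.cu) (by simpa using h.cv)

theorem State.Reg.contDiffOn_X (hs : s.Reg y δ) : ContDiffOn ℝ 2 s.X (ball 0 δ) := by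
  have := hs.dX.contDiffOn_succ (n := 1) (by simpa using hs.dP.contDiffOn_one)
    (by simpa using hs.dQ.contDiffOn_one)
  convert this using 1
  norm_num

end ContDiff

section Physics

namespace Setup

variable (S : Setup)

theorem contDiffAt_p {r : ℝ} (hr : 0 < r) : ContDiffAt ℝ (⊤ : ℕ∞) S.p r :=
  S.hp.contDiffAt (Ioi_mem_nhds hr)

theorem contDiffAt_η {r : ℝ} (hr : 0 < r) : ContDiffAt ℝ (⊤ : ℕ∞) S.η r := by
  have h1 : ContDiffOn ℝ (⊤ : ℕ∞) (deriv S.p) (Ioi 0) :=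
    ((contDiffOn_infty_iff_deriv_of_isOpen isOpen_Ioi).1 S.hp).2
  refine ((h1.contDiffAt (Ioi_mem_nhds hr)).sqrt (S.hp' r hr).ne').congr_of_eventuallyEq ?_
  filter_upwards [Ioi_mem_nhds hr] with x hx using S.hη x hx

theorem η_pos {r : ℝ} (hr : 0 < r) : 0 < S.η r := by
  rw [S.hη r hr]
  exact Real.sqrt_pos.2 (S.hp' r hr)

theorem sq_η {r : ℝ} (hr : 0 < r) : S.η r ^ 2 = deriv S.p r := by
  rw [S.hη r hr, Real.sq_sqrt (S.hp' r hr).le]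

theorem contDiffAt_σ {r : ℝ} (hr : 0 < r) : ContDiffAt ℝ (⊤ : ℕ∞) S.σ r := by
  refine ContDiffOn.contDiffAt ?_ (Ioi_mem_nhds hr)
  refine (contDiffOn_infty_iff_deriv_of_isOpen isOpen_Ioi).2
    ⟨fun x hx => (S.hσ x hx).differentiableAt.differentiableWithinAt, fun x hx => ?_⟩
  refine (((S.contDiffAt_η hx).div contDiffAt_id (ne_of_gt hx)).contDiffWithinAt).congr
    (fun z hz => (S.hσ z hz).deriv) (S.hσ x hx).deriv

theorem injOn_σ : InjOn S.σ (Ioi 0) := by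
  refine (strictMonoOn_of_deriv_pos (convex_Ioi 0)
    (fun x hx => (S.hσ x hx).continuousAt.continuousWithinAt) fun x hx => ?_).injOn
  rw [interior_Ioi] at hx
  rw [(S.hσ x hx).deriv]
  exact div_pos (S.η_pos hx) hx

theorem R_σ {r : ℝ} (hr : 0 < r) : S.R (S.σ r) = r :=
  S.injOn_σ (S.hRpos _) hr (S.hRσ _)

theorem hasDerivAt_R (s : ℝ) : HasDerivAt S.R (S.R s / S.η (S.R s)) s := by
  have h1 : DifferentiableAt ℝ S.R s := S.hR.differentiable (by simp) s
  have h2 := (S.hσ _ (S.hRpos s)).comp s h1.hasDerivAt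
  have h3 : HasDerivAt (S.σ ∘ S.R) 1 s := (hasDerivAt_id s).congr_of_eventuallyEq
    (Eventually.of_forall S.hRσ)
  have h4 := h2.unique h3
  refine h1.hasDerivAt.congr_deriv ?_
  have := S.hRpos s
  have := S.η_pos (S.hRpos s)
  field_simp at h4 ⊢
  linarith

theorem η₀_pos : 0 < η₀ S := S.η_pos S.hρ₀

theorem ρf_pos (α β : ℝ) : 0 < ρf S α β := S.hRpos _

theorem ρf_base : ρf S (β₀ S) (β₀ S) = S.ρ₀ := by
  rw [ρf, add_self_div_two]
  exact S.R_σ S.hρ₀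

theorem wf_base : wf (β₀ S) (β₀ S) = 0 := by simp [wf]

theorem cin_base : cin S (β₀ S) (β₀ S) = -η₀ S := by
  rw [cin, ρf_base, wf_base, zero_sub, η₀]

theorem cout_base : cout S (β₀ S) (β₀ S) = η₀ S := by
  rw [cout, ρf_base, wf_base, zero_add, η₀]

theorem contDiff_ρf : ContDiff ℝ (⊤ : ℕ∞) fun z : ℝ × ℝ => ρf S z.1 z.2 :=
  S.hR.comp ((contDiff_fst.add contDiff_snd).div_const 2)

theorem contDiff_wf : ContDiff ℝ (⊤ : ℕ∞) fun z : ℝ × ℝ => wf z.1 z.2 :=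
  (contDiff_fst.sub contDiff_snd).div_const 2

theorem contDiff_η_ρf : ContDiff ℝ (⊤ : ℕ∞) fun z : ℝ × ℝ => S.η (ρf S z.1 z.2) :=
  contDiff_iff_contDiffAt.2 fun z =>
    (S.contDiffAt_η (S.ρf_pos z.1 z.2)).comp z S.contDiff_ρf.contDiffAt

theorem contDiff_p_ρf : ContDiff ℝ (⊤ : ℕ∞) fun z : ℝ × ℝ => S.p (ρf S z.1 z.2) :=
  contDiff_iff_contDiffAt.2 fun z =>
    (S.contDiffAt_p (S.ρf_pos z.1 z.2)).comp z S.contDiff_ρf.contDiffAt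

theorem contDiff_cin : ContDiff ℝ (⊤ : ℕ∞) fun z : ℝ × ℝ => cin S z.1 z.2 :=
  contDiff_wf.sub S.contDiff_η_ρf

theorem contDiff_cout : ContDiff ℝ (⊤ : ℕ∞) fun z : ℝ × ℝ => cout S z.1 z.2 :=
  contDiff_wf.add S.contDiff_η_ρf

theorem contDiff_Jf :
    ContDiff ℝ (⊤ : ℕ∞) fun z : ℝ × ℝ × ℝ × ℝ => Jf S z.1 z.2.1 z.2.2.1 z.2.2.2 := by
  have hp : ContDiff ℝ (⊤ : ℕ∞) fun z : ℝ × ℝ × ℝ × ℝ => (z.1, z.2.1) := by fun_prop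
  have hm : ContDiff ℝ (⊤ : ℕ∞) fun z : ℝ × ℝ × ℝ × ℝ => (z.2.2.1, z.2.2.2) := by fun_prop
  have h1 := S.contDiff_ρf.comp hp
  have h2 := contDiff_wf.comp hp
  have h3 := S.contDiff_p_ρf.comp hp
  have h4 := S.contDiff_ρf.comp hm
  have h5 := contDiff_wf.comp hm
  have h6 := S.contDiff_p_ρf.comp hm
  exact (((h1.mul h2).sub (h4.mul h5)).pow 2).sub
    (((((h1.mul (h2.pow 2)).add h3).sub (h4.mul (h5.pow 2))).sub h6).mul (h1.sub h4))

/-- The derivative of the jump function in terms of its partial derivatives. -/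
theorem fderiv_Jf (z d : ℝ × ℝ × ℝ × ℝ) :
    fderiv ℝ (fun z : ℝ × ℝ × ℝ × ℝ => Jf S z.1 z.2.1 z.2.2.1 z.2.2.2) z d =
      Jαp S z.1 z.2.1 z.2.2.1 z.2.2.2 * d.1 + Jβp S z.1 z.2.1 z.2.2.1 z.2.2.2 * d.2.1
      + Jαm S z.1 z.2.1 z.2.2.1 z.2.2.2 * d.2.2.1 + Jβm S z.1 z.2.1 z.2.2.1 z.2.2.2 * d.2.2.2 := by
  have hf := (S.contDiff_Jf.differentiable (by simp) z).hasFDerivAt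
  set f' := fderiv ℝ (fun z : ℝ × ℝ × ℝ × ℝ => Jf S z.1 z.2.1 z.2.2.1 z.2.2.2) z
  obtain ⟨z1, z2, z3, z4⟩ := z
  obtain ⟨d1, d2, d3, d4⟩ := d
  have c1 : HasDerivAt (fun s : ℝ => (s, z2, z3, z4)) (1, 0, 0, 0) z1 :=
    (hasDerivAt_id z1).prodMk (hasDerivAt_const z1 (z2, z3, z4))
  have c2 : HasDerivAt (fun s : ℝ => (z1, s, z3, z4)) (0, 1, 0, 0) z2 :=
    (hasDerivAt_const z2 z1).prodMk ((hasDerivAt_id z2).prodMk (hasDerivAt_const z2 (z3, z4)))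
  have c3 : HasDerivAt (fun s : ℝ => (z1, z2, s, z4)) (0, 0, 1, 0) z3 :=
    (hasDerivAt_const z3 z1).prodMk ((hasDerivAt_const z3 z2).prodMk
      ((hasDerivAt_id z3).prodMk (hasDerivAt_const z3 z4)))
  have c4 : HasDerivAt (fun s : ℝ => (z1, z2, z3, s)) (0, 0, 0, 1) z4 :=
    (hasDerivAt_const z4 z1).prodMk ((hasDerivAt_const z4 z2).prodMk
      ((hasDerivAt_const z4 z3).prodMk (hasDerivAt_id z4)))
  have e1 : Jαp S z1 z2 z3 z4 = f' (1, 0, 0, 0) :=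
    (HasFDerivAt.comp_hasDerivAt_of_eq z1 hf c1 rfl).deriv
  have e2 : Jβp S z1 z2 z3 z4 = f' (0, 1, 0, 0) :=
    (HasFDerivAt.comp_hasDerivAt_of_eq z2 hf c2 rfl).deriv
  have e3 : Jαm S z1 z2 z3 z4 = f' (0, 0, 1, 0) :=
    (HasFDerivAt.comp_hasDerivAt_of_eq z3 hf c3 rfl).deriv
  have e4 : Jβm S z1 z2 z3 z4 = f' (0, 0, 0, 1) :=
    (HasFDerivAt.comp_hasDerivAt_of_eq z4 hf c4 rfl).deriv
  have hd : ((d1, d2, d3, d4) : ℝ × ℝ × ℝ × ℝ) = d1 • (1, 0, 0, 0) + d2 • (0, 1, 0, 0)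
      + d3 • (0, 0, 1, 0) + d4 • (0, 0, 0, 1) := by simp
  simp only [e1, e2, e3, e4]
  rw [hd]
  simp only [map_add, map_smul, smul_eq_mul]
  ring

/-- Derivative of the density along a curve in the space of Riemann invariants. -/
theorem hasDerivAt_ρf {a b : ℝ → ℝ} {a' b' s : ℝ} (ha : HasDerivAt a a' s)
    (hb : HasDerivAt b b' s) : HasDerivAt (fun s => ρf S (a s) (b s))
      (ρf S (a s) (b s) / S.η (ρf S (a s) (b s)) * ((a' + b') / 2)) s :=
  (S.hasDerivAt_R _).comp s ((ha.add hb).div_const 2)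

theorem hasDerivAt_wf {a b : ℝ → ℝ} {a' b' s : ℝ} (ha : HasDerivAt a a' s)
    (hb : HasDerivAt b b' s) : HasDerivAt (fun s => wf (a s) (b s)) ((a' - b') / 2) s :=
  (ha.sub hb).div_const 2

/-- Derivative of the jump function with respect to the state behind, at a state behind at rest
satisfying the jump conditions with shock speed `V`. -/
theorem hasDerivAt_Jf {a b : ℝ → ℝ} {a' b' am bm s V : ℝ} (ha : HasDerivAt a a' s)
    (hb : HasDerivAt b b' s) (has : a s = β₀ S) (hbs : b s = β₀ S)
    (hV : (S.ρ₀ - ρf S am bm) * V = -(ρf S am bm * wf am bm))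
    (hM : -(ρf S am bm * wf am bm) * V =
      S.p S.ρ₀ - (ρf S am bm * wf am bm ^ 2 + S.p (ρf S am bm))) :
    HasDerivAt (fun s => Jf S (a s) (b s) am bm)
      (-((S.ρ₀ - ρf S am bm) * (S.ρ₀ / (2 * η₀ S))
        * ((η₀ S - V) ^ 2 * a' + (η₀ S + V) ^ 2 * b'))) s := by
  have h1 := S.hasDerivAt_ρf ha hb
  have h2 := hasDerivAt_wf ha hb
  have h3 : HasDerivAt (fun s => S.p (ρf S (a s) (b s))) _ s :=
    ((S.contDiffAt_p (S.ρf_pos (a s) (b s))).differentiableAt (by simp)).hasDerivAt.comp s h1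
  have := (((h1.mul h2).sub_const (ρf S am bm * wf am bm)).pow 2).sub
    (((((h1.mul (h2.pow 2)).add h3).sub_const (ρf S am bm * wf am bm ^ 2)).sub_const
      (S.p (ρf S am bm))).mul (h1.sub_const (ρf S am bm)))
  refine HasDerivAt.congr_deriv this ?_
  have hη := S.η₀_pos
  simp only [has, hbs, S.ρf_base, S.wf_base, Pi.mul_apply, Pi.pow_apply, Pi.add_apply,
    ← S.sq_η S.hρ₀, show S.η S.ρ₀ = η₀ S from rfl]
  have hK : S.ρ₀ * 0 ^ 2 + S.p S.ρ₀ - ρf S am bm * wf am bm ^ 2 - S.p (ρf S am bm)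
    = (S.ρ₀ - ρf S am bm) * V * V := by rw [hV, hM]; ring
  have hn : S.ρ₀ * 0 - ρf S am bm * wf am bm = (S.ρ₀ - ρf S am bm) * V := by rw [hV]; ring
  rw [hK, hn]
  field_simp
  ring

end Setup

end Physics

section InteractionPoint

namespace Setup

variable (S : Setup)

theorem ρf_σ {r : ℝ} (hr : 0 < r) (w : ℝ) : ρf S (S.σ r + w) (S.σ r - w) = r := by
  rw [ρf, show (S.σ r + w + (S.σ r - w)) / 2 = S.σ r by ring, S.R_σ hr]

theorem wf_σ (r w : ℝ) : wf (S.σ r + w) (S.σ r - w) = w := by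
  rw [wf]
  ring

theorem ρst₁_pos : 0 < S.ρst₁ (0, 0) := S.hρst₁pos _ S.hD₁0

theorem ρst₂_pos : 0 < S.ρst₂ (0, 0) := S.hρst₂pos _ S.hD₂0

theorem ρf_ahead₁ : ρf S (αm₁₀ S) (βm₁₀ S) = S.ρst₁ (0, 0) := S.ρf_σ S.ρst₁_pos _

theorem ρf_ahead₂ : ρf S (αm₂₀ S) (βm₂₀ S) = S.ρst₂ (0, 0) := S.ρf_σ S.ρst₂_pos _

theorem wf_ahead₁ : wf (αm₁₀ S) (βm₁₀ S) = S.wst₁ (0, 0) := S.wf_σ _ _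

theorem wf_ahead₂ : wf (αm₂₀ S) (βm₂₀ S) = S.wst₂ (0, 0) := S.wf_σ _ _

theorem density_jump₁_ne : S.ρ₀ - ρf S (αm₁₀ S) (βm₁₀ S) ≠ 0 := by
  rw [S.ρf_ahead₁]
  intro h
  have h1 := S.hjump₁V
  rw [h, zero_mul, zero_eq_neg] at h1
  have h2 := S.hdet₁r
  rw [(mul_eq_zero.1 h1).resolve_left S.ρst₁_pos.ne', ← sub_eq_zero.1 h] at h2
  linarith [S.hdet₁l]

theorem density_jump₂_ne : S.ρ₀ - ρf S (αm₂₀ S) (βm₂₀ S) ≠ 0 := by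
  rw [S.ρf_ahead₂]
  intro h
  have h1 := S.hjump₂V
  rw [h, zero_mul, zero_eq_neg] at h1
  have h2 := S.hdet₂l
  rw [(mul_eq_zero.1 h1).resolve_left S.ρst₂_pos.ne', ← sub_eq_zero.1 h] at h2
  linarith [S.hdet₂r]

theorem η₀_add_V₁₀_pos : 0 < η₀ S + S.V₁₀ := by
  have := S.hdet₁l
  rw [← η₀] at this
  linarith

theorem η₀_sub_V₁₀_pos : 0 < η₀ S - S.V₁₀ := by linarith [S.η₀_pos, S.hV₁₀neg]

theorem η₀_add_V₂₀_pos : 0 < η₀ S + S.V₂₀ := by linarith [S.η₀_pos, S.hV₂₀pos]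

theorem η₀_sub_V₂₀_pos : 0 < η₀ S - S.V₂₀ := by
  have := S.hdet₂r
  rw [← η₀] at this
  linarith

theorem aconst_pos : 0 < aconst S :=
  mul_pos (div_pos S.η₀_add_V₁₀_pos S.η₀_sub_V₁₀_pos) (div_pos S.η₀_sub_V₂₀_pos S.η₀_add_V₂₀_pos)

theorem aconst_lt_one : aconst S < 1 := by
  refine mul_lt_one_of_nonneg_of_lt_one_left (div_pos S.η₀_add_V₁₀_pos S.η₀_sub_V₁₀_pos).le
    ((div_lt_one S.η₀_sub_V₁₀_pos).2 ?_) ((div_le_one S.η₀_add_V₂₀_pos).2 ?_)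
  · linarith [S.hV₁₀neg]
  · linarith [S.hV₂₀pos]

theorem Γ₀_neg : Γ₀ S < 0 := by
  rw [Γ₀, neg_div]
  exact neg_neg_of_pos (div_pos S.η₀_add_V₁₀_pos S.η₀_sub_V₁₀_pos)

theorem abs_F₁₀_lt_one : |F₁₀ S| < 1 := by
  have h1 : 0 < (S.V₁₀ + η₀ S) / (η₀ S - S.V₁₀) := by
    rw [add_comm]
    exact div_pos S.η₀_add_V₁₀_pos S.η₀_sub_V₁₀_pos
  have h2 : (S.V₁₀ + η₀ S) / (η₀ S - S.V₁₀) < 1 :=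
    (div_lt_one S.η₀_sub_V₁₀_pos).2 (by linarith [S.hV₁₀neg])
  rw [F₁₀, abs_neg, abs_of_nonneg (sq_nonneg _)]
  nlinarith

theorem abs_F₂₀_lt_one : |F₂₀ S| < 1 := by
  have h1 : 0 < (η₀ S - S.V₂₀) / (S.V₂₀ + η₀ S) := by
    rw [add_comm]
    exact div_pos S.η₀_sub_V₂₀_pos S.η₀_add_V₂₀_pos
  have h2 : (η₀ S - S.V₂₀) / (S.V₂₀ + η₀ S) < 1 := by
    rw [add_comm]
    exact (div_lt_one S.η₀_add_V₂₀_pos).2 (by linarith [S.hV₂₀pos])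
  rw [F₂₀, abs_neg, abs_of_nonneg (sq_nonneg _)]
  nlinarith

theorem det_pos : 0 < 1 - aconst S * F₁₀ S * F₂₀ S := by
  have h : |aconst S * F₁₀ S * F₂₀ S| < 1 := by
    rw [abs_mul, abs_mul, abs_of_pos S.aconst_pos]
    have h1 : aconst S * |F₁₀ S| < 1 := mul_lt_one_of_nonneg_of_lt_one_left S.aconst_pos.le
      S.aconst_lt_one S.abs_F₁₀_lt_one.le
    exact mul_lt_one_of_nonneg_of_lt_one_left (mul_nonneg S.aconst_pos.le (abs_nonneg _)) h1
      S.abs_F₂₀_lt_one.le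
  linarith [le_abs_self (aconst S * F₁₀ S * F₂₀ S)]

theorem α₀'_eq : F₁₀ S * β₀' S + a₀ S = α₀' S := by
  have h := S.det_pos.ne'
  rw [α₀', β₀', eq_div_iff h, add_mul, mul_assoc, div_mul_cancel₀ _ h]
  ring

theorem β₀'_eq : aconst S * F₂₀ S * α₀' S + b₀ S = β₀' S := by
  have h := S.det_pos.ne'
  rw [α₀', β₀', eq_div_iff h, add_mul, mul_assoc, div_mul_cancel₀ _ h]
  ring

section Jump

variable {S} {am bm V : ℝ} (hV : (S.ρ₀ - ρf S am bm) * V = -(ρf S am bm * wf am bm))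
  (hM : -(ρf S am bm * wf am bm) * V = S.p S.ρ₀ - (ρf S am bm * wf am bm ^ 2 + S.p (ρf S am bm)))

include hV hM

theorem Jαp_base : Jαp S (β₀ S) (β₀ S) am bm =
    -((S.ρ₀ - ρf S am bm) * (S.ρ₀ / (2 * η₀ S)) * (η₀ S - V) ^ 2) := by
  have h := S.hasDerivAt_Jf (a := fun s => s) (b := fun _ => β₀ S) (s := β₀ S) (hasDerivAt_id' _)
    (hasDerivAt_const _ _) rfl rfl hV hM
  exact h.deriv.trans (by ring)

theorem Jβp_base : Jβp S (β₀ S) (β₀ S) am bm =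
    -((S.ρ₀ - ρf S am bm) * (S.ρ₀ / (2 * η₀ S)) * (η₀ S + V) ^ 2) := by
  have h := S.hasDerivAt_Jf (a := fun _ => β₀ S) (b := fun s => s) (s := β₀ S)
    (hasDerivAt_const _ _) (hasDerivAt_id' _) rfl rfl hV hM
  exact h.deriv.trans (by ring)

theorem Jαp_base_ne (hd : S.ρ₀ - ρf S am bm ≠ 0) (hη : η₀ S - V ≠ 0) :
    Jαp S (β₀ S) (β₀ S) am bm ≠ 0 := by
  rw [Jαp_base hV hM]
  have h1 := S.hρ₀
  have h2 := S.η₀_pos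
  have h3 : S.ρ₀ / (2 * η₀ S) ≠ 0 := by positivity
  exact neg_ne_zero.2 (mul_ne_zero (mul_ne_zero hd h3) (pow_ne_zero 2 hη))

theorem Jβp_base_ne (hd : S.ρ₀ - ρf S am bm ≠ 0) (hη : η₀ S + V ≠ 0) :
    Jβp S (β₀ S) (β₀ S) am bm ≠ 0 := by
  rw [Jβp_base hV hM]
  have h1 := S.hρ₀
  have h2 := S.η₀_pos
  have h3 : S.ρ₀ / (2 * η₀ S) ≠ 0 := by positivity
  exact neg_ne_zero.2 (mul_ne_zero (mul_ne_zero hd h3) (pow_ne_zero 2 hη))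

end Jump

theorem jumpV₁ : (S.ρ₀ - ρf S (αm₁₀ S) (βm₁₀ S)) * S.V₁₀ =
    -(ρf S (αm₁₀ S) (βm₁₀ S) * wf (αm₁₀ S) (βm₁₀ S)) := by
  rw [S.ρf_ahead₁, S.wf_ahead₁, S.hjump₁V]

theorem jumpM₁ : -(ρf S (αm₁₀ S) (βm₁₀ S) * wf (αm₁₀ S) (βm₁₀ S)) * S.V₁₀ =
    S.p S.ρ₀ - (ρf S (αm₁₀ S) (βm₁₀ S) * wf (αm₁₀ S) (βm₁₀ S) ^ 2
      + S.p (ρf S (αm₁₀ S) (βm₁₀ S))) := by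
  rw [S.ρf_ahead₁, S.wf_ahead₁, S.hjump₁M]

theorem jumpV₂ : (S.ρ₀ - ρf S (αm₂₀ S) (βm₂₀ S)) * S.V₂₀ =
    -(ρf S (αm₂₀ S) (βm₂₀ S) * wf (αm₂₀ S) (βm₂₀ S)) := by
  rw [S.ρf_ahead₂, S.wf_ahead₂, S.hjump₂V]

theorem jumpM₂ : -(ρf S (αm₂₀ S) (βm₂₀ S) * wf (αm₂₀ S) (βm₂₀ S)) * S.V₂₀ =
    S.p S.ρ₀ - (ρf S (αm₂₀ S) (βm₂₀ S) * wf (αm₂₀ S) (βm₂₀ S) ^ 2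
      + S.p (ρf S (αm₂₀ S) (βm₂₀ S))) := by
  rw [S.ρf_ahead₂, S.wf_ahead₂, S.hjump₂M]

theorem Jαp₁_ne : Jαp S (β₀ S) (β₀ S) (αm₁₀ S) (βm₁₀ S) ≠ 0 :=
  Jαp_base_ne S.jumpV₁ S.jumpM₁ S.density_jump₁_ne S.η₀_sub_V₁₀_pos.ne'

theorem Jβp₂_ne : Jβp S (β₀ S) (β₀ S) (αm₂₀ S) (βm₂₀ S) ≠ 0 :=
  Jβp_base_ne S.jumpV₂ S.jumpM₂ S.density_jump₂_ne S.η₀_add_V₂₀_pos.ne'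

theorem F₁₀_mul_Jαp : F₁₀ S * Jαp S (β₀ S) (β₀ S) (αm₁₀ S) (βm₁₀ S)
    = -Jβp S (β₀ S) (β₀ S) (αm₁₀ S) (βm₁₀ S) := by
  have := S.η₀_sub_V₁₀_pos.ne'
  rw [Jαp_base S.jumpV₁ S.jumpM₁, Jβp_base S.jumpV₁ S.jumpM₁, F₁₀]
  field_simp
  ring

theorem F₂₀_mul_Jβp : F₂₀ S * Jβp S (β₀ S) (β₀ S) (αm₂₀ S) (βm₂₀ S)
    = -Jαp S (β₀ S) (β₀ S) (αm₂₀ S) (βm₂₀ S) := by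
  have h := S.η₀_add_V₂₀_pos.ne'
  rw [Jαp_base S.jumpV₂ S.jumpM₂, Jβp_base S.jumpV₂ S.jumpM₂, F₂₀, add_comm S.V₂₀]
  field_simp

theorem contDiffAt_αst₁ : ContDiffAt ℝ (⊤ : ℕ∞) (αst₁ S) (0, 0) :=
  ((S.contDiffAt_σ S.ρst₁_pos).comp _ S.hρst₁.contDiffAt).add S.hwst₁.contDiffAt

theorem contDiffAt_βst₁ : ContDiffAt ℝ (⊤ : ℕ∞) (βst₁ S) (0, 0) :=
  ((S.contDiffAt_σ S.ρst₁_pos).comp _ S.hρst₁.contDiffAt).sub S.hwst₁.contDiffAt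

theorem contDiffAt_αst₂ : ContDiffAt ℝ (⊤ : ℕ∞) (αst₂ S) (0, 0) :=
  ((S.contDiffAt_σ S.ρst₂_pos).comp _ S.hρst₂.contDiffAt).add S.hwst₂.contDiffAt

theorem contDiffAt_βst₂ : ContDiffAt ℝ (⊤ : ℕ∞) (βst₂ S) (0, 0) :=
  ((S.contDiffAt_σ S.ρst₂_pos).comp _ S.hρst₂.contDiffAt).sub S.hwst₂.contDiffAt

end Setup

theorem fderiv_eq_pu_pv {f : ℝ × ℝ → ℝ} {q : ℝ × ℝ} (hf : DifferentiableAt ℝ f q) (d : ℝ × ℝ) :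
    fderiv ℝ f q d = pu f q * d.1 + pv f q * d.2 := by
  have e1 : pu f q = fderiv ℝ f q (1, 0) :=
    (HasFDerivAt.comp_hasDerivAt_of_eq q.1 hf.hasFDerivAt
      ((hasDerivAt_id q.1).prodMk (hasDerivAt_const q.1 q.2)) rfl).deriv
  have e2 : pv f q = fderiv ℝ f q (0, 1) :=
    (HasFDerivAt.comp_hasDerivAt_of_eq q.2 hf.hasFDerivAt
      ((hasDerivAt_const q.2 q.1).prodMk (hasDerivAt_id q.2)) rfl).deriv
  have hd : d = d.1 • (1, 0) + d.2 • (0, 1) := by ext <;> simp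
  rw [e1, e2]
  conv_lhs => rw [hd]
  rw [map_add, map_smul, map_smul, smul_eq_mul, smul_eq_mul]
  ring

namespace IterSetup

variable (T : IterSetup)

theorem contDiffAt_H₁ : ContDiffAt ℝ (⊤ : ℕ∞) T.H₁
    (β₀ T.toSetup, αm₁₀ T.toSetup, βm₁₀ T.toSetup) :=
  T.hH₁.contDiffAt (T.hU₁.mem_nhds T.hU₁mem)

theorem contDiffAt_H₂ : ContDiffAt ℝ (⊤ : ℕ∞) T.H₂
    (β₀ T.toSetup, αm₂₀ T.toSetup, βm₂₀ T.toSetup) :=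
  T.hH₂.contDiffAt (T.hU₂.mem_nhds T.hU₂mem)

/-- The linearized jump condition along the left shock. -/
theorem fderiv_H₁ (d : ℝ × ℝ × ℝ) :
    fderiv ℝ T.H₁ (β₀ T.toSetup, αm₁₀ T.toSetup, βm₁₀ T.toSetup) d =
      F₁₀ T.toSetup * d.1 + M₁₁₀ T.toSetup * d.2.1 + M₁₂₀ T.toSetup * d.2.2 := by
  obtain ⟨z, hz⟩ : ∃ z, z = (β₀ T.toSetup, αm₁₀ T.toSetup, βm₁₀ T.toSetup) := ⟨_, rfl⟩
  have hval : T.H₁ z = β₀ T.toSetup := hz ▸ T.hH₁val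
  have hU : T.U₁ ∈ 𝓝 z := hz ▸ T.hU₁.mem_nhds T.hU₁mem
  have hd : HasFDerivAt T.H₁ (fderiv ℝ T.H₁ z) z :=
    (((T.hH₁.contDiffAt hU)).differentiableAt (by simp)).hasFDerivAt
  have h1 : HasFDerivAt (fun y : ℝ × ℝ × ℝ => (T.H₁ y, y))
      ((fderiv ℝ T.H₁ z).prod (ContinuousLinearMap.id ℝ (ℝ × ℝ × ℝ))) z :=
    hd.prodMk (hasFDerivAt_id z)
  have hJ := (T.contDiff_Jf.differentiable (by simp) (T.H₁ z, z)).hasFDerivAt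
  have h2 := HasFDerivAt.comp (f := fun y : ℝ × ℝ × ℝ => (T.H₁ y, y)) z hJ h1
  have h3 : HasFDerivAt (fun _ : ℝ × ℝ × ℝ => (0 : ℝ)) (0 : ℝ × ℝ × ℝ →L[ℝ] ℝ) z :=
    hasFDerivAt_const _ _
  have h4 := DFunLike.congr_fun (h2.unique (h3.congr_of_eventuallyEq
    (Filter.mem_of_superset hU T.hH₁J))) d
  rw [ContinuousLinearMap.comp_apply, hval, Setup.fderiv_Jf] at h4
  rw [← hz]
  simp only [hz, ContinuousLinearMap.prod_apply, ContinuousLinearMap.id_apply,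
    zero_apply] at h4 ⊢
  have hne := T.Jαp₁_ne
  have hF := T.F₁₀_mul_Jαp
  rw [M₁₁₀, M₁₂₀]
  apply mul_left_cancel₀ hne
  field_simp
  linear_combination h4 - d.1 * hF

/-- The linearized jump condition along the right shock. -/
theorem fderiv_H₂ (d : ℝ × ℝ × ℝ) :
    fderiv ℝ T.H₂ (β₀ T.toSetup, αm₂₀ T.toSetup, βm₂₀ T.toSetup) d =
      F₂₀ T.toSetup * d.1 + M₂₁₀ T.toSetup * d.2.1 + M₂₂₀ T.toSetup * d.2.2 := by
  obtain ⟨z, hz⟩ : ∃ z, z = (β₀ T.toSetup, αm₂₀ T.toSetup, βm₂₀ T.toSetup) := ⟨_, rfl⟩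
  have hval : T.H₂ z = β₀ T.toSetup := hz ▸ T.hH₂val
  have hU : T.U₂ ∈ 𝓝 z := hz ▸ T.hU₂.mem_nhds T.hU₂mem
  have hd : HasFDerivAt T.H₂ (fderiv ℝ T.H₂ z) z :=
    (((T.hH₂.contDiffAt hU)).differentiableAt (by simp)).hasFDerivAt
  have h1 : HasFDerivAt (fun y : ℝ × ℝ × ℝ => (y.1, T.H₂ y, y.2))
      ((ContinuousLinearMap.fst ℝ ℝ (ℝ × ℝ)).prod
        ((fderiv ℝ T.H₂ z).prod (ContinuousLinearMap.snd ℝ ℝ (ℝ × ℝ)))) z :=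
    hasFDerivAt_fst.prodMk (hd.prodMk hasFDerivAt_snd)
  have hJ := (T.contDiff_Jf.differentiable (by simp) (z.1, T.H₂ z, z.2)).hasFDerivAt
  have h2 := HasFDerivAt.comp (f := fun y : ℝ × ℝ × ℝ => (y.1, T.H₂ y, y.2)) z hJ h1
  have h3 : HasFDerivAt (fun _ : ℝ × ℝ × ℝ => (0 : ℝ)) (0 : ℝ × ℝ × ℝ →L[ℝ] ℝ) z :=
    hasFDerivAt_const _ _
  have h4 := DFunLike.congr_fun (h2.unique (h3.congr_of_eventuallyEq
    (Filter.mem_of_superset hU T.hH₂J))) d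
  rw [ContinuousLinearMap.comp_apply, hval, Setup.fderiv_Jf] at h4
  rw [← hz]
  simp only [hz, ContinuousLinearMap.prod_apply, ContinuousLinearMap.coe_fst',
    ContinuousLinearMap.coe_snd', zero_apply] at h4 ⊢
  have hne := T.Jβp₂_ne
  have hF := T.F₂₀_mul_Jβp
  rw [M₂₁₀, M₂₂₀]
  apply mul_left_cancel₀ hne
  field_simp
  linear_combination h4 - d.1 * hF

end IterSetup

end InteractionPoint

section InteractionSystem

namespace Setup

variable (S : Setup)

/-- The shock speed `[ρw] / [ρ]`. -/
def shockSpeed (α β αm βm : ℝ) : ℝ :=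
  (ρf S α β * wf α β - ρf S αm βm * wf αm βm) / (ρf S α β - ρf S αm βm)

/-- The ratio `∂x/∂v : ∂x/∂u` along a shock with states ahead `am`, `bm`, as a function of the
Riemann invariants behind and of the position of the shock. -/
def slope (am bm : ℝ × ℝ → ℝ) (z : ℝ × ℝ × ℝ × ℝ) : ℝ :=
  (cout S z.1 z.2.1 / cin S z.1 z.2.1) *
    ((S.shockSpeed z.1 z.2.1 (am z.2.2) (bm z.2.2) - cin S z.1 z.2.1) /
      (cout S z.1 z.2.1 - S.shockSpeed z.1 z.2.1 (am z.2.2) (bm z.2.2)))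

variable {S} in
theorem shockSpeed_base {am bm V : ℝ} (hd : S.ρ₀ - ρf S am bm ≠ 0)
    (hV : (S.ρ₀ - ρf S am bm) * V = -(ρf S am bm * wf am bm)) :
    S.shockSpeed (β₀ S) (β₀ S) am bm = V := by
  rw [shockSpeed, ρf_base, wf_base, div_eq_iff hd, mul_zero, zero_sub, ← hV, mul_comm]

variable {S} in
theorem slope_base {am bm : ℝ × ℝ → ℝ} {V : ℝ} (hd : S.ρ₀ - ρf S (am (0, 0)) (bm (0, 0)) ≠ 0)
    (hV : (S.ρ₀ - ρf S (am (0, 0)) (bm (0, 0))) * V =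
      -(ρf S (am (0, 0)) (bm (0, 0)) * wf (am (0, 0)) (bm (0, 0)))) :
    S.slope am bm (β₀ S, β₀ S, 0, 0) = -(η₀ S + V) / (η₀ S - V) := by
  have h := S.η₀_pos.ne'
  rw [slope, shockSpeed_base hd hV, cin_base, cout_base, div_neg, div_self h]
  ring

variable {S} in
theorem contDiffAt_slope {am bm : ℝ × ℝ → ℝ} {V : ℝ}
    (ham : ContDiffAt ℝ (⊤ : ℕ∞) am (0, 0)) (hbm : ContDiffAt ℝ (⊤ : ℕ∞) bm (0, 0))
    (hd : S.ρ₀ - ρf S (am (0, 0)) (bm (0, 0)) ≠ 0)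
    (hV : (S.ρ₀ - ρf S (am (0, 0)) (bm (0, 0))) * V =
      -(ρf S (am (0, 0)) (bm (0, 0)) * wf (am (0, 0)) (bm (0, 0)))) (hη : η₀ S - V ≠ 0) :
    ContDiffAt ℝ (⊤ : ℕ∞) (S.slope am bm) (β₀ S, β₀ S, 0, 0) := by
  have hp : ContDiff ℝ (⊤ : ℕ∞) fun z : ℝ × ℝ × ℝ × ℝ => (z.1, z.2.1) := by fun_prop
  have hq : ContDiffAt ℝ (⊤ : ℕ∞) (fun z : ℝ × ℝ × ℝ × ℝ => z.2.2) (β₀ S, β₀ S, 0, 0) := by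
    fun_prop
  have hm : ContDiffAt ℝ (⊤ : ℕ∞) (fun z : ℝ × ℝ × ℝ × ℝ => (am z.2.2, bm z.2.2))
      (β₀ S, β₀ S, 0, 0) :=
    (ContDiffAt.comp (β₀ S, β₀ S, 0, 0) ham hq).prodMk (ContDiffAt.comp (β₀ S, β₀ S, 0, 0) hbm hq)
  have h1 := (S.contDiff_ρf.comp hp).contDiffAt (x := (β₀ S, β₀ S, 0, 0))
  have h2 := (contDiff_wf.comp hp).contDiffAt (x := (β₀ S, β₀ S, 0, 0))
  have h3 := S.contDiff_ρf.contDiffAt.comp (β₀ S, β₀ S, 0, 0) hm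
  have h4 := contDiff_wf.contDiffAt.comp (β₀ S, β₀ S, 0, 0) hm
  have h5 := (S.contDiff_cin.comp hp).contDiffAt (x := (β₀ S, β₀ S, 0, 0))
  have h6 := (S.contDiff_cout.comp hp).contDiffAt (x := (β₀ S, β₀ S, 0, 0))
  have h7 : ContDiffAt ℝ (⊤ : ℕ∞) (fun z : ℝ × ℝ × ℝ × ℝ =>
      S.shockSpeed z.1 z.2.1 (am z.2.2) (bm z.2.2)) (β₀ S, β₀ S, 0, 0) := by
    refine ((h1.mul h2).sub (h3.mul h4)).div (h1.sub h3) ?_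
    rwa [← ρf_base] at hd
  refine (h6.div h5 ?_).mul ((h7.sub h5).div (h6.sub h7) ?_)
  · rw [Function.comp_apply, cin_base]
    exact neg_ne_zero.2 S.η₀_pos.ne'
  · rwa [cout_base, shockSpeed_base hd hV]

/-- `∂t/∂u` in terms of the Riemann invariants and `∂x/∂u`. -/
def timeU (z : ℝ × ℝ × ℝ) : ℝ := z.2.2 / cin S z.1 z.2.1

/-- `∂t/∂v` in terms of the Riemann invariants and `∂x/∂v`. -/
def timeV (z : ℝ × ℝ × ℝ) : ℝ := z.2.2 / cout S z.1 z.2.1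

/-- The mixed derivative of `x` in terms of the Riemann invariants, their derivatives, and the
first derivatives of `x`. -/
def mixed (z : ℝ × ℝ × ℝ × ℝ × ℝ × ℝ) : ℝ :=
  1 / (cout S z.1 z.2.1 - cin S z.1 z.2.1) * (cout S z.1 z.2.1 / cin S z.1 z.2.1) *
      (fderiv ℝ (fun w : ℝ × ℝ => cin S w.1 w.2) (z.1, z.2.1) (0, 1) * z.2.2.2.1) * z.2.2.2.2.1 +
    -(1 / (cout S z.1 z.2.1 - cin S z.1 z.2.1) * (cin S z.1 z.2.1 / cout S z.1 z.2.1) *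
      (fderiv ℝ (fun w : ℝ × ℝ => cout S w.1 w.2) (z.1, z.2.1) (1, 0) * z.2.2.1)) * z.2.2.2.2.2

theorem contDiffAt_timeU (p : ℝ) : ContDiffAt ℝ (⊤ : ℕ∞) S.timeU (β₀ S, β₀ S, p) := by
  have hp : ContDiff ℝ (⊤ : ℕ∞) fun z : ℝ × ℝ × ℝ => (z.1, z.2.1) := by fun_prop
  refine ContDiffAt.div (by fun_prop) (S.contDiff_cin.comp hp).contDiffAt ?_
  rw [cin_base]
  exact neg_ne_zero.2 S.η₀_pos.ne'

theorem contDiffAt_timeV (p : ℝ) : ContDiffAt ℝ (⊤ : ℕ∞) S.timeV (β₀ S, β₀ S, p) := by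
  have hp : ContDiff ℝ (⊤ : ℕ∞) fun z : ℝ × ℝ × ℝ => (z.1, z.2.1) := by fun_prop
  refine ContDiffAt.div (by fun_prop) (S.contDiff_cout.comp hp).contDiffAt ?_
  rw [cout_base]
  exact S.η₀_pos.ne'

theorem contDiffAt_mixed (z : ℝ × ℝ × ℝ × ℝ) :
    ContDiffAt ℝ (⊤ : ℕ∞) S.mixed (β₀ S, β₀ S, z) := by
  have hp : ContDiff ℝ (⊤ : ℕ∞) fun z : ℝ × ℝ × ℝ × ℝ × ℝ × ℝ => (z.1, z.2.1) := by fun_prop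
  have h1 := (S.contDiff_cin.comp hp).contDiffAt (x := (β₀ S, β₀ S, z))
  have h2 := (S.contDiff_cout.comp hp).contDiffAt (x := (β₀ S, β₀ S, z))
  have h3 := ((S.contDiff_cin.fderiv_right (m := (⊤ : ℕ∞)) (by simp)).comp hp).contDiffAt
    (x := (β₀ S, β₀ S, z))
  have h4 := ((S.contDiff_cout.fderiv_right (m := (⊤ : ℕ∞)) (by simp)).comp hp).contDiffAt
    (x := (β₀ S, β₀ S, z))
  have hη := S.η₀_pos
  have e1 : cin S (β₀ S) (β₀ S) ≠ 0 := by
    rw [cin_base]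
    exact neg_ne_zero.2 hη.ne'
  have e2 : cout S (β₀ S) (β₀ S) ≠ 0 := by
    rw [cout_base]
    exact hη.ne'
  have e3 : cout S (β₀ S) (β₀ S) - cin S (β₀ S) (β₀ S) ≠ 0 := by
    rw [cin_base, cout_base]
    linarith
  have h5 := contDiffAt_const (c := (1 : ℝ)).div (h2.sub h1) e3
  exact (((h5.mul (h2.div h1 e1)).mul ((h3.clm_apply contDiffAt_const).mul (by fun_prop))).mul
    (by fun_prop)).add (((h5.mul (h1.div h2 e2)).mul
      ((h4.clm_apply contDiffAt_const).mul (by fun_prop))).neg.mul (by fun_prop))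

end Setup

theorem hasFDerivAt_comp_snd {f : ℝ × ℝ → ℝ} {q : ℝ × ℝ} (hf : DifferentiableAt ℝ f q) (b : ℝ) :
    HasFDerivAt (fun z : ℝ × ℝ × ℝ => f z.2)
      ((fderiv ℝ f q).comp (ContinuousLinearMap.snd ℝ ℝ (ℝ × ℝ))) (b, q) :=
  HasFDerivAt.comp (f := fun z : ℝ × ℝ × ℝ => z.2) (b, q) hf.hasFDerivAt hasFDerivAt_snd

namespace IterSetup

variable (T : IterSetup)

/-- The Riemann invariant `α` behind the left shock. -/
def behind₁ (z : ℝ × ℝ × ℝ) : ℝ := T.H₁ (z.1, αst₁ T.toSetup z.2, βst₁ T.toSetup z.2)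

/-- The Riemann invariant `β` behind the right shock. -/
def behind₂ (z : ℝ × ℝ × ℝ) : ℝ := T.H₂ (z.1, αst₂ T.toSetup z.2, βst₂ T.toSetup z.2)

theorem contDiffAt_state₁ : ContDiffAt ℝ (⊤ : ℕ∞)
    (fun z : ℝ × ℝ × ℝ => (z.1, αst₁ T.toSetup z.2, βst₁ T.toSetup z.2)) (β₀ T.toSetup, 0, 0) :=
  contDiffAt_fst.prodMk ((T.contDiffAt_αst₁.comp (β₀ T.toSetup, 0, 0) contDiffAt_snd).prodMk
    (T.contDiffAt_βst₁.comp (β₀ T.toSetup, 0, 0) contDiffAt_snd))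

theorem contDiffAt_state₂ : ContDiffAt ℝ (⊤ : ℕ∞)
    (fun z : ℝ × ℝ × ℝ => (z.1, αst₂ T.toSetup z.2, βst₂ T.toSetup z.2)) (β₀ T.toSetup, 0, 0) :=
  contDiffAt_fst.prodMk ((T.contDiffAt_αst₂.comp (β₀ T.toSetup, 0, 0) contDiffAt_snd).prodMk
    (T.contDiffAt_βst₂.comp (β₀ T.toSetup, 0, 0) contDiffAt_snd))

theorem contDiffAt_behind₁ : ContDiffAt ℝ (⊤ : ℕ∞) T.behind₁ (β₀ T.toSetup, 0, 0) :=
  ContDiffAt.comp (β₀ T.toSetup, 0, 0) T.contDiffAt_H₁ T.contDiffAt_state₁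

theorem contDiffAt_behind₂ : ContDiffAt ℝ (⊤ : ℕ∞) T.behind₂ (β₀ T.toSetup, 0, 0) :=
  ContDiffAt.comp (β₀ T.toSetup, 0, 0) T.contDiffAt_H₂ T.contDiffAt_state₂

theorem fderiv_behind₁ (d : ℝ × ℝ × ℝ) : fderiv ℝ T.behind₁ (β₀ T.toSetup, 0, 0) d =
    F₁₀ T.toSetup * d.1
      + M₁₁₀ T.toSetup * (pu (αst₁ T.toSetup) (0, 0) * d.2.1 + pv (αst₁ T.toSetup) (0, 0) * d.2.2)
      + M₁₂₀ T.toSetup *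
        (pu (βst₁ T.toSetup) (0, 0) * d.2.1 + pv (βst₁ T.toSetup) (0, 0) * d.2.2) := by
  have hα := T.contDiffAt_αst₁.differentiableAt (by simp)
  have hβ := T.contDiffAt_βst₁.differentiableAt (by simp)
  have h1 : HasFDerivAt (fun z : ℝ × ℝ × ℝ => (z.1, αst₁ T.toSetup z.2, βst₁ T.toSetup z.2))
      ((ContinuousLinearMap.fst ℝ ℝ (ℝ × ℝ)).prod
        (((fderiv ℝ (αst₁ T.toSetup) (0, 0)).comp (ContinuousLinearMap.snd ℝ ℝ (ℝ × ℝ))).prod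
          ((fderiv ℝ (βst₁ T.toSetup) (0, 0)).comp (ContinuousLinearMap.snd ℝ ℝ (ℝ × ℝ)))))
      (β₀ T.toSetup, 0, 0) :=
    hasFDerivAt_fst.prodMk
      ((hasFDerivAt_comp_snd hα _).prodMk (hasFDerivAt_comp_snd hβ _))
  have h2 : HasFDerivAt T.H₁ _ (β₀ T.toSetup, αst₁ T.toSetup (0, 0), βst₁ T.toSetup (0, 0)) :=
    (T.contDiffAt_H₁.differentiableAt (by simp)).hasFDerivAt
  have h3 := HasFDerivAt.comp (f := fun z : ℝ × ℝ × ℝ =>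
    (z.1, αst₁ T.toSetup z.2, βst₁ T.toSetup z.2)) (β₀ T.toSetup, 0, 0) h2 h1
  have h4 : fderiv ℝ T.behind₁ (β₀ T.toSetup, 0, 0) = _ := h3.fderiv
  rw [h4, ContinuousLinearMap.comp_apply]
  refine (T.fderiv_H₁ _).trans ?_
  simp [fderiv_eq_pu_pv hα, fderiv_eq_pu_pv hβ]

theorem fderiv_behind₂ (d : ℝ × ℝ × ℝ) : fderiv ℝ T.behind₂ (β₀ T.toSetup, 0, 0) d =
    F₂₀ T.toSetup * d.1
      + M₂₁₀ T.toSetup * (pu (αst₂ T.toSetup) (0, 0) * d.2.1 + pv (αst₂ T.toSetup) (0, 0) * d.2.2)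
      + M₂₂₀ T.toSetup *
        (pu (βst₂ T.toSetup) (0, 0) * d.2.1 + pv (βst₂ T.toSetup) (0, 0) * d.2.2) := by
  have hα := T.contDiffAt_αst₂.differentiableAt (by simp)
  have hβ := T.contDiffAt_βst₂.differentiableAt (by simp)
  have h1 : HasFDerivAt (fun z : ℝ × ℝ × ℝ => (z.1, αst₂ T.toSetup z.2, βst₂ T.toSetup z.2))
      ((ContinuousLinearMap.fst ℝ ℝ (ℝ × ℝ)).prod
        (((fderiv ℝ (αst₂ T.toSetup) (0, 0)).comp (ContinuousLinearMap.snd ℝ ℝ (ℝ × ℝ))).prod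
          ((fderiv ℝ (βst₂ T.toSetup) (0, 0)).comp (ContinuousLinearMap.snd ℝ ℝ (ℝ × ℝ)))))
      (β₀ T.toSetup, 0, 0) :=
    hasFDerivAt_fst.prodMk
      ((hasFDerivAt_comp_snd hα _).prodMk (hasFDerivAt_comp_snd hβ _))
  have h2 : HasFDerivAt T.H₂ _ (β₀ T.toSetup, αst₂ T.toSetup (0, 0), βst₂ T.toSetup (0, 0)) :=
    (T.contDiffAt_H₂.differentiableAt (by simp)).hasFDerivAt
  have h3 := HasFDerivAt.comp (f := fun z : ℝ × ℝ × ℝ =>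
    (z.1, αst₂ T.toSetup z.2, βst₂ T.toSetup z.2)) (β₀ T.toSetup, 0, 0) h2 h1
  have h4 : fderiv ℝ T.behind₂ (β₀ T.toSetup, 0, 0) = _ := h3.fderiv
  rw [h4, ContinuousLinearMap.comp_apply]
  refine (T.fderiv_H₂ _).trans ?_
  simp [fderiv_eq_pu_pv hα, fderiv_eq_pu_pv hβ]

theorem slope₁_base :
    T.slope (αst₁ T.toSetup) (βst₁ T.toSetup) (β₀ T.toSetup, β₀ T.toSetup, 0, 0) =
      Γ₀ T.toSetup :=
  Setup.slope_base T.density_jump₁_ne T.jumpV₁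

theorem slope₂_base :
    aconst T.toSetup * T.slope (αst₂ T.toSetup) (βst₂ T.toSetup)
      (β₀ T.toSetup, β₀ T.toSetup, 0, 0) = Γ₀ T.toSetup := by
  rw [Setup.slope_base T.density_jump₂_ne T.jumpV₂, aconst, Γ₀]
  have h1 := T.η₀_add_V₂₀_pos.ne'
  have h2 := T.η₀_sub_V₂₀_pos.ne'
  field_simp

/-- The iteration system of the shock interaction problem. -/
def system : System where
  a := aconst T.toSetup
  Γ := Γ₀ T.toSetup
  β := β₀ T.toSetup
  α' := α₀' T.toSetup
  β' := β₀' T.toSetup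
  F := T.timeU
  O := T.timeV
  M := T.mixed
  G₁ := T.slope (αst₁ T.toSetup) (βst₁ T.toSetup)
  G₂ z := aconst T.toSetup * T.slope (αst₂ T.toSetup) (βst₂ T.toSetup) z
  h₁ := T.behind₁
  h₂ := T.behind₂
  a_pos := T.aconst_pos
  a_lt := T.aconst_lt_one
  Γ_ne := T.Γ₀_neg.ne
  contDiff_F := (T.contDiffAt_timeU _).of_le (WithTop.coe_le_coe.2 le_top)
  contDiff_O := (T.contDiffAt_timeV _).of_le (WithTop.coe_le_coe.2 le_top)
  contDiff_M := (T.contDiffAt_mixed _).of_le (WithTop.coe_le_coe.2 le_top)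
  contDiff_G₁ := (Setup.contDiffAt_slope T.contDiffAt_αst₁ T.contDiffAt_βst₁ T.density_jump₁_ne
    T.jumpV₁ T.η₀_sub_V₁₀_pos.ne').of_le (WithTop.coe_le_coe.2 le_top)
  contDiff_G₂ := contDiffAt_const.mul ((Setup.contDiffAt_slope T.contDiffAt_αst₂ T.contDiffAt_βst₂
    T.density_jump₂_ne T.jumpV₂ T.η₀_sub_V₂₀_pos.ne').of_le (WithTop.coe_le_coe.2 le_top))
  contDiff_h₁ := T.contDiffAt_behind₁.of_le (WithTop.coe_le_coe.2 le_top)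
  contDiff_h₂ := T.contDiffAt_behind₂.of_le (WithTop.coe_le_coe.2 le_top)
  G₁_base := T.slope₁_base
  G₂_base := T.slope₂_base
  h₁_base := T.hH₁val
  h₂_base := T.hH₂val
  h₁_deriv := by
    rw [fderiv_behind₁, Setup.timeU, Setup.timeV, T.cin_base, T.cout_base, ← T.α₀'_eq, a₀, dαm₁,
      dβm₁]
    ring
  h₂_deriv := by
    rw [fderiv_behind₂, Setup.timeU, Setup.timeV, T.cin_base, T.cout_base]
    refine Eq.trans ?_ T.β₀'_eq
    rw [b₀, dαm₂, dβm₂]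
    ring
  h₁_contr := by
    rw [fderiv_behind₁]
    simpa using T.abs_F₁₀_lt_one
  h₂_contr := by
    rw [fderiv_behind₂]
    simpa using T.abs_F₂₀_lt_one

end IterSetup

end InteractionSystem

section Agreement

variable {δ : ℝ}

theorem deriv_eq_of_eqOn {f g : ℝ → ℝ} {d u : ℝ} (h : EqOn f g (ball 0 δ))
    (hu : u ∈ ball (0 : ℝ) δ) (hg : HasDerivAt g d u) : deriv f u = d :=
  (hg.congr_of_eventuallyEq (h.eventuallyEq_of_mem (isOpen_ball.mem_nhds hu))).deriv

theorem eqOn_fst {f g : ℝ × ℝ → ℝ} {v : ℝ} (h : EqOn f g (ball 0 δ)) (hv : |v| < δ) :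
    EqOn (fun u => f (u, v)) (fun u => g (u, v)) (ball 0 δ) := fun _ hu =>
  h (mem_ball_prod.2 ⟨mem_ball_real.1 hu, hv⟩)

theorem eqOn_snd {f g : ℝ × ℝ → ℝ} {u : ℝ} (h : EqOn f g (ball 0 δ)) (hu : |u| < δ) :
    EqOn (fun v => f (u, v)) (fun v => g (u, v)) (ball 0 δ) := fun _ hv =>
  h (mem_ball_prod.2 ⟨hu, mem_ball_real.1 hv⟩)

theorem pu_eqOn {f g g' : ℝ × ℝ → ℝ} (h : EqOn f g (ball 0 δ))
    (hg : ∀ q ∈ ball (0 : ℝ × ℝ) δ, HasDerivAt (fun u => g (u, q.2)) (g' q) q.1) :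
    EqOn (pu f) g' (ball 0 δ) := fun q hq =>
  deriv_eq_of_eqOn (eqOn_fst h (mem_ball_prod.1 hq).2) (mem_ball_real.2 (mem_ball_prod.1 hq).1)
    (hg q hq)

theorem pv_eqOn {f g g' : ℝ × ℝ → ℝ} (h : EqOn f g (ball 0 δ))
    (hg : ∀ q ∈ ball (0 : ℝ × ℝ) δ, HasDerivAt (fun v => g (q.1, v)) (g' q) q.2) :
    EqOn (pv f) g' (ball 0 δ) := fun q hq =>
  deriv_eq_of_eqOn (eqOn_snd h (mem_ball_prod.1 hq).1) (mem_ball_real.2 (mem_ball_prod.1 hq).2)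
    (hg q hq)

theorem integral_eq_of_eqOn {f g : ℝ → ℝ} {b c : ℝ} (h : EqOn f g (ball 0 δ)) (hb : |b| < δ)
    (hc : |c| < δ) : ∫ t in b..c, f t = ∫ t in b..c, g t :=
  intervalIntegral.integral_congr (h.mono (uIcc_subset_ball hb hc))

/-- Agreement of a triple with a state on a box. -/
structure Triple.Agrees (δ : ℝ) (P : Triple) (s : State) : Prop where
  A : EqOn P.1 s.A (ball 0 δ)
  B : EqOn P.2.1 s.B (ball 0 δ)
  X : EqOn P.2.2 s.X (ball 0 δ)

variable {P : Triple} {s : State} {y : System}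

theorem Triple.Agrees.deriv_A (h : P.Agrees δ s) (hs : s.Reg y δ) :
    EqOn (deriv P.1) s.A₁ (ball 0 δ) := fun u hu =>
  deriv_eq_of_eqOn h.A hu (hs.dA u hu)

theorem Triple.Agrees.deriv_deriv_A (h : P.Agrees δ s) (hs : s.Reg y δ) :
    EqOn (deriv (deriv P.1)) s.A₂ (ball 0 δ) := fun u hu =>
  deriv_eq_of_eqOn (h.deriv_A hs) hu (hs.dA₁ u hu)

theorem Triple.Agrees.deriv_B (h : P.Agrees δ s) (hs : s.Reg y δ) :
    EqOn (deriv P.2.1) s.B₁ (ball 0 δ) := fun u hu =>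
  deriv_eq_of_eqOn h.B hu (hs.dB u hu)

theorem Triple.Agrees.deriv_deriv_B (h : P.Agrees δ s) (hs : s.Reg y δ) :
    EqOn (deriv (deriv P.2.1)) s.B₂ (ball 0 δ) := fun u hu =>
  deriv_eq_of_eqOn (h.deriv_B hs) hu (hs.dB₁ u hu)

theorem Triple.Agrees.pu_X (h : P.Agrees δ s) (hs : s.Reg y δ) :
    EqOn (pu P.2.2) s.P (ball 0 δ) := pu_eqOn h.X hs.dX.du

theorem Triple.Agrees.pv_X (h : P.Agrees δ s) (hs : s.Reg y δ) :
    EqOn (pv P.2.2) s.Q (ball 0 δ) := pv_eqOn h.X hs.dX.dv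

theorem Triple.Agrees.pu_pu_X (h : P.Agrees δ s) (hs : s.Reg y δ) :
    EqOn (pu fun q => pu P.2.2 q) s.Pu (ball 0 δ) := pu_eqOn (h.pu_X hs) hs.dP.du

theorem Triple.Agrees.pv_pu_X (h : P.Agrees δ s) (hs : s.Reg y δ) :
    EqOn (pv fun q => pu P.2.2 q) s.W (ball 0 δ) := pv_eqOn (h.pu_X hs) hs.dP.dv

theorem Triple.Agrees.pv_pv_X (h : P.Agrees δ s) (hs : s.Reg y δ) :
    EqOn (pv fun q => pv P.2.2 q) s.Qv (ball 0 δ) := pv_eqOn (h.pv_X hs) hs.dQ.dv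

namespace IterSetup

variable (T : IterSetup) (P : Triple)

/-- `∂t/∂u` for a triple. -/
def stepφ (q : ℝ × ℝ) : ℝ := T.timeU (P.1 q.1, P.2.1 q.2, pu P.2.2 q)

/-- `∂t/∂v` for a triple. -/
def stepψ (q : ℝ × ℝ) : ℝ := T.timeV (P.1 q.1, P.2.1 q.2, pv P.2.2 q)

/-- The time function of a triple. -/
def stepTime (q : ℝ × ℝ) : ℝ :=
  (∫ t in (0 : ℝ)..q.1, (stepφ T P (t, t) + stepψ T P (t, t))) + ∫ t in q.1..q.2, stepψ T P (q.1, t)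

/-- The slope factor along the left shock. -/
def stepΓ₁ (u : ℝ) : ℝ :=
  T.slope (αst₁ T.toSetup) (βst₁ T.toSetup) (P.1 u, P.2.1 u, stepTime T P (u, u), P.2.2 (u, u))

/-- The slope factor along the right shock. -/
def stepΓ₂ (v : ℝ) : ℝ :=
  aconst T.toSetup *
      (cout T.toSetup (P.1 (aconst T.toSetup * v)) (P.2.1 v) /
        cin T.toSetup (P.1 (aconst T.toSetup * v)) (P.2.1 v)) *
    ((T.shockSpeed (P.1 (aconst T.toSetup * v)) (P.2.1 v)
        (αst₂ T.toSetup (stepTime T P (aconst T.toSetup * v, v), P.2.2 (aconst T.toSetup * v, v)))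
        (βst₂ T.toSetup (stepTime T P (aconst T.toSetup * v, v), P.2.2 (aconst T.toSetup * v, v)))
        - cin T.toSetup (P.1 (aconst T.toSetup * v)) (P.2.1 v)) /
      (cout T.toSetup (P.1 (aconst T.toSetup * v)) (P.2.1 v) -
        T.shockSpeed (P.1 (aconst T.toSetup * v)) (P.2.1 v)
        (αst₂ T.toSetup (stepTime T P (aconst T.toSetup * v, v), P.2.2 (aconst T.toSetup * v, v)))
        (βst₂ T.toSetup (stepTime T P (aconst T.toSetup * v, v), P.2.2 (aconst T.toSetup * v, v)))))

/-- The incoming characteristic speed of a triple. -/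
def stepCin (q : ℝ × ℝ) : ℝ := cin T.toSetup (P.1 q.1) (P.2.1 q.2)

/-- The outgoing characteristic speed of a triple. -/
def stepCout (q : ℝ × ℝ) : ℝ := cout T.toSetup (P.1 q.1) (P.2.1 q.2)

/-- The right-hand side of the equation for the mixed derivative of `x`. -/
def stepM (q : ℝ × ℝ) : ℝ :=
  1 / (stepCout T P q - stepCin T P q) * (stepCout T P q / stepCin T P q) * pv (stepCin T P) q
      * pu P.2.2 q
    + -(1 / (stepCout T P q - stepCin T P q) * (stepCin T P q / stepCout T P q)
      * pu (stepCout T P) q) * pv P.2.2 q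

/-- The ratio of the slope factors at a point of the right shock and the point of the left shock
on the same outgoing characteristic. -/
def stepγ₁ (u : ℝ) : ℝ := stepΓ₂ T P u / stepΓ₁ T P u

/-- The ratio of the slope factors at a point of the right shock and the point of the left shock
on the same incoming characteristic. -/
def stepγ₂ (v : ℝ) : ℝ := stepΓ₂ T P v / stepΓ₁ T P (aconst T.toSetup * v)

/-- The integrand `Λ¹`. -/
def stepΛ₁ (u : ℝ) : ℝ :=
  deriv (stepγ₁ T P) u * pu P.2.2 (aconst T.toSetup * u, u)
    + aconst T.toSetup * stepγ₁ T P u * pu (fun q => pu P.2.2 q) (aconst T.toSetup * u, u)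
    + stepγ₁ T P u * stepM T P (aconst T.toSetup * u, u)

/-- The integrand `Λ²`. -/
def stepΛ₂ (v : ℝ) : ℝ :=
  deriv (stepγ₂ T P) v * pv P.2.2 (aconst T.toSetup * v, aconst T.toSetup * v)
    + aconst T.toSetup * stepγ₂ T P v *
      pv (fun q => pv P.2.2 q) (aconst T.toSetup * v, aconst T.toSetup * v)
    + aconst T.toSetup * stepγ₂ T P v * stepM T P (aconst T.toSetup * v, aconst T.toSetup * v)

/-- The boundary term `Φ¹`. -/
def stepΦ₁ (u : ℝ) : ℝ :=
  (∫ t in (0 : ℝ)..u, stepΛ₁ T P t)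
    + (1 / stepΓ₁ T P u) * ∫ t in (aconst T.toSetup * u)..u, stepM T P (t, u)

/-- The boundary term `Φ²`. -/
def stepΦ₂ (v : ℝ) : ℝ :=
  (∫ t in (0 : ℝ)..v, stepΛ₂ T P t)
    + stepΓ₂ T P v * ∫ t in (aconst T.toSetup * v)..v, stepM T P (aconst T.toSetup * v, t)

theorem step_eq : step T P =
    (fun u => T.behind₁ (P.2.1 u, stepTime T P (u, u), P.2.2 (u, u)),
      fun v => T.behind₂ (P.1 (aconst T.toSetup * v), stepTime T P (aconst T.toSetup * v, v),
        P.2.2 (aconst T.toSetup * v, v)),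
      fun q => q.1 / Γ₀ T.toSetup + q.2 + (∫ t in (0 : ℝ)..q.1, stepΦ₁ T P t)
        + (∫ t in (0 : ℝ)..q.2, stepΦ₂ T P t)
        + (∫ v in (0 : ℝ)..q.1, ∫ u in (aconst T.toSetup * v)..v, stepM T P (u, v))
        + ∫ v in q.1..q.2, ∫ u in (aconst T.toSetup * v)..q.1, stepM T P (u, v)) :=
  rfl

section

variable {T P} {s : State} (h : P.Agrees δ s) (hs : s.Reg T.system δ)
  (hn : T.system.Nice s δ)

include h

theorem X_left {u : ℝ} (hu : u ∈ ball (0 : ℝ) δ) : P.2.2 (u, u) = T.system.lx s u :=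
  h.X (mem_ball_prod.2 ⟨mem_ball_real.1 hu, mem_ball_real.1 hu⟩)

theorem X_right {v : ℝ} (hv : v ∈ ball (0 : ℝ) δ) :
    P.2.2 (aconst T.toSetup * v, v) = T.system.rx s v :=
  h.X (mem_ball_prod.2 ⟨System.abs_a_mul_lt (y := T.system) hv, mem_ball_real.1 hv⟩)

theorem A_right {v : ℝ} (hv : v ∈ ball (0 : ℝ) δ) :
    P.1 (aconst T.toSetup * v) = s.A (aconst T.toSetup * v) :=
  h.A (mem_ball_real.2 (System.abs_a_mul_lt (y := T.system) hv))

include hs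

theorem stepφ_agrees : EqOn (stepφ T P) (T.system.φ s) (ball 0 δ) := fun q hq => by
  rw [stepφ, h.A (mem_ball_real.2 (mem_ball_prod.1 hq).1),
    h.B (mem_ball_real.2 (mem_ball_prod.1 hq).2), h.pu_X hs hq]
  rfl

theorem stepψ_agrees : EqOn (stepψ T P) (T.system.ψ s) (ball 0 δ) := fun q hq => by
  rw [stepψ, h.A (mem_ball_real.2 (mem_ball_prod.1 hq).1),
    h.B (mem_ball_real.2 (mem_ball_prod.1 hq).2), h.pv_X hs hq]
  rfl

theorem integral_diagonal_agrees {u : ℝ} (hu : |u| < δ) :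
    ∫ t in (0 : ℝ)..u, (stepφ T P (t, t) + stepψ T P (t, t)) = T.system.lt s u := by
  refine integral_eq_of_eqOn (fun t ht => ?_) (by simpa using (abs_nonneg u).trans_lt hu) hu
  have := mem_ball_real.1 ht
  exact congrArg₂ (· + ·) (stepφ_agrees h hs (mem_ball_prod.2 ⟨this, this⟩))
    (stepψ_agrees h hs (mem_ball_prod.2 ⟨this, this⟩))

theorem stepTime_left {u : ℝ} (hu : u ∈ ball (0 : ℝ) δ) :
    stepTime T P (u, u) = T.system.lt s u := by
  rw [stepTime, integral_diagonal_agrees h hs (mem_ball_real.1 hu), intervalIntegral.integral_same,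
    add_zero]

theorem stepTime_right {v : ℝ} (hv : v ∈ ball (0 : ℝ) δ) :
    stepTime T P (aconst T.toSetup * v, v) = T.system.rt s v := by
  have hv' := mem_ball_real.1 hv
  have hav : |aconst T.toSetup * v| < δ := System.abs_a_mul_lt (y := T.system) hv
  rw [stepTime, integral_diagonal_agrees h hs hav,
    integral_eq_of_eqOn (eqOn_snd (stepψ_agrees h hs) hav) hav hv']
  rfl

theorem stepΓ₁_agrees : EqOn (stepΓ₁ T P) (T.system.g₁ s) (ball 0 δ) := fun u hu => by
  rw [stepΓ₁, h.A hu, h.B hu, stepTime_left h hs hu, X_left h hu]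
  rfl

theorem stepΓ₂_agrees : EqOn (stepΓ₂ T P) (T.system.g₂ s) (ball 0 δ) := fun v hv => by
  rw [stepΓ₂, A_right h hv, h.B hv, stepTime_right h hs hv, X_right h hv, mul_assoc]
  rfl

theorem pv_stepCin {q : ℝ × ℝ} (hq : q ∈ ball (0 : ℝ × ℝ) δ) : pv (stepCin T P) q =
    fderiv ℝ (fun w : ℝ × ℝ => cin T.toSetup w.1 w.2) (s.A q.1, s.B q.2) (0, 1) * s.B₁ q.2 := by
  have hq1 := mem_ball_real.2 (mem_ball_prod.1 hq).1
  have hq2 := mem_ball_real.2 (mem_ball_prod.1 hq).2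
  have hc : HasDerivAt (fun t => (s.A q.1, s.B t)) (0, s.B₁ q.2) q.2 :=
    (hasDerivAt_const _ _).prodMk (hs.dB _ hq2)
  have hd := ((T.contDiff_cin.differentiable (by simp) (s.A q.1, s.B q.2)).hasFDerivAt).comp_hasDerivAt
    q.2 hc
  refine (deriv_eq_of_eqOn (fun t ht => ?_) hq2 hd).trans ?_
  · rw [stepCin, h.A hq1, h.B ht]
    rfl
  · rw [show ((0 : ℝ), s.B₁ q.2) = s.B₁ q.2 • ((0 : ℝ), (1 : ℝ)) by simp, map_smul, smul_eq_mul,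
      mul_comm]

theorem pu_stepCout {q : ℝ × ℝ} (hq : q ∈ ball (0 : ℝ × ℝ) δ) : pu (stepCout T P) q =
    fderiv ℝ (fun w : ℝ × ℝ => cout T.toSetup w.1 w.2) (s.A q.1, s.B q.2) (1, 0) * s.A₁ q.1 := by
  have hq1 := mem_ball_real.2 (mem_ball_prod.1 hq).1
  have hq2 := mem_ball_real.2 (mem_ball_prod.1 hq).2
  have hc : HasDerivAt (fun t => (s.A t, s.B q.2)) (s.A₁ q.1, 0) q.1 :=
    (hs.dA _ hq1).prodMk (hasDerivAt_const _ _)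
  have hd := ((T.contDiff_cout.differentiable (by simp) (s.A q.1, s.B q.2)).hasFDerivAt).comp_hasDerivAt
    q.1 hc
  refine (deriv_eq_of_eqOn (fun t ht => ?_) hq1 hd).trans ?_
  · rw [stepCout, h.A ht, h.B hq2]
    rfl
  · rw [show (s.A₁ q.1, (0 : ℝ)) = s.A₁ q.1 • ((1 : ℝ), (0 : ℝ)) by simp, map_smul, smul_eq_mul,
      mul_comm]

theorem stepM_agrees : EqOn (stepM T P) (T.system.m s) (ball 0 δ) := fun q hq => by
  rw [stepM, pv_stepCin h hs hq, pu_stepCout h hs hq, h.pu_X hs hq, h.pv_X hs hq, stepCin,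
    stepCout, h.A (mem_ball_real.2 (mem_ball_prod.1 hq).1),
    h.B (mem_ball_real.2 (mem_ball_prod.1 hq).2)]
  rfl

theorem stepγ₁_agrees : EqOn (stepγ₁ T P) (T.system.γ₁ s) (ball 0 δ) := fun u hu => by
  rw [stepγ₁, stepΓ₁_agrees h hs hu, stepΓ₂_agrees h hs hu]
  rfl

theorem stepγ₂_agrees : EqOn (stepγ₂ T P) (T.system.γ₂ s) (ball 0 δ) := fun u hu => by
  have hau : |aconst T.toSetup * u| < δ := System.abs_a_mul_lt (y := T.system) hu
  rw [stepγ₂, stepΓ₁_agrees h hs (mem_ball_real.2 hau), stepΓ₂_agrees h hs hu]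
  rfl

include hn

theorem stepΛ₁_agrees : EqOn (stepΛ₁ T P) (T.system.Λ₁ s) (ball 0 δ) := fun u hu => by
  have hm : (aconst T.toSetup * u, u) ∈ ball (0 : ℝ × ℝ) δ :=
    mem_ball_prod.2 ⟨System.abs_a_mul_lt (y := T.system) hu, mem_ball_real.1 hu⟩
  rw [stepΛ₁, deriv_eq_of_eqOn (stepγ₁_agrees h hs) hu (System.hasDerivAt_γ₁ hs hn hu),
    h.pu_pu_X hs hm, h.pu_X hs hm, stepM_agrees h hs hm,
    stepγ₁_agrees h hs hu]
  rfl

theorem stepΛ₂_agrees : EqOn (stepΛ₂ T P) (T.system.Λ₂ s) (ball 0 δ) := fun v hv => by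
  have hav : |aconst T.toSetup * v| < δ := System.abs_a_mul_lt (y := T.system) hv
  have hm : (aconst T.toSetup * v, aconst T.toSetup * v) ∈ ball (0 : ℝ × ℝ) δ :=
    mem_ball_prod.2 ⟨hav, hav⟩
  rw [stepΛ₂, deriv_eq_of_eqOn (stepγ₂_agrees h hs) hv (System.hasDerivAt_γ₂ hs hn hv),
    h.pv_pv_X hs hm, h.pv_X hs hm, stepM_agrees h hs hm,
    stepγ₂_agrees h hs hv]
  rfl

theorem stepΦ₁_agrees : EqOn (stepΦ₁ T P) (T.system.Φ₁ s) (ball 0 δ) := fun u hu => by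
  have hu' := mem_ball_real.1 hu
  have hau : |aconst T.toSetup * u| < δ := System.abs_a_mul_lt (y := T.system) hu
  rw [stepΦ₁, integral_eq_of_eqOn (stepΛ₁_agrees h hs hn)
      (by simpa using (abs_nonneg u).trans_lt hu') hu', stepΓ₁_agrees h hs hu,
    integral_eq_of_eqOn (eqOn_fst (stepM_agrees h hs) hu') hau hu']
  rfl

theorem stepΦ₂_agrees : EqOn (stepΦ₂ T P) (T.system.Φ₂ s) (ball 0 δ) := fun v hv => by
  have hv' := mem_ball_real.1 hv
  have hav : |aconst T.toSetup * v| < δ := System.abs_a_mul_lt (y := T.system) hv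
  rw [stepΦ₂, integral_eq_of_eqOn (stepΛ₂_agrees h hs hn)
      (by simpa using (abs_nonneg v).trans_lt hv') hv', stepΓ₂_agrees h hs hv,
    integral_eq_of_eqOn (eqOn_snd (stepM_agrees h hs) hav) hav hv']
  rfl

theorem step_agrees : (step T P).Agrees δ (T.system.next s) := by
  rw [step_eq]
  refine ⟨fun u hu => ?_, fun v hv => ?_, fun q hq => ?_⟩
  · dsimp only
    rw [h.B hu, stepTime_left h hs hu, X_left h hu]
    rfl
  · dsimp only
    rw [A_right h hv, stepTime_right h hs hv, X_right h hv]
    rfl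
  · have hq1 := (mem_ball_prod.1 hq).1
    have hq2 := (mem_ball_prod.1 hq).2
    have h0 : |(0 : ℝ)| < δ := by simpa using (abs_nonneg q.1).trans_lt hq1
    have e1 : EqOn (fun v => ∫ u in (aconst T.toSetup * v)..v, stepM T P (u, v))
        (fun v => ∫ u in (aconst T.toSetup * v)..v, T.system.m s (u, v)) (ball 0 δ) := fun v hv =>
      integral_eq_of_eqOn (eqOn_fst (stepM_agrees h hs) (mem_ball_real.1 hv))
        (System.abs_a_mul_lt (y := T.system) hv) (mem_ball_real.1 hv)
    have e2 : EqOn (fun v => ∫ u in (aconst T.toSetup * v)..q.1, stepM T P (u, v))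
        (fun v => ∫ u in (aconst T.toSetup * v)..q.1, T.system.m s (u, v)) (ball 0 δ) := fun v hv =>
      integral_eq_of_eqOn (eqOn_fst (stepM_agrees h hs) (mem_ball_real.1 hv))
        (System.abs_a_mul_lt (y := T.system) hv) hq1
    dsimp only
    rw [integral_eq_of_eqOn (stepΦ₁_agrees h hs hn) h0 hq1,
      integral_eq_of_eqOn (stepΦ₂_agrees h hs hn) h0 hq2, integral_eq_of_eqOn e1 h0 hq1,
      integral_eq_of_eqOn e2 hq1 hq2]
    rfl

end

variable {T} in
theorem seq_agrees (hs : ∀ n, (T.system.iter n).Reg T.system δ)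
    (hn : ∀ n, T.system.Nice (T.system.iter n) δ) (n : ℕ) :
    (seq T n).Agrees δ (T.system.iter n) := by
  induction n with
  | zero => exact ⟨fun _ _ => rfl, fun _ _ => rfl, fun _ _ => rfl⟩
  | succ n ih =>
    rw [System.iter_succ]
    exact step_agrees ih (hs n) (hn n)

end IterSetup

end Agreement

section Transfer

variable {δ : ℝ}

theorem tendstoUniformlyOn_of_eqOn {Y : Type*} {f g : ℕ → Y → ℝ} {f' g' : Y → ℝ} {t t' : Set Y}
    (h : TendstoUniformlyOn g g' atTop t) (ht : t' ⊆ t) (hf : ∀ n, EqOn (f n) (g n) t)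
    (hf' : EqOn f' g' t) : TendstoUniformlyOn f f' atTop t' :=
  ((h.congr (Eventually.of_forall fun n => (hf n).symm)).congr_right hf'.symm).mono ht

theorem Icc_subset_ball {b : ℝ} (hb : b < δ) : Icc 0 b ⊆ ball (0 : ℝ) δ := fun _ hu =>
  mem_ball_real.2 ((abs_of_nonneg hu.1).trans_lt (hu.2.trans_lt hb))

theorem Teps_subset_ball {a ε : ℝ} (hε : ε < δ) : Teps a ε ⊆ ball 0 δ := by
  rintro q ⟨h0, h1, h2, h3⟩
  have hv : |q.2| < δ := by
    rw [abs_of_nonneg (h0.trans h1)]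
    linarith
  exact mem_ball_prod.2 ⟨(abs_le_abs_of_nonneg h0 h1).trans_lt hv, hv⟩

end Transfer

/-- **Convergence of the iteration.**
For `ε` sufficiently small, the sequence of iterates `(α¹₊,ₙ, β²₊,ₙ, xₙ)` of the shock
interaction iteration scheme converges in `B_A × B_B × B_{N₀}`: the `α¹₊,ₙ`, `β²₊,ₙ` and
`xₙ` converge uniformly, together with all their derivatives up to second order, to limits
`α¹₊ ∈ B_A`, `β²₊ ∈ B_B`, `x ∈ B_{N₀}`. -/
theorem iteration_converges (T : IterSetup) :
    ∃ A B N₀ : ℝ, 0 < A ∧ 0 < B ∧ 0 < N₀ ∧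
      ∃ ε₀ > (0 : ℝ), ∀ ε : ℝ, 0 < ε → ε ≤ ε₀ →
        ∃ αp βp : ℝ → ℝ, ∃ x : ℝ × ℝ → ℝ,
          memBA T.toSetup ε A αp ∧ memBB T.toSetup ε B βp ∧ memBN T.toSetup ε N₀ x ∧
          TendstoUniformlyOn (fun n => (seq T n).1) αp atTop
            (Icc (0 : ℝ) (aconst T.toSetup * ε)) ∧
          TendstoUniformlyOn (fun n => deriv (seq T n).1) (deriv αp) atTop
            (Icc (0 : ℝ) (aconst T.toSetup * ε)) ∧
          TendstoUniformlyOn (fun n => deriv (deriv (seq T n).1)) (deriv (deriv αp)) atTop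
            (Icc (0 : ℝ) (aconst T.toSetup * ε)) ∧
          TendstoUniformlyOn (fun n => (seq T n).2.1) βp atTop (Icc (0 : ℝ) ε) ∧
          TendstoUniformlyOn (fun n => deriv (seq T n).2.1) (deriv βp) atTop
            (Icc (0 : ℝ) ε) ∧
          TendstoUniformlyOn (fun n => deriv (deriv (seq T n).2.1)) (deriv (deriv βp)) atTop
            (Icc (0 : ℝ) ε) ∧
          TendstoUniformlyOn (fun n => (seq T n).2.2) x atTop
            (Teps (aconst T.toSetup) ε) ∧
          TendstoUniformlyOn (fun n => pu (seq T n).2.2) (pu x) atTop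
            (Teps (aconst T.toSetup) ε) ∧
          TendstoUniformlyOn (fun n => pv (seq T n).2.2) (pv x) atTop
            (Teps (aconst T.toSetup) ε) ∧
          TendstoUniformlyOn (fun n => pu (fun q => pu (seq T n).2.2 q))
            (pu (fun q => pu x q)) atTop (Teps (aconst T.toSetup) ε) ∧
          TendstoUniformlyOn (fun n => pv (fun q => pu (seq T n).2.2 q))
            (pv (fun q => pu x q)) atTop (Teps (aconst T.toSetup) ε) ∧
          TendstoUniformlyOn (fun n => pv (fun q => pv (seq T n).2.2 q))
            (pv (fun q => pv x q)) atTop (Teps (aconst T.toSetup) ε) := by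
  obtain ⟨N, δ, hN, hδ, hreg, hnice, s, hs, hb, hl⟩ := T.system.exists_limit
  have hag := IterSetup.seq_agrees hreg hnice
  have hlim : Triple.Agrees δ (s.A, s.B, s.X) s :=
    ⟨fun _ _ => rfl, fun _ _ => rfl, fun _ _ => rfl⟩
  refine ⟨N + 1, N + 1, N + 1, by linarith, by linarith, by linarith, δ / 2, by linarith,
    fun ε hε hε' => ⟨s.A, s.B, s.X, ?_⟩⟩
  have hεδ : ε < δ := by linarith
  have ha : Icc 0 (aconst T.toSetup * ε) ⊆ ball (0 : ℝ) δ :=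
    Icc_subset_ball ((mul_le_of_le_one_left hε.le T.aconst_lt_one.le).trans_lt hεδ)
  have hI : Icc 0 ε ⊆ ball (0 : ℝ) δ := Icc_subset_ball hεδ
  have hT : Teps (aconst T.toSetup) ε ⊆ ball 0 δ := Teps_subset_ball hεδ
  have h0 : (0 : ℝ) ∈ ball (0 : ℝ) δ := mem_ball_self hδ
  have h00 : ((0, 0) : ℝ × ℝ) ∈ ball (0 : ℝ × ℝ) δ := mem_ball_self hδ
  refine ⟨⟨(contDiffOn_two_of_hasDerivAt hs.dA hs.dA₁ hs.cA₂).mono ha, hs.A_zero,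
      (hlim.deriv_A hs h0).trans hs.A₁_zero, fun u hu => ?_⟩,
    ⟨(contDiffOn_two_of_hasDerivAt hs.dB hs.dB₁ hs.cB₂).mono hI, hs.B_zero,
      (hlim.deriv_B hs h0).trans hs.B₁_zero, fun u hu => ?_⟩,
    ⟨hs.contDiffOn_X.mono hT, hs.X_zero, (hlim.pu_X hs h00).trans hs.P_zero,
      (hlim.pv_X hs h00).trans hs.Q_zero, fun q hq => ⟨?_, ?_, ?_⟩⟩,
    tendstoUniformlyOn_of_eqOn hl.A ha (fun n => (hag n).A) hlim.A,
    tendstoUniformlyOn_of_eqOn hl.A₁ ha (fun n => (hag n).deriv_A (hreg n)) (hlim.deriv_A hs),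
    tendstoUniformlyOn_of_eqOn hl.A₂ ha (fun n => (hag n).deriv_deriv_A (hreg n))
      (hlim.deriv_deriv_A hs),
    tendstoUniformlyOn_of_eqOn hl.B hI (fun n => (hag n).B) hlim.B,
    tendstoUniformlyOn_of_eqOn hl.B₁ hI (fun n => (hag n).deriv_B (hreg n)) (hlim.deriv_B hs),
    tendstoUniformlyOn_of_eqOn hl.B₂ hI (fun n => (hag n).deriv_deriv_B (hreg n))
      (hlim.deriv_deriv_B hs),
    tendstoUniformlyOn_of_eqOn hl.X hT (fun n => (hag n).X) hlim.X,
    tendstoUniformlyOn_of_eqOn hl.P hT (fun n => (hag n).pu_X (hreg n)) (hlim.pu_X hs),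
    tendstoUniformlyOn_of_eqOn hl.Q hT (fun n => (hag n).pv_X (hreg n)) (hlim.pv_X hs),
    tendstoUniformlyOn_of_eqOn hl.Pu hT (fun n => (hag n).pu_pu_X (hreg n)) (hlim.pu_pu_X hs),
    tendstoUniformlyOn_of_eqOn hl.W hT (fun n => (hag n).pv_pu_X (hreg n)) (hlim.pv_pu_X hs),
    tendstoUniformlyOn_of_eqOn hl.Qv hT (fun n => (hag n).pv_pv_X (hreg n)) (hlim.pv_pv_X hs)⟩
  · exact (congrArg abs (hlim.deriv_deriv_A hs (ha hu))).le.trans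
      ((hb.A₂ u (ha hu)).trans (by linarith))
  · exact (congrArg abs (hlim.deriv_deriv_B hs (hI hu))).le.trans
      ((hb.B₂ u (hI hu)).trans (by linarith))
  · exact (congrArg abs (hlim.pu_pu_X hs (hT hq))).le.trans
      ((hb.Pu q (hT hq)).trans (by linarith))
  · exact (congrArg abs (hlim.pv_pu_X hs (hT hq))).le.trans
      ((hb.W q (hT hq)).trans (by linarith))
  · exact (congrArg abs (hlim.pv_pv_X hs (hT hq))).le.trans
      ((hb.Qv q (hT hq)).trans (by linarith))

end ShockInteraction
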